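/- Let ℓ be a prime. The only solutions in integers x ≥ 1, y to the equation (x+1)³ + (x+2)³ + ⋯ + (x+50)³ = yˡ are (x, y, ℓ) = (1224, ±312375, 2). -/

import Mathlib

open Finset Matrix

/-- A matrix with injective action on column vectors has a nonzero maximal minor. -/
theorem exists_det_submatrix_ne_zero {m n : Type} [Fintype m] [Fintype n] [DecidableEq n]
    (M : Matrix m n ℝ) (hM : ∀ v, M *ᵥ v = 0 → v = 0) :
    ∃ f : n → m, (M.submatrix f id).det ≠ 0 := by
  have hrank : M.rank = Fintype.card n := by
    have hker : LinearMap.ker M.mulVecLin = ⊥ := by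
      rw [LinearMap.ker_eq_bot']
      intro v hv
      exact hM v hv
    have := LinearMap.finrank_range_add_finrank_ker M.mulVecLin
    rw [hker, finrank_bot, add_zero, Module.finrank_fintype_fun_eq_card] at this
    exact this
  obtain ⟨κ, a, ha, hspan, hli⟩ := exists_linearIndependent' ℝ M.row
  have : Finite κ := Finite.of_injective a ha
  have := Fintype.ofFinite κ
  have hcard : Fintype.card κ = Fintype.card n := by
    rw [← hrank, Matrix.rank_eq_finrank_span_row, ← hspan, finrank_span_eq_card hli]
  let e : n ≃ κ := (Fintype.equivOfCardEq hcard).symm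
  refine ⟨a ∘ e, ?_⟩
  have hli' : LinearIndependent ℝ (M.submatrix (a ∘ e) id).row := by
    have := hli.comp e e.injective
    exact this
  rw [Matrix.linearIndependent_rows_iff_isUnit, Matrix.isUnit_iff_isUnit_det] at hli'
  exact hli'.ne_zero

/-- Weighted expansion bound for the determinant of a product. -/
theorem abs_det_mul_le {n M : Type} [Fintype n] [DecidableEq n] [Fintype M] [DecidableEq M]
    (Z : Matrix n M ℝ) (C : Matrix M n ℝ) (w : M → ℕ) (W : ℕ) (ρ : ℝ) (hρ : 1 ≤ ρ) (F : n → ℝ)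
    (hW : ∀ p : n → M, Function.Injective p → W ≤ ∑ i, w (p i))
    (hF : ∀ i j, ∑ m, ρ ^ w m * (|Z i m| * |C m j|) ≤ F j) :
    ρ ^ W * |(Z * C).det| ≤ (Fintype.card n).factorial * ∏ j, F j := by
  have hρ0 : 0 < ρ := by linarith
  have hexp : (Z * C).det = ∑ p : n → M, (∏ i, Z i (p i)) * (C.submatrix p id).det := by
    have h := (Matrix.detRowAlternating (n := n) (R := ℝ)).toMultilinearMap.map_sum
      (fun i (m : M) => Z i m • C m)
    have h1 : (fun i => ∑ m, Z i m • C m) = (Z * C) := by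
      ext i j
      simp [Matrix.mul_apply, Finset.sum_apply]
    rw [h1] at h
    change (Z * C).det = _ at h
    rw [h]
    refine Finset.sum_congr rfl fun p _ => ?_
    have := (Matrix.detRowAlternating (n := n) (R := ℝ)).toMultilinearMap.map_smul_univ
      (fun i => Z i (p i)) (fun i => C (p i))
    rw [this]
    rfl
  have hterm : ∀ p : n → M, ρ ^ W * |(∏ i, Z i (p i)) * (C.submatrix p id).det| ≤
      ∑ σ : Equiv.Perm n, ∏ i, ρ ^ w (p (σ i)) * (|Z (σ i) (p (σ i))| * |C (p (σ i)) i|) := by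
    intro p
    have hnn : 0 ≤ ∑ σ : Equiv.Perm n,
        ∏ i, ρ ^ w (p (σ i)) * (|Z (σ i) (p (σ i))| * |C (p (σ i)) i|) :=
      Finset.sum_nonneg fun σ _ => Finset.prod_nonneg fun i _ => by positivity
    by_cases hp : Function.Injective p
    · have hdet : |(C.submatrix p id).det| ≤ ∑ σ : Equiv.Perm n, ∏ i, |C (p (σ i)) i| := by
        rw [Matrix.det_apply]
        refine (Finset.abs_sum_le_sum_abs _ _).trans (Finset.sum_le_sum fun σ _ => ?_)
        rw [Units.smul_def, zsmul_eq_mul, abs_mul, Finset.abs_prod]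
        have : |((Equiv.Perm.sign σ : ℤˣ) : ℤ)| = 1 := Int.isUnit_iff_abs_eq.mp (Units.isUnit _)
        rw [← Int.cast_abs, this]
        simp
      calc ρ ^ W * |(∏ i, Z i (p i)) * (C.submatrix p id).det|
          ≤ ρ ^ (∑ i, w (p i)) * ((∏ i, |Z i (p i)|) * ∑ σ : Equiv.Perm n, ∏ i, |C (p (σ i)) i|) := by
            rw [abs_mul, Finset.abs_prod]
            have := hW p hp
            gcongr
        _ = _ := by
            rw [Finset.mul_sum, Finset.mul_sum]
            refine Finset.sum_congr rfl fun σ _ => ?_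
            rw [Finset.prod_mul_distrib, Finset.prod_mul_distrib, Finset.prod_pow_eq_pow_sum,
              Equiv.sum_comp σ (fun i => w (p i)), Equiv.prod_comp σ (fun i => |Z i (p i)|)]
    · have : (C.submatrix p id).det = 0 := by
        simp only [Function.Injective, not_forall] at hp
        obtain ⟨i, j, hij, hne⟩ := hp
        exact Matrix.det_zero_of_row_eq hne (by ext k; simp [hij])
      rw [this]
      simpa using hnn
  calc ρ ^ W * |(Z * C).det|
      ≤ ∑ p : n → M, ρ ^ W * |(∏ i, Z i (p i)) * (C.submatrix p id).det| := by
        rw [hexp, ← Finset.mul_sum]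
        gcongr
        exact Finset.abs_sum_le_sum_abs _ _
    _ ≤ ∑ p : n → M, ∑ σ : Equiv.Perm n,
          ∏ i, ρ ^ w (p (σ i)) * (|Z (σ i) (p (σ i))| * |C (p (σ i)) i|) :=
        Finset.sum_le_sum fun p _ => hterm p
    _ = ∑ σ : Equiv.Perm n, ∏ i, ∑ m, ρ ^ w m * (|Z (σ i) m| * |C m i|) := by
        rw [Finset.sum_comm]
        refine Finset.sum_congr rfl fun σ _ => ?_
        rw [Finset.prod_univ_sum, Fintype.piFinset_univ]
        exact Fintype.sum_equiv (σ.symm.arrowCongr (Equiv.refl M)) _ _ fun p => by simp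
    _ ≤ ∑ σ : Equiv.Perm n, ∏ j, F j := by
        refine Finset.sum_le_sum fun σ _ => Finset.prod_le_prod (fun i _ => ?_) fun i _ => hF _ _
        exact Finset.sum_nonneg fun m _ => by positivity
    _ = _ := by
        rw [Finset.sum_const, Finset.card_univ, Fintype.card_perm, nsmul_eq_mul]

theorem sum_range_le_sum_of_injOn {n : Type} [Fintype n] (v : n → ℕ)
    (hv : ∀ i j, v i = v j → v i < Fintype.card n → i = j) :
    ∑ t ∈ range (Fintype.card n), t ≤ ∑ i, v i := by
  classical
  set N := Fintype.card n
  have h1 : ∀ i, #{t ∈ range N | t < v i} ≤ v i := fun i => by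
    calc #{t ∈ range N | t < v i} ≤ #(range (v i)) := card_le_card fun t ht => by
          simp only [mem_filter, mem_range] at ht ⊢; exact ht.2
      _ = v i := card_range _
  have h2 : ∀ t ∈ range N, N - 1 - t ≤ #{i : n | t < v i} := fun t ht => by
    have hle : #{i : n | ¬ t < v i} ≤ t + 1 := by
      calc #{i : n | ¬ t < v i} ≤ #(range (t + 1)) := by
            refine card_le_card_of_injOn v (fun i hi => ?_) fun i hi j hj hij => ?_
            · simp at hi ⊢; omega
            · simp at hi ht
              exact hv i j hij (by omega)
        _ = t + 1 := card_range _
    have := card_filter_add_card_filter_not (s := (univ : Finset n)) (fun i => t < v i)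
    rw [card_univ] at this
    omega
  calc ∑ t ∈ range N, t = ∑ t ∈ range N, (N - 1 - t) := (sum_range_reflect (fun t => t) N).symm
    _ ≤ ∑ t ∈ range N, #{i : n | t < v i} := sum_le_sum h2
    _ = ∑ i, #{t ∈ range N | t < v i} := sum_card_bipartiteAbove_eq_sum_card_bipartiteBelow _
    _ ≤ ∑ i, v i := sum_le_sum fun i _ => h1 i

/-- The value at `Y` of the polynomial whose coefficients are the absolute values of those of `p`. -/
noncomputable def majorant (p : Polynomial ℝ) (Y : ℝ) : ℝ := p.sum fun m c => |c| * Y ^ m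

theorem majorant_eq_sum_range (p : Polynomial ℝ) (Y : ℝ) {D : ℕ} (hD : p.natDegree < D) :
    majorant p Y = ∑ m ∈ range D, |p.coeff m| * Y ^ m :=
  p.sum_over_range' (by simp) D hD

theorem majorant_nonneg (p : Polynomial ℝ) {Y : ℝ} (hY : 0 ≤ Y) : 0 ≤ majorant p Y :=
  Finset.sum_nonneg fun _ _ => by positivity

theorem majorant_add_le (p q : Polynomial ℝ) {Y : ℝ} (hY : 0 ≤ Y) :
    majorant (p + q) Y ≤ majorant p Y + majorant q Y := by
  set D := max p.natDegree q.natDegree + 1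
  have hp : p.natDegree < D := by omega
  have hq : q.natDegree < D := by omega
  have hpq : (p + q).natDegree < D := by
    have := Polynomial.natDegree_add_le p q
    omega
  rw [majorant_eq_sum_range p Y hp, majorant_eq_sum_range q Y hq, majorant_eq_sum_range _ Y hpq,
    ← sum_add_distrib]
  refine sum_le_sum fun m _ => ?_
  rw [Polynomial.coeff_add, ← add_mul]
  gcongr
  exact abs_add_le _ _

theorem majorant_monomial_mul (n : ℕ) (a : ℝ) (q : Polynomial ℝ) (Y : ℝ) :
    majorant (Polynomial.monomial n a * q) Y = |a| * Y ^ n * majorant q Y := by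
  have hD : (Polynomial.monomial n a * q).natDegree < n + (q.natDegree + 1) := by
    have h1 := Polynomial.natDegree_mul_le (p := Polynomial.monomial n a) (q := q)
    have h2 := Polynomial.natDegree_monomial_le (m := n) a
    omega
  rw [majorant_eq_sum_range _ Y hD, majorant_eq_sum_range q Y (Nat.lt_succ_self _),
    sum_range_add, mul_sum]
  have h0 : ∑ x ∈ range n, |(Polynomial.monomial n a * q).coeff x| * Y ^ x = 0 := by
    refine sum_eq_zero fun x hx => ?_
    rw [← Polynomial.C_mul_X_pow_eq_monomial, mul_assoc, Polynomial.coeff_C_mul,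
      Polynomial.coeff_X_pow_mul']
    simp at hx
    simp [hx]
  rw [h0, zero_add]
  refine sum_congr rfl fun x _ => ?_
  rw [add_comm n x, Polynomial.coeff_monomial_mul, abs_mul, pow_add]
  ring

theorem majorant_mul_le (p q : Polynomial ℝ) {Y : ℝ} (hY : 0 ≤ Y) :
    majorant (p * q) Y ≤ majorant p Y * majorant q Y := by
  have hq := majorant_nonneg q hY
  have key : ∀ s : Finset ℕ, majorant ((∑ m ∈ s, Polynomial.monomial m (p.coeff m)) * q) Y ≤
      (∑ m ∈ s, |p.coeff m| * Y ^ m) * majorant q Y := by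
    intro s
    induction s using Finset.induction_on with
    | empty => simp [majorant]
    | insert a s ha ih =>
      rw [sum_insert ha, sum_insert ha, add_mul, add_mul]
      refine (majorant_add_le _ _ hY).trans ?_
      rw [majorant_monomial_mul]
      linarith
  have := key p.support
  rwa [← Polynomial.as_sum_support] at this

theorem majorant_C (a Y : ℝ) : majorant (Polynomial.C a) Y = |a| := by
  simp [majorant, Polynomial.sum_C_index]

theorem majorant_X_add_C_le (a : ℝ) {Y : ℝ} (hY : 0 ≤ Y) :
    majorant (Polynomial.X + Polynomial.C a) Y ≤ Y + |a| := by
  refine (majorant_add_le _ _ hY).trans ?_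
  rw [majorant_C]
  simp [majorant, Polynomial.sum_X_index]

theorem majorant_prod_le {ι : Type} (s : Finset ι) (p : ι → Polynomial ℝ) (F : ι → ℝ) {Y : ℝ}
    (hY : 0 ≤ Y) (h : ∀ i ∈ s, majorant (p i) Y ≤ F i) :
    majorant (∏ i ∈ s, p i) Y ≤ ∏ i ∈ s, F i := by
  classical
  induction s using Finset.induction_on with
  | empty => simpa using (majorant_C 1 Y).le
  | insert a s ha ih =>
    rw [prod_insert ha, prod_insert ha]
    refine (majorant_mul_le _ _ hY).trans ?_
    have h1 := h a (mem_insert_self a s)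
    have h2 := ih fun i hi => h i (mem_insert_of_mem hi)
    exact mul_le_mul h1 h2 (majorant_nonneg _ hY) ((majorant_nonneg _ hY).trans h1)

theorem abs_eval_le_majorant (p : Polynomial ℝ) {x Y : ℝ} (hx : |x| ≤ Y) :
    |p.eval x| ≤ majorant p Y := by
  rw [Polynomial.eval_eq_sum, Polynomial.sum, majorant, Polynomial.sum]
  refine (abs_sum_le_sum_abs _ _).trans (sum_le_sum fun m _ => ?_)
  rw [abs_mul, abs_pow]
  gcongr

/-- A determinant of polynomial values at points of a small disc, up to a small error, is small. -/
theorem abs_det_interpolation_le {n : Type} [Fintype n] [DecidableEq n] (p : n → Polynomial ℝ)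
    (ζ : n → ℝ) (E : n → n → ℝ) (X ρ : ℝ) (hρ : 1 ≤ ρ) (F : n → ℝ)
    (hζ : ∀ i, |ζ i| ≤ X) (hp : ∀ j, majorant (p j) (ρ * X) ≤ F j)
    (hE : ∀ i j, ρ ^ Fintype.card n * |E i j| ≤ F j) :
    ρ ^ (∑ t ∈ range (Fintype.card n), t) *
      |(Matrix.of fun i j => (p j).eval (ζ i) + E i j).det| ≤
      (Fintype.card n).factorial * ∏ j, (2 * F j) := by
  have hρ0 : 0 < ρ := by linarith
  set D := (∑ j, (p j).natDegree) + 1 with hDdef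
  have hD : ∀ j, (p j).natDegree < D := fun j => by
    have := Finset.single_le_sum (f := fun j => (p j).natDegree) (fun _ _ => Nat.zero_le _)
      (mem_univ j)
    omega
  let Z : Matrix n (Fin D ⊕ n) ℝ :=
    Matrix.of fun i m => Sum.elim (fun m : Fin D => ζ i ^ (m : ℕ)) (fun k => if i = k then 1 else 0) m
  let C : Matrix (Fin D ⊕ n) n ℝ :=
    Matrix.of fun m j => Sum.elim (fun m : Fin D => (p j).coeff m) (fun k => E k j) m
  have hprod : (Matrix.of fun i j => (p j).eval (ζ i) + E i j) = Z * C := by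
    ext i j
    simp only [Matrix.of_apply, Matrix.mul_apply, Fintype.sum_sum_type, Sum.elim_inl, Sum.elim_inr,
      Z, C]
    congr 1
    · rw [Polynomial.eval_eq_sum_range' (hD j), Finset.sum_range]
      exact sum_congr rfl fun m _ => mul_comm _ _
    · simp
  rw [hprod]
  refine abs_det_mul_le Z C (Sum.elim (fun m : Fin D => (m : ℕ)) fun _ => Fintype.card n) _ ρ hρ
    (fun j => 2 * F j) (fun q hq => ?_) fun i j => ?_
  · refine sum_range_le_sum_of_injOn _ fun i j hij hlt => hq ?_
    rcases hi : q i with a | a <;> rcases hj : q j with b | b <;> simp [hi, hj] at hij hlt ⊢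
    · exact Fin.ext hij
    · omega
  · rw [Fintype.sum_sum_type]
    have h1 : ∑ m : Fin D, ρ ^ (m : ℕ) * (|ζ i ^ (m : ℕ)| * |(p j).coeff m|) ≤ F j := by
      refine le_trans ?_ (hp j)
      rw [majorant_eq_sum_range _ _ (hD j), Finset.sum_range]
      refine sum_le_sum fun m _ => ?_
      rw [mul_pow, abs_pow, mul_left_comm |(p j).coeff m|, mul_comm |(p j).coeff m|]
      have := hζ i
      gcongr
    have h2 : ∑ k : n, ρ ^ Fintype.card n * (|if i = k then (1 : ℝ) else 0| * |E k j|) ≤ F j := by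
      rw [Finset.sum_eq_single i (fun k _ hk => by simp [Ne.symm hk]) (by simp)]
      simpa using hE i j
    simp only [Sum.elim_inl, Sum.elim_inr, Matrix.of_apply, Z, C]
    linarith

theorem coeff_prod_of_natDegree_le_sum {ι : Type} (s : Finset ι) (p : ι → Polynomial ℝ) (d : ι → ℕ)
    (h : ∀ i ∈ s, (p i).natDegree ≤ d i) :
    (∏ i ∈ s, p i).natDegree ≤ ∑ i ∈ s, d i ∧
      (∏ i ∈ s, p i).coeff (∑ i ∈ s, d i) = ∏ i ∈ s, (p i).coeff (d i) := by
  classical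
  induction s using Finset.induction_on with
  | empty => simp
  | insert a s ha ih =>
    obtain ⟨h1, h2⟩ := ih fun i hi => h i (mem_insert_of_mem hi)
    have h3 := h a (mem_insert_self a s)
    rw [prod_insert ha, sum_insert ha, prod_insert ha]
    refine ⟨Polynomial.natDegree_mul_le_of_le h3 h1, ?_⟩
    rw [Polynomial.coeff_mul_add_eq_of_natDegree_le h3 h1, h2]

/-- If an exponential polynomial and its shifts vanish at many points, there are at most as many
points as the total degree. -/
theorem card_le_sum_natDegree_of_shifts_vanish {n : ℕ} (P : Fin n → Polynomial ℝ) (β : Fin n → ℝ)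
    (hβ : Function.Injective β) (hP : ∀ l, P l ≠ 0) (pts : Finset ℕ) (c : ℕ → Fin n → ℝ)
    (hc : ∀ x ∈ pts, c x ≠ 0)
    (hv : ∀ x ∈ pts, ∀ i : Fin n, ∑ l, (P l).eval ((x : ℝ) + (i : ℕ)) * β l ^ (i : ℕ) * c x l = 0) :
    #pts ≤ ∑ l, (P l).natDegree := by
  classical
  let d : Fin n → ℕ := fun l => (P l).natDegree
  let q : Fin n → Fin n → Polynomial ℝ := fun i l =>
    Polynomial.C (β l ^ (i : ℕ)) * (P l).comp (Polynomial.X + Polynomial.C ((i : ℕ) : ℝ))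
  let Δ : Polynomial ℝ := (Matrix.of q).det
  have hqdeg : ∀ i l, (q i l).natDegree ≤ d l := fun i l => by
    refine (Polynomial.natDegree_C_mul_le _ _).trans ?_
    rw [Polynomial.natDegree_comp, Polynomial.natDegree_X_add_C, mul_one]
  have hqc : ∀ i l, (q i l).coeff (d l) = β l ^ (i : ℕ) * (P l).leadingCoeff := fun i l => by
    have : d l = ((P l).comp (Polynomial.X + Polynomial.C ((i : ℕ) : ℝ))).natDegree := by
      rw [Polynomial.natDegree_comp, Polynomial.natDegree_X_add_C, mul_one]
    rw [Polynomial.coeff_C_mul, this, Polynomial.coeff_natDegree,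
      Polynomial.leadingCoeff_comp (by rw [Polynomial.natDegree_X_add_C]; exact one_ne_zero),
      Polynomial.leadingCoeff_X_add_C, one_pow, mul_one]
  have hΔdeg : Δ.natDegree ≤ ∑ l, d l := by
    simp only [Δ, Matrix.det_apply]
    refine Polynomial.natDegree_sum_le_of_forall_le _ _ fun σ _ => ?_
    refine (Polynomial.natDegree_smul_le _ _).trans ?_
    exact (coeff_prod_of_natDegree_le_sum univ _ d fun l _ => hqdeg (σ l) l).1
  have hΔcoeff : Δ.coeff (∑ l, d l) =
      (Matrix.vandermonde β).det * ∏ l, (P l).leadingCoeff := by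
    have : (Matrix.vandermonde β).det * ∏ l, (P l).leadingCoeff =
        (Matrix.of fun i l : Fin n => β l ^ (i : ℕ) * (P l).leadingCoeff).det := by
      rw [← Matrix.det_transpose (Matrix.vandermonde β), ← Matrix.det_diagonal,
        ← Matrix.det_mul]
      congr 1
      ext i l
      rw [Matrix.mul_diagonal]
      simp [Matrix.vandermonde]
    rw [this]
    simp only [Δ, Matrix.det_apply, Polynomial.finsetSum_coeff, Polynomial.coeff_smul]
    refine sum_congr rfl fun σ _ => ?_
    congr 1
    simp only [Matrix.of_apply]
    rw [(coeff_prod_of_natDegree_le_sum univ _ d fun l _ => hqdeg (σ l) l).2]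
    exact prod_congr rfl fun l _ => hqc _ _
  have hΔ0 : Δ ≠ 0 := by
    intro h0
    rw [h0, Polynomial.coeff_zero] at hΔcoeff
    rcases mul_eq_zero.mp hΔcoeff.symm with h | h
    · exact Matrix.det_vandermonde_ne_zero_iff.mpr hβ h
    · rw [prod_eq_zero_iff] at h
      obtain ⟨l, _, hl⟩ := h
      exact hP l (Polynomial.leadingCoeff_eq_zero.mp hl)
  have heval : ∀ x ∈ pts, Δ.eval (x : ℝ) = 0 := by
    intro x hx
    have : Δ.eval (x : ℝ) = (Matrix.of fun i l => (q i l).eval (x : ℝ)).det := by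
      have := RingHom.map_det (Polynomial.evalRingHom (x : ℝ)) (Matrix.of q)
      rw [Polynomial.coe_evalRingHom] at this
      rw [this]
      rfl
    rw [this]
    by_contra hne
    refine hc x hx (Matrix.eq_zero_of_mulVec_eq_zero hne ?_)
    ext i
    have := hv x hx i
    simp only [Matrix.mulVec, dotProduct, Matrix.of_apply, q, Pi.zero_apply]
    rw [← this]
    refine sum_congr rfl fun l _ => ?_
    rw [Polynomial.eval_mul, Polynomial.eval_C, Polynomial.eval_comp]
    simp only [Polynomial.eval_add, Polynomial.eval_X, Polynomial.eval_C]
    ring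
  by_contra hlt
  push Not at hlt
  refine hΔ0 (Polynomial.eq_zero_of_natDegree_lt_card_of_eval_eq_zero' Δ (pts.map Nat.castEmbedding)
    ?_ ?_)
  · intro y hy
    rw [mem_map] at hy
    obtain ⟨x, hx, rfl⟩ := hy
    exact heval x hx
  · rw [card_map]
    exact lt_of_le_of_lt hΔdeg hlt

theorem eq_zero_of_sum_choose_polynomial_eq_zero {K : ℕ} (v : Fin K → ℝ)
    (h : ∑ k : Fin K, Polynomial.C (v k / (k : ℕ).factorial) * descPochhammer ℝ k = 0) : v = 0 := by
  let S : Polynomial.Sequence ℝ := ⟨fun k => descPochhammer ℝ k, fun k => by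
    rw [Polynomial.degree_eq_natDegree (monic_descPochhammer ℝ k).ne_zero,
      descPochhammer_natDegree]⟩
  have hli : LinearIndependent ℝ fun k : Fin K => descPochhammer ℝ k :=
    S.linearIndependent.comp (fun k : Fin K => (k : ℕ)) Fin.val_injective
  rw [Fintype.linearIndependent_iff] at hli
  ext k
  have := hli (fun k => v k / (k : ℕ).factorial) (by
    rw [← h]
    exact sum_congr rfl fun k _ => Polynomial.smul_eq_C_mul _) k
  have hk : ((k : ℕ).factorial : ℝ) ≠ 0 := by positivity
  simpa [hk] using this

/-- The interpolation matrix of the functions `x.choose k * y ^ (l - 2)` at the points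
`x = r * ℓ + s`, `y = γ ^ r * α ^ s`. -/
noncomputable def interpolationMatrix (ℓ K R S : ℕ) (γ α : ℝ) :
    Matrix (Fin R × Fin S) (Fin 5 × Fin K) ℝ :=
  Matrix.of fun i j => (((i.1 : ℕ) * ℓ + i.2).choose j.2 : ℝ) *
    (γ ^ (i.1 : ℕ) * α ^ (i.2 : ℕ)) ^ ((j.1 : ℤ) - 2)

theorem interpolationMatrix_mulVec_injective {ℓ K R S : ℕ} {γ α : ℝ} (hγ : 0 < γ) (hα : 0 < α)
    (hα1 : α ≠ 1) (hSℓ : S ≤ ℓ) (hK : 0 < K) (hRS : 5 * K ≤ R * (S - 4))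
    (v : Fin 5 × Fin K → ℝ) (hv : interpolationMatrix ℓ K R S γ α *ᵥ v = 0) : v = 0 := by
  classical
  let P : Fin 5 → Polynomial ℝ := fun l =>
    ∑ k : Fin K, Polynomial.C (v (l, k) / (k : ℕ).factorial) * descPochhammer ℝ k
  have hPdeg : ∀ l, (P l).natDegree ≤ K - 1 := fun l => by
    refine Polynomial.natDegree_sum_le_of_forall_le _ _ fun k _ => ?_
    refine (Polynomial.natDegree_C_mul_le _ _).trans ?_
    rw [descPochhammer_natDegree]
    have := k.2
    omega
  have hPeval : ∀ l (x : ℕ), (P l).eval (x : ℝ) = ∑ k : Fin K, (x.choose k : ℝ) * v (l, k) := by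
    intro l x
    simp only [P, Polynomial.eval_finsetSum, Polynomial.eval_mul, Polynomial.eval_C]
    refine sum_congr rfl fun k _ => ?_
    rw [descPochhammer_eval_eq_descFactorial, Nat.descFactorial_eq_factorial_mul_choose]
    have hk : ((k : ℕ).factorial : ℝ) ≠ 0 := by positivity
    push_cast
    field_simp
  have hrow : ∀ r < R, ∀ s < S, ∑ l, (P l).eval ((r * ℓ + s : ℕ) : ℝ) *
      (γ ^ r * α ^ s) ^ ((l : ℤ) - 2) = 0 := by
    intro r hr s hs
    have := congrFun hv (⟨r, hr⟩, ⟨s, hs⟩)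
    simp only [Matrix.mulVec, dotProduct, interpolationMatrix, Matrix.of_apply, Pi.zero_apply,
      Fintype.sum_prod_type] at this
    rw [← this]
    refine sum_congr rfl fun l _ => ?_
    rw [hPeval, sum_mul]
    exact sum_congr rfl fun k _ => by ring
  by_contra hv0
  let I := {l : Fin 5 // P l ≠ 0}
  have hI : Nonempty I := by
    by_contra hemp
    rw [not_nonempty_iff] at hemp
    refine hv0 (funext fun ⟨l, k⟩ => ?_)
    have hl : P l = 0 := by
      by_contra hne
      exact hemp.false ⟨l, hne⟩
    exact congrFun (eq_zero_of_sum_choose_polynomial_eq_zero (fun k => v (l, k)) hl) k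
  let n := Fintype.card I
  have hn5 : n ≤ 5 := (Fintype.card_subtype_le _).trans (by simp)
  let e : Fin n ≃ I := (Fintype.equivFin I).symm
  have hn0 : 0 < n := Fintype.card_pos
  let pts : Finset ℕ := ((range R) ×ˢ (range (S - 4))).image fun z => z.1 * ℓ + z.2
  have hpts : #pts = R * (S - 4) := by
    rw [card_image_of_injOn, card_product, card_range, card_range]
    rintro ⟨r, s⟩ h ⟨r', s'⟩ h' heq
    simp only [coe_product, Set.mem_prod, coe_range, Set.mem_Iio] at h h' heq
    have hs : s < ℓ := by omega
    have hs' : s' < ℓ := by omega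
    have h1 : r = r' := by
      have := congrArg (· / ℓ) heq
      simpa [Nat.add_div_of_dvd_right, Nat.add_comm, Nat.add_mul_div_right _ _ (by omega : 0 < ℓ),
        Nat.div_eq_of_lt hs, Nat.div_eq_of_lt hs'] using this
    subst h1
    simpa using heq
  have hcard := card_le_sum_natDegree_of_shifts_vanish (fun l => P (e l))
    (fun l => α ^ (((e l : Fin 5) : ℤ) - 2)) (fun l l' hll => by
      have := zpow_right_injective₀ hα hα1 hll
      have h2 : ((e l : Fin 5) : ℕ) = ((e l' : Fin 5) : ℕ) := by
        omega
      exact e.injective (Subtype.ext (Fin.ext h2))) (fun l => (e l).2) pts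
    (fun x l => (γ ^ (x / ℓ) * α ^ (x % ℓ)) ^ (((e l : Fin 5) : ℤ) - 2))
    (fun x _ h0 => by
      have := congrFun h0 ⟨0, hn0⟩
      simp only [Pi.zero_apply] at this
      have hpos : 0 < γ ^ (x / ℓ) * α ^ (x % ℓ) := by positivity
      exact (zpow_pos hpos _).ne' this) (fun x hx i => by
      simp only [pts, mem_image, mem_product, mem_range, Prod.exists] at hx
      obtain ⟨r, s, ⟨hr, hs⟩, rfl⟩ := hx
      have hsℓ : s < ℓ := by omega
      have h1 : (r * ℓ + s) / ℓ = r := by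
        rw [Nat.add_comm, Nat.add_mul_div_right _ _ (by omega), Nat.div_eq_of_lt hsℓ, zero_add]
      have h2 : (r * ℓ + s) % ℓ = s := by
        rw [Nat.add_comm, Nat.add_mul_mod_self_right, Nat.mod_eq_of_lt hsℓ]
      rw [h1, h2]
      have hrow' := hrow r hr (s + i) (by have := i.2; omega)
      have hsub : ∑ l : I, (P l).eval ((r * ℓ + (s + i) : ℕ) : ℝ) *
          (γ ^ r * α ^ (s + i)) ^ (((l : Fin 5) : ℤ) - 2) = 0 := by
        rw [← hrow']
        rw [← Fintype.sum_subtype_add_sum_subtype (fun l => P l ≠ 0), left_eq_add]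
        refine sum_eq_zero fun l _ => ?_
        rw [not_not.mp l.2, Polynomial.eval_zero, zero_mul]
      rw [← hsub, ← Equiv.sum_comp e]
      refine sum_congr rfl fun l _ => ?_
      have h3 : ((r * ℓ + (s + i) : ℕ) : ℝ) = ((r * ℓ + s : ℕ) : ℝ) + (i : ℕ) := by
        push_cast; ring
      have h4 (z : ℤ) : (α ^ (i : ℕ)) ^ z = (α ^ z) ^ (i : ℕ) := by
        rw [← zpow_natCast, ← zpow_natCast, ← _root_.zpow_mul, ← _root_.zpow_mul, mul_comm]
      rw [h3, pow_add, ← mul_assoc (γ ^ r), mul_zpow (γ ^ r * α ^ s), h4]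
      ring)
  rw [hpts] at hcard
  have hsum : ∑ l, (P (e l)).natDegree ≤ 5 * (K - 1) := by
    calc ∑ l : Fin n, (P (e l)).natDegree ≤ ∑ _l : Fin n, (K - 1) := sum_le_sum fun l _ => hPdeg _
      _ = n * (K - 1) := by simp
      _ ≤ 5 * (K - 1) := Nat.mul_le_mul_right _ hn5
  omega

theorem one_le_abs_det_interpolationMatrix_mul {ℓ K R S : ℕ} {P Q A B : ℕ} (hP : 0 < P) (hQ : 0 < Q)
    (hA : 0 < A) (hB : 0 < B) (f : Fin 5 × Fin K → Fin R × Fin S)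
    (hdet : ((interpolationMatrix ℓ K R S (Q / P) (B / A)).submatrix f id).det ≠ 0) :
    1 ≤ |((interpolationMatrix ℓ K R S (Q / P) (B / A)).submatrix f id).det| *
      (((P : ℝ) * Q) ^ (3 * K * (R - 1)) * ((A : ℝ) * B) ^ (3 * K * (S - 1))) := by
  set M := (interpolationMatrix ℓ K R S (Q / P) (B / A)).submatrix f id with hM
  let U : ℕ := Q ^ (R - 1) * B ^ (S - 1)
  let V : ℕ := P ^ (R - 1) * A ^ (S - 1)
  let c : Fin 5 → ℕ := ![U ^ 2, U, 1, V, V ^ 2]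
  have hU : 0 < U := by positivity
  have hV : 0 < V := by positivity
  have hint : ∀ i j : Fin 5 × Fin K, ∃ z : ℤ, (c j.1 : ℝ) * M i j = z := by
    rintro i ⟨l, k⟩
    set r : ℕ := ((f i).1 : ℕ)
    set s : ℕ := ((f i).2 : ℕ)
    have hr : R - 1 = r + (R - 1 - r) := by have := (f i).1.2; omega
    have hs : S - 1 = s + (S - 1 - s) := by have := (f i).2.2; omega
    set x := (r * ℓ + s).choose k
    let m : ℕ := P ^ r * A ^ s
    let n : ℕ := Q ^ r * B ^ s
    have hm0 : (m : ℝ) ≠ 0 := by positivity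
    have hn0 : (n : ℝ) ≠ 0 := by positivity
    have hy : ((Q : ℝ) / P) ^ r * ((B : ℝ) / A) ^ s = n / m := by
      simp only [m, n]
      push_cast
      rw [div_pow, div_pow, div_mul_div_comm]
    obtain ⟨u, hu⟩ : ∃ u : ℕ, U = n * u :=
      ⟨Q ^ (R - 1 - r) * B ^ (S - 1 - s), by simp only [U, n]; rw [hr, hs, pow_add, pow_add]; simp; ring⟩
    obtain ⟨v, hv⟩ : ∃ v : ℕ, V = m * v :=
      ⟨P ^ (R - 1 - r) * A ^ (S - 1 - s), by simp only [V, m]; rw [hr, hs, pow_add, pow_add]; simp; ring⟩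
    have hMij : M i (l, k) = (x : ℝ) * ((n : ℝ) / m) ^ ((l : ℤ) - 2) := by
      rw [← hy]
      rfl
    rw [hMij]
    fin_cases l
    · refine ⟨(u ^ 2 * m ^ 2 * x : ℕ), ?_⟩
      simp [c, hu]
      field_simp
    · refine ⟨(u * m * x : ℕ), ?_⟩
      simp [c, hu]
      field_simp
    · refine ⟨x, ?_⟩
      simp [c]
    · refine ⟨(v * n * x : ℕ), ?_⟩
      simp [c, hv]
      field_simp
    · refine ⟨(v ^ 2 * n ^ 2 * x : ℕ), ?_⟩
      simp [c, hv]
      field_simp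
  choose z hz using hint
  have hscaled : (∏ j : Fin 5 × Fin K, (c j.1 : ℝ)) * M.det = ((Matrix.of z).det : ℤ) := by
    rw [← Matrix.det_mul_row]
    have := (Int.castRingHom ℝ).map_det (Matrix.of z)
    rw [eq_intCast] at this
    rw [this]
    congr 1
    ext i j
    simpa using hz i j
  have hc : (∏ j : Fin 5 × Fin K, (c j.1 : ℝ)) =
      ((P : ℝ) * Q) ^ (3 * K * (R - 1)) * ((A : ℝ) * B) ^ (3 * K * (S - 1)) := by
    rw [Fintype.prod_prod_type]
    simp only [prod_const, card_univ, Fintype.card_fin, Fin.prod_univ_five, c, U, V]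
    simp
    ring
  rw [← hc]
  have hc0 : (0 : ℝ) < ∏ j : Fin 5 × Fin K, (c j.1 : ℝ) := by
    rw [hc]
    positivity
  rw [← abs_of_pos hc0, ← abs_mul, mul_comm, hscaled]
  have hne : (Matrix.of z).det ≠ 0 := by
    intro h0
    rw [h0, Int.cast_zero] at hscaled
    exact (mul_ne_zero hc0.ne' hdet) hscaled
  exact_mod_cast Int.one_le_abs hne

theorem majorant_choose_polynomial_le {X ρ : ℝ} (hX : 0 ≤ X) (hρ : 0 ≤ ρ) (k : ℕ) (hk : (k : ℝ) ≤ 2 * X) :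
    majorant (Polynomial.C ((k.factorial : ℝ)⁻¹) *
      ∏ t ∈ range k, (Polynomial.X + Polynomial.C (X - (t : ℝ)))) (ρ * X) ≤
      ((ρ + 1) * X) ^ k / k.factorial := by
  have hY : 0 ≤ ρ * X := by positivity
  refine (majorant_mul_le _ _ hY).trans ?_
  rw [majorant_C, abs_of_nonneg (by positivity), inv_mul_eq_div]
  gcongr
  refine (majorant_prod_le (range k) _ (fun _ => (ρ + 1) * X) hY fun t ht => ?_).trans (by simp)
  refine (majorant_X_add_C_le _ hY).trans ?_
  have htk : (t : ℝ) ≤ k := by exact_mod_cast (mem_range.mp ht).le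
  have : |X - (t : ℝ)| ≤ X := by
    rw [abs_le]
    have : (0 : ℝ) ≤ t := by positivity
    constructor <;> linarith
  linarith

theorem eval_choose_polynomial (X : ℝ) (k x : ℕ) :
    (Polynomial.C ((k.factorial : ℝ)⁻¹) *
      ∏ t ∈ range k, (Polynomial.X + Polynomial.C (X - (t : ℝ)))).eval (x - X) = x.choose k := by
  rw [Polynomial.eval_mul, Polynomial.eval_C, Polynomial.eval_prod]
  have h : ∏ t ∈ range k, (Polynomial.X + Polynomial.C (X - (t : ℝ))).eval ((x : ℝ) - X) =
      (x.descFactorial k : ℝ) := by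
    rw [← descPochhammer_eval_eq_descFactorial, descPochhammer_eval_eq_prod_range]
    exact prod_congr rfl fun t _ => by simp
  rw [h, Nat.descFactorial_eq_factorial_mul_choose]
  have : (k.factorial : ℝ) ≠ 0 := by positivity
  push_cast
  field_simp

/-- The Taylor polynomial of degree less than `D` of `z ↦ exp (a * z)`. -/
noncomputable def expTaylor (D : ℕ) (a : ℝ) : Polynomial ℝ :=
  ∑ m ∈ range D, Polynomial.monomial m (a ^ m / m.factorial)

theorem eval_expTaylor (D : ℕ) (a z : ℝ) :
    (expTaylor D a).eval z = ∑ m ∈ range D, (a * z) ^ m / m.factorial := by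
  rw [expTaylor, Polynomial.eval_finsetSum]
  refine sum_congr rfl fun m _ => ?_
  rw [Polynomial.eval_monomial, mul_pow]
  ring

theorem majorant_expTaylor_le (D : ℕ) (a : ℝ) {Y : ℝ} (hY : 0 ≤ Y) :
    majorant (expTaylor D a) Y ≤ Real.exp (|a| * Y) := by
  have h : ∀ D, majorant (expTaylor D a) Y ≤ ∑ m ∈ range D, (|a| * Y) ^ m / m.factorial := by
    intro D
    induction D with
    | zero => simp [expTaylor, majorant]
    | succ D ih =>
      rw [expTaylor, sum_range_succ, sum_range_succ]
      refine (majorant_add_le _ _ hY).trans (add_le_add ih ?_)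
      have := majorant_monomial_mul D (a ^ D / D.factorial) (Polynomial.C 1) Y
      rw [majorant_C, Polynomial.C_1, mul_one] at this
      rw [this, abs_div, abs_pow, mul_pow, abs_one, Nat.abs_cast]
      apply le_of_eq
      ring
  exact (h D).trans (Real.sum_le_exp_of_nonneg (by positivity) D)

theorem exists_expTaylor_close {ι : Type} [Finite ι] (a z : ι → ℝ) {η : ℝ} (hη : 0 < η) :
    ∃ D, ∀ i, |Real.exp (a i * z i) - (expTaylor D (a i)).eval (z i)| ≤ η := by
  have h : ∀ i, ∀ᶠ D in Filter.atTop,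
      |Real.exp (a i * z i) - (expTaylor D (a i)).eval (z i)| ≤ η := by
    intro i
    have hs := (NormedSpace.expSeries_div_hasSum_exp (a i * z i)).tendsto_sum_nat
    rw [← Real.exp_eq_exp_ℝ] at hs
    have := (Metric.tendsto_nhds.mp hs) η hη
    filter_upwards [this] with D hD
    rw [Real.dist_eq, abs_sub_comm] at hD
    rw [eval_expTaylor]
    exact hD.le
  exact (Filter.eventually_all.mpr h).exists

theorem abs_det_interpolationMatrix_le {ℓ K R S : ℕ} {γ α δ X ρ : ℝ} (hγ : 0 < γ) (hα : 0 < α)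
    (hδ : δ = ℓ * Real.log α - Real.log γ) (hδ0 : 0 ≤ δ) (hX : X = R * ℓ / 2) (hSℓ : S ≤ ℓ)
    (hKR : K ≤ R * ℓ) (hρ : 1 ≤ ρ) (hρδ : ρ ^ (5 * K) * (8 * R * δ) ≤ 1)
    (f : Fin 5 × Fin K → Fin R × Fin S) :
    ρ ^ (∑ t ∈ range (5 * K), t) * |((interpolationMatrix ℓ K R S γ α).submatrix f id).det| ≤
      (5 * K).factorial * ∏ j : Fin 5 × Fin K, (2 * (((ρ + 1) * X) ^ (j.2 : ℕ) / (j.2 : ℕ).factorial *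
        Real.exp (ρ * |Real.log α| * X * |((j.1 : ℕ) : ℝ) - 2|))) := by
  set lam := Real.log α with hlam
  have hρ0 : 0 < ρ := by linarith
  have hX0 : 0 ≤ X := by rw [hX]; positivity
  set N := 5 * K with hN
  have hcard : Fintype.card (Fin 5 × Fin K) = N := by simp [hN]
  let μ : Fin 5 → ℝ := fun l => ((l : ℕ) : ℝ) - 2
  have hμ : ∀ l, |μ l| ≤ 2 := by
    intro l
    fin_cases l <;> simp only [μ] <;> norm_num
  let x : Fin 5 × Fin K → ℕ := fun i => (f i).1 * ℓ + (f i).2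
  let ζ : Fin 5 × Fin K → ℝ := fun i => x i - X
  have hζ : ∀ i, |ζ i| ≤ X := by
    intro i
    have h1 : (f i).1 * ℓ + (f i).2 ≤ R * ℓ := by
      have h1 := (f i).1.2
      have h2 := (f i).2.2
      calc (f i).1 * ℓ + (f i).2 ≤ (f i).1 * ℓ + ℓ := by omega
        _ = ((f i).1 + 1) * ℓ := by ring
        _ ≤ R * ℓ := Nat.mul_le_mul_right _ h1
    have h2 : (x i : ℝ) ≤ R * ℓ := by exact_mod_cast h1
    have h3 : (0 : ℝ) ≤ x i := by positivity
    rw [abs_le]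
    simp only [ζ]
    constructor <;> linarith
  obtain ⟨D, hD⟩ := exists_expTaylor_close
    (fun q : (Fin 5 × Fin K) × (Fin 5 × Fin K) => μ q.2.1 * lam) (fun q => ζ q.1)
    (η := (ρ ^ N)⁻¹ / 2) (by positivity)
  let b : ℕ → Polynomial ℝ := fun k => Polynomial.C ((k.factorial : ℝ)⁻¹) *
      ∏ t ∈ range k, (Polynomial.X + Polynomial.C (X - (t : ℝ)))
  have hk2 : ∀ k : Fin K, ((k : ℕ) : ℝ) ≤ 2 * X := by
    intro k
    have : (k : ℕ) ≤ R * ℓ := k.2.le.trans hKR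
    have : ((k : ℕ) : ℝ) ≤ R * ℓ := by exact_mod_cast this
    linarith
  let F : Fin 5 × Fin K → ℝ := fun j => ((ρ + 1) * X) ^ (j.2 : ℕ) / (j.2 : ℕ).factorial *
        Real.exp (ρ * |lam| * X * |((j.1 : ℕ) : ℝ) - 2|)
  let p : Fin 5 × Fin K → Polynomial ℝ := fun j => b j.2 * expTaylor D (μ j.1 * lam)
  let e : Fin 5 × Fin K → Fin 5 × Fin K → ℝ := fun i j =>
    Real.exp (μ j.1 * lam * ζ i - μ j.1 * ((f i).1 : ℕ) * δ)
  let E : Fin 5 × Fin K → Fin 5 × Fin K → ℝ := fun i j =>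
    (b j.2).eval (ζ i) * (e i j - (expTaylor D (μ j.1 * lam)).eval (ζ i))
  have hdet : ((interpolationMatrix ℓ K R S γ α).submatrix f id).det =
      (Matrix.of fun i j => (p j).eval (ζ i) + E i j).det := by
    have hprod : ∏ j : Fin 5 × Fin K, Real.exp (μ j.1 * lam * X) = 1 := by
      rw [← Real.exp_sum, Fintype.sum_prod_type]
      simp only [sum_const, card_univ, Fintype.card_fin, Fin.sum_univ_five, μ]
      rw [← smul_add, ← smul_add, ← smul_add, ← smul_add]
      norm_num
    rw [← one_mul (Matrix.det (Matrix.of _)), ← hprod, ← Matrix.det_mul_row]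
    congr 1
    ext i j
    simp only [Matrix.submatrix_apply, id, interpolationMatrix, Matrix.of_apply, p, E,
      Polynomial.eval_mul]
    have hb : (b j.2).eval (ζ i) = (x i).choose j.2 := eval_choose_polynomial X j.2 (x i)
    rw [hb]
    have hy : (γ ^ ((f i).1 : ℕ) * α ^ ((f i).2 : ℕ)) ^ (((j.1 : ℕ) : ℤ) - 2) =
        Real.exp (μ j.1 * lam * X) * e i j := by
      rw [← Real.exp_log hγ, ← Real.exp_log hα, ← Real.exp_nat_mul, ← Real.exp_nat_mul,
        ← Real.exp_add, ← Real.rpow_intCast, ← Real.exp_mul, ← Real.exp_add]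
      congr 1
      simp only [ζ, x, μ]
      rw [hδ]
      push_cast
      ring
    rw [hy]
    ring
  rw [hdet]
  have hmain := abs_det_interpolation_le p ζ E X ρ hρ F hζ ?_ ?_
  · rw [hcard] at hmain
    exact hmain
  · intro j
    refine (majorant_mul_le _ _ (by positivity)).trans ?_
    have h1 := majorant_choose_polynomial_le hX0 hρ0.le j.2 (hk2 j.2)
    have h2 := majorant_expTaylor_le D (μ j.1 * lam) (Y := ρ * X) (by positivity)
    refine mul_le_mul h1 (h2.trans (le_of_eq ?_)) (majorant_nonneg _ (by positivity)) (by positivity)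
    congr 1
    rw [abs_mul]
    ring
  · intro i j
    rw [hcard]
    have h1 : |(b j.2).eval (ζ i)| ≤ ((ρ + 1) * X) ^ (j.2 : ℕ) / (j.2 : ℕ).factorial := by
      refine (abs_eval_le_majorant _ ?_).trans
        (majorant_choose_polynomial_le hX0 hρ0.le j.2 (hk2 j.2))
      refine (hζ i).trans ?_
      nlinarith
    have hδ1 : ρ ^ N * (8 * (R : ℝ) * δ) ≤ 1 := hρδ
    have hρN : 1 ≤ ρ ^ N := one_le_pow₀ hρ
    have hr : (((f i).1 : ℕ) : ℝ) ≤ R := by exact_mod_cast (f i).1.2.le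
    have ht : |-(μ j.1 * ((f i).1 : ℕ) * δ)| ≤ 2 * R * δ := by
      rw [abs_neg, abs_mul, abs_mul, abs_of_nonneg hδ0, Nat.abs_cast]
      have := hμ j.1
      gcongr
    have hRδ : 8 * (R : ℝ) * δ ≤ 1 := by
      have : 0 ≤ 8 * (R : ℝ) * δ := by positivity
      nlinarith
    have h2 : |Real.exp (-(μ j.1 * ((f i).1 : ℕ) * δ)) - 1| ≤ 4 * R * δ := by
      refine (Real.abs_exp_sub_one_le (by linarith)).trans (by linarith)
    have h3 : |e i j - (expTaylor D (μ j.1 * lam)).eval (ζ i)| ≤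
        Real.exp (|lam| * X * |μ j.1|) * (4 * R * δ) + (ρ ^ N)⁻¹ / 2 := by
      have hsplit : e i j - (expTaylor D (μ j.1 * lam)).eval (ζ i) =
          Real.exp (μ j.1 * lam * ζ i) * (Real.exp (-(μ j.1 * ((f i).1 : ℕ) * δ)) - 1) +
          (Real.exp (μ j.1 * lam * ζ i) - (expTaylor D (μ j.1 * lam)).eval (ζ i)) := by
        simp only [e]
        rw [sub_eq_add_neg (μ j.1 * lam * ζ i), Real.exp_add]
        ring
      rw [hsplit]
      refine (abs_add_le _ _).trans (add_le_add ?_ (hD (i, j)))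
      rw [abs_mul, Real.abs_exp]
      refine mul_le_mul (Real.exp_le_exp.mpr ?_) h2 (abs_nonneg _) (Real.exp_pos _).le
      refine (le_abs_self _).trans ?_
      rw [abs_mul, abs_mul]
      have := hζ i
      calc |μ j.1| * |lam| * |ζ i| ≤ |μ j.1| * |lam| * X := by gcongr
        _ = _ := by ring
    have h4 : ρ ^ N * |e i j - (expTaylor D (μ j.1 * lam)).eval (ζ i)| ≤
        Real.exp (ρ * |lam| * X * |μ j.1|) := by
      have h5 : Real.exp (|lam| * X * |μ j.1|) ≤ Real.exp (ρ * |lam| * X * |μ j.1|) := by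
        apply Real.exp_le_exp.mpr
        have : 0 ≤ |lam| * X * |μ j.1| := by positivity
        nlinarith
      have h6 : 1 ≤ Real.exp (|lam| * X * |μ j.1|) := Real.one_le_exp (by positivity)
      calc ρ ^ N * |e i j - (expTaylor D (μ j.1 * lam)).eval (ζ i)|
          ≤ ρ ^ N * (Real.exp (|lam| * X * |μ j.1|) * (4 * R * δ) + (ρ ^ N)⁻¹ / 2) := by gcongr
        _ = Real.exp (|lam| * X * |μ j.1|) * (ρ ^ N * (8 * R * δ)) / 2 + 1 / 2 := by
            field_simp
            ring
        _ ≤ Real.exp (|lam| * X * |μ j.1|) * 1 / 2 + Real.exp (|lam| * X * |μ j.1|) / 2 := by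
            gcongr
        _ = Real.exp (|lam| * X * |μ j.1|) := by ring
        _ ≤ _ := h5
    simp only [E, F]
    rw [abs_mul, mul_left_comm]
    exact mul_le_mul h1 h4 (by positivity) (by positivity)
theorem sum_log_factorial_ge (K : ℕ) :
    (K : ℝ) * (K - 1) / 2 * (Real.log K - 3 / 2) ≤ ∑ k ∈ range K, Real.log k.factorial := by
  induction K with
  | zero => simp
  | succ K ih =>
    rw [sum_range_succ]
    rcases Nat.eq_zero_or_pos K with rfl | hK
    · simp
    have hK' : (1 : ℝ) ≤ K := by exact_mod_cast hK
    have hfac : (K : ℝ) * Real.log K - K + 1 / 2 ≤ Real.log K.factorial := by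
      have h1 := Stirling.le_log_factorial_stirling hK.ne'
      have h2 : 0 ≤ Real.log K := Real.log_nonneg hK'
      have h3 : 1 ≤ Real.log (2 * Real.pi) := by
        rw [Real.le_log_iff_exp_le (by positivity)]
        have := Real.exp_one_lt_d9
        have := Real.pi_gt_three
        linarith
      linarith
    have hlog : Real.log ((K + 1 : ℕ) : ℝ) ≤ Real.log K + 1 / K := by
      have h1 : ((K + 1 : ℕ) : ℝ) = K * (1 + 1 / K) := by
        push_cast
        field_simp
      rw [h1, Real.log_mul (by positivity) (by positivity)]
      have := Real.log_le_sub_one_of_pos (x := 1 + 1 / (K : ℝ)) (by positivity)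
      linarith
    have hmul := mul_le_mul_of_nonneg_left hlog (by positivity : (0 : ℝ) ≤ K * (K + 1) / 2)
    have hsimp : (K : ℝ) * (K + 1) / 2 * (Real.log K + 1 / K) =
        K * (K + 1) / 2 * Real.log K + (K + 1) / 2 := by
      field_simp
    have hK1 : ((K + 1 : ℕ) : ℝ) - 1 = K := by push_cast; ring
    rw [hK1]
    push_cast at *
    nlinarith

theorem interpolation_log_inequality {ℓ K R S : ℕ} {P Q A B : ℕ} {δ X : ℝ} (hP : 0 < P) (hQ : 0 < Q)
    (hA : 0 < A) (hB : 0 < B) (hAB : A ≠ B) (hK : 0 < K) (hR : 0 < R) (hℓ : 0 < ℓ)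
    (hδ : δ = ℓ * Real.log ((B : ℝ) / A) - Real.log ((Q : ℝ) / P)) (hδ0 : 0 ≤ δ)
    (hX : X = R * ℓ / 2) (hSℓ : S ≤ ℓ) (hKR : K ≤ R * ℓ) (hRS : 5 * K ≤ R * (S - 4))
    (hρδ : Real.exp 3 ^ (5 * K) * (8 * R * δ) ≤ 1) :
    15 / 2 * (5 * (K : ℝ) - 1) ≤ 5 * Real.log (5 * K) + 5 * Real.log 2 +
      5 / 2 * (K - 1) * (Real.log ((Real.exp 3 + 1) * X) - Real.log K + 3 / 2) +
      6 * (Real.exp 3 * |Real.log ((B : ℝ) / A)| * X) +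
      3 * (R - 1 : ℕ) * Real.log ((P : ℝ) * Q) + 3 * (S - 1 : ℕ) * Real.log ((A : ℝ) * B) := by
  have hα1 : (B : ℝ) / A ≠ 1 := by
    rw [Ne, div_eq_one_iff_eq (by positivity)]
    exact_mod_cast hAB.symm
  obtain ⟨f, hf⟩ := exists_det_submatrix_ne_zero (interpolationMatrix ℓ K R S (Q / P) (B / A))
    (interpolationMatrix_mulVec_injective (by positivity) (by positivity) hα1 hSℓ hK hRS)
  have hlow := one_le_abs_det_interpolationMatrix_mul hP hQ hA hB f hf
  have hup := abs_det_interpolationMatrix_le (γ := Q / P) (α := B / A) (ρ := Real.exp 3) (by positivity)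
    (by positivity) hδ hδ0 hX hSℓ hKR (Real.one_le_exp (by norm_num)) hρδ f
  set Δ := |((interpolationMatrix ℓ K R S (Q / P) (B / A)).submatrix f id).det| with hΔ
  have hΔ0 : 0 < Δ := abs_pos.mpr hf
  set lam := Real.log ((B : ℝ) / A) with hlam
  have hX0 : 0 < X := by rw [hX]; positivity
  have hl1 := Real.log_le_log one_pos hlow
  have hl2 := Real.log_le_log (by positivity) hup
  rw [Real.log_one, Real.log_mul hΔ0.ne' (by positivity), Real.log_mul (by positivity) (by positivity),
    Real.log_pow, Real.log_pow] at hl1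
  rw [Real.log_mul (by positivity) hΔ0.ne', Real.log_pow, Real.log_exp,
    Real.log_mul (by positivity) (by positivity), Real.log_prod (fun j _ => by positivity)] at hl2
  have hj : ∀ j : Fin 5 × Fin K,
      Real.log (2 * (((Real.exp 3 + 1) * X) ^ (j.2 : ℕ) / (j.2 : ℕ).factorial *
        Real.exp (Real.exp 3 * |lam| * X * |((j.1 : ℕ) : ℝ) - 2|))) =
      (Real.log 2 + ((j.2 : ℕ) * Real.log ((Real.exp 3 + 1) * X) - Real.log (j.2 : ℕ).factorial)) +
        Real.exp 3 * |lam| * X * |((j.1 : ℕ) : ℝ) - 2| := by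
    intro j
    rw [Real.log_mul (by positivity) (by positivity), Real.log_mul (by positivity) (by positivity),
      Real.log_exp, Real.log_div (by positivity) (by positivity), Real.log_pow]
    ring
  simp_rw [hj] at hl2
  set L := Real.log ((Real.exp 3 + 1) * X) with hL
  have hgauss : ∀ n : ℕ, ∑ k ∈ range n, (k : ℝ) = n * (n - 1) / 2 := by
    intro n
    induction n with
    | zero => simp
    | succ n ih =>
      rw [sum_range_succ, ih]
      push_cast
      ring
  have hsum : ∑ j : Fin 5 × Fin K, ((Real.log 2 + ((j.2 : ℕ) * L - Real.log (j.2 : ℕ).factorial)) +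
        Real.exp 3 * |lam| * X * |((j.1 : ℕ) : ℝ) - 2|) =
      5 * (K * Real.log 2 + (K * (K - 1) / 2 * L - ∑ k ∈ range K, Real.log k.factorial)) +
        K * (6 * (Real.exp 3 * |lam| * X)) := by
    rw [sum_add_distrib, Fintype.sum_prod_type, Fintype.sum_prod_type]
    simp only [sum_const, card_univ, Fintype.card_fin, nsmul_eq_mul]
    rw [Fin.sum_univ_eq_sum_range (fun k => Real.log 2 + ((k : ℝ) * L - Real.log k.factorial)) K,
      sum_add_distrib, sum_sub_distrib, ← sum_mul, hgauss, Fin.sum_univ_five]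
    norm_num
    ring
  rw [hsum] at hl2
  have hfacN : Real.log ((5 * K).factorial : ℝ) ≤ 5 * K * Real.log (5 * K) := by
    have h1 : ((5 * K).factorial : ℝ) ≤ (5 * (K : ℝ)) ^ (5 * K) := by
      exact_mod_cast Nat.factorial_le_pow (5 * K)
    have h2 := Real.log_le_log (by positivity) h1
    rw [Real.log_pow] at h2
    push_cast at h2
    exact h2
  have hS := sum_log_factorial_ge K
  have hN : ((∑ t ∈ range (5 * K), t : ℕ) : ℝ) = 5 * K * (5 * K - 1) / 2 := by
    push_cast
    rw [hgauss]
    push_cast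
    ring
  rw [hN] at hl2
  have hK0 : (0 : ℝ) < K := by exact_mod_cast hK
  refine le_of_mul_le_mul_left ?_ hK0
  push_cast at hl1
  nlinarith

theorem exp_three_lt : Real.exp 3 < 201 / 10 := by
  have h : Real.exp 3 = Real.exp 1 ^ 3 := by rw [← Real.exp_nat_mul]; norm_num
  rw [h]
  calc Real.exp 1 ^ 3 < 2.7182818286 ^ 3 := by gcongr; exact Real.exp_one_lt_d9
    _ < 201 / 10 := by norm_num

theorem pow_le_exp_natCast (n : ℕ) : (2.7182818283 : ℝ) ^ n ≤ Real.exp n := by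
  have h : Real.exp n = Real.exp 1 ^ n := by rw [← Real.exp_nat_mul]; norm_num
  rw [h]
  gcongr
  exact Real.exp_one_gt_d9.le

theorem log_660_le : Real.log 660 ≤ 13 / 2 := by
  have h : Real.log (660 ^ 2) ≤ 13 := by
    rw [Real.log_le_iff_le_exp (by norm_num)]
    refine le_trans ?_ ((pow_le_exp_natCast 13).trans_eq (by norm_num))
    norm_num
  rw [Real.log_pow] at h
  push_cast at h
  linarith

set_option maxHeartbeats 1000000 in
/-- A lower bound for a linear form in two logarithms, in the shape needed for two `ℓ`-th powers. -/
theorem mul_pow_ne_mul_pow_add {P Q C A B ℓ : ℕ} (hP : 0 < P) (hQ : 0 < Q) (hPQ : P ≠ Q)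
    (hPQ' : P * Q ≤ 4 * 10 ^ 13) (hC : 0 < C) (hC' : C ≤ 10 ^ 13) (hA : 4 ≤ A)
    (hℓ : 20000 ≤ ℓ) : P * B ^ ℓ ≠ Q * A ^ ℓ + C := by
  intro heq
  have hB : 0 < B := by
    rcases Nat.eq_zero_or_pos B with rfl | h
    · rw [zero_pow (by omega)] at heq
      omega
    · exact h
  have hA0 : 0 < A := by omega
  have hApow : 10 ^ 14 ≤ A ^ ℓ := by
    calc 10 ^ 14 ≤ 4 ^ 25 := by norm_num
      _ ≤ 4 ^ ℓ := Nat.pow_le_pow_right (by norm_num) (by omega)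
      _ ≤ A ^ ℓ := Nat.pow_le_pow_left hA _
  have hAB : A ≠ B := by
    rintro rfl
    rcases lt_or_gt_of_ne hPQ with h | h
    · have := Nat.mul_le_mul_right (A ^ ℓ) h.le
      omega
    · have := Nat.mul_le_mul_right (A ^ ℓ) (show Q + 1 ≤ P from h)
      rw [add_mul, one_mul] at this
      omega
  set T := Real.log A with hT
  have hT1 : (1.386 : ℝ) ≤ T := by
    have h1 : Real.log 4 ≤ T := Real.log_le_log (by norm_num) (by exact_mod_cast hA)
    have h2 : Real.log 4 = 2 * Real.log 2 := by
      rw [show (4 : ℝ) = 2 ^ 2 by norm_num, Real.log_pow]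
      norm_num
    have := Real.log_two_gt_d9
    linarith
  have hℓR : (20000 : ℝ) ≤ ℓ := by exact_mod_cast hℓ
  have hlogPQ : Real.log ((P : ℝ) * Q) ≤ 32 := by
    rw [Real.log_le_iff_le_exp (by positivity)]
    have h1 : (P : ℝ) * Q ≤ 4 * 10 ^ 13 := by exact_mod_cast hPQ'
    refine h1.trans (le_trans ?_ ((pow_le_exp_natCast 32).trans_eq (by norm_num)))
    norm_num
  have hlogP : 0 ≤ Real.log P := Real.log_nonneg (by exact_mod_cast hP)
  have hlogQ : 0 ≤ Real.log Q := Real.log_nonneg (by exact_mod_cast hQ)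
  have hlogγ : |Real.log ((Q : ℝ) / P)| ≤ 32 := by
    rw [Real.log_mul (by positivity) (by positivity)] at hlogPQ
    rw [Real.log_div (by positivity) (by positivity), abs_le]
    constructor <;> linarith
  set δ := ℓ * Real.log ((B : ℝ) / A) - Real.log ((Q : ℝ) / P) with hδ
  have hδeq : δ = Real.log (1 + C / (Q * (A : ℝ) ^ ℓ)) := by
    have h1 : (1 : ℝ) + C / (Q * (A : ℝ) ^ ℓ) = P * B ^ ℓ / (Q * A ^ ℓ) := by
      have : (P : ℝ) * B ^ ℓ = Q * A ^ ℓ + C := by exact_mod_cast heq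
      rw [this]
      field_simp
    rw [h1, Real.log_div (by positivity) (by positivity), Real.log_mul (by positivity) (by positivity),
      Real.log_mul (by positivity) (by positivity), Real.log_pow, Real.log_pow, hδ,
      Real.log_div (by positivity) (by positivity), Real.log_div (by positivity) (by positivity)]
    ring
  have hδ0 : 0 ≤ δ := by
    rw [hδeq]
    apply Real.log_nonneg
    have : 0 ≤ (C : ℝ) / (Q * (A : ℝ) ^ ℓ) := by positivity
    linarith
  have hApowR : (A : ℝ) ^ ℓ = Real.exp (ℓ * T) := by
    rw [Real.exp_nat_mul, Real.exp_log (by positivity)]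
  have hδ1 : δ ≤ 10 ^ 13 / Real.exp (ℓ * T) := by
    rw [hδeq, ← hApowR]
    have h1 := Real.log_le_sub_one_of_pos (x := 1 + (C : ℝ) / (Q * (A : ℝ) ^ ℓ)) (by positivity)
    have h2 : (C : ℝ) / (Q * (A : ℝ) ^ ℓ) ≤ 10 ^ 13 / (A : ℝ) ^ ℓ := by
      have hC1 : (C : ℝ) ≤ 10 ^ 13 := by exact_mod_cast hC'
      have hQ1 : (1 : ℝ) ≤ Q := by exact_mod_cast hQ
      apply div_le_div₀ (by positivity) hC1 (by positivity)
      exact le_mul_of_one_le_left (by positivity) hQ1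
    linarith
  have hδ2 : δ ≤ 1 := by
    refine hδ1.trans ?_
    rw [div_le_one (by positivity), ← hApowR]
    have : (10 : ℝ) ^ 14 ≤ (A : ℝ) ^ ℓ := by exact_mod_cast hApow
    linarith
  set lam := Real.log ((B : ℝ) / A) with hlam
  have hlam1 : ℓ * |lam| ≤ 33 := by
    have h1 : (ℓ : ℝ) * |lam| = |(ℓ : ℝ) * lam| := by rw [abs_mul, Nat.abs_cast]
    have h2 : (ℓ : ℝ) * lam = δ + Real.log ((Q : ℝ) / P) := by rw [hδ]; ring
    rw [h1, h2]
    refine (abs_add_le _ _).trans ?_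
    rw [abs_of_nonneg hδ0]
    linarith
  set K := ⌊ℓ * T / 16⌋₊ with hKdef
  set R := ⌈3 * T⌉₊ with hRdef
  set S := ℓ / 9 with hSdef
  have hK1 : (K : ℝ) ≤ ℓ * T / 16 := Nat.floor_le (by positivity)
  have hK2 : ℓ * T / 16 < K + 1 := Nat.lt_floor_add_one _
  have hR1 : 3 * T ≤ R := Nat.le_ceil _
  have hR2 : (R : ℝ) < 3 * T + 1 := Nat.ceil_lt_add_one (by positivity)
  have hS1 : (S : ℝ) ≤ ℓ / 9 := Nat.cast_div_le
  have hS2 : (ℓ : ℝ) / 9 - 1 < S := by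
    have : ℓ < 9 * (S + 1) := by omega
    have : (ℓ : ℝ) < 9 * (S + 1) := by exact_mod_cast this
    linarith
  have hℓT : 20000 * T ≤ ℓ * T := by gcongr
  have hKbig : (1731 : ℝ) ≤ K := by linarith
  have hTK : T ≤ (K + 1) / 1250 := by linarith
  have hRpos : 0 < R := by
    have : (0 : ℝ) < R := by linarith
    exact_mod_cast this
  have hKpos : 0 < K := by
    have : (0 : ℝ) < K := by linarith
    exact_mod_cast this
  have hS4 : ((S - 4 : ℕ) : ℝ) = S - 4 := by
    rw [Nat.cast_sub (by omega)]
    norm_num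
  have hineq := interpolation_log_inequality (K := K) (R := R) (S := S) (X := R * ℓ / 2) hP hQ hA0 hB
    hAB hKpos hRpos (by omega) hδ hδ0 rfl (Nat.div_le_self _ _) ?_ ?_ ?_
  · have hX1 : (Real.exp 3 + 1) * (R * ℓ / 2) ≤ 660 * K := by
      have h1 := exp_three_lt
      calc (Real.exp 3 + 1) * ((R : ℝ) * ℓ / 2) ≤ (201 / 10 + 1) * ((3 * T + 1) * ℓ / 2) := by gcongr
        _ ≤ 660 * (ℓ * T / 16 - 1) := by nlinarith
        _ ≤ 660 * K := by linarith
    have hlogX : Real.log ((Real.exp 3 + 1) * (R * ℓ / 2)) - Real.log K ≤ 13 / 2 := by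
      have h1 := Real.log_le_log (by positivity) hX1
      rw [Real.log_mul (x := 660) (by norm_num) (by positivity)] at h1
      have := log_660_le
      linarith
    have hlog5 : Real.log (5 * K) ≤ 5 * K / 600 + 6 := by
      have h1 : Real.log (5 * K / 600) ≤ 5 * K / 600 - 1 := Real.log_le_sub_one_of_pos (by positivity)
      rw [Real.log_div (by positivity) (by norm_num)] at h1
      have h2 : Real.log 600 ≤ 7 := by
        have h3 : Real.log 600 ≤ Real.log 660 := Real.log_le_log (by norm_num) (by norm_num)
        have := log_660_le
        linarith
      linarith
    have hlog2 : Real.log 2 ≤ 1 := by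
      have := Real.log_two_lt_d9
      linarith
    have hterm : 6 * (Real.exp 3 * |lam| * (R * ℓ / 2)) ≤ 1990 * (3 * T + 1) := by
      have h1 := exp_three_lt
      calc 6 * (Real.exp 3 * |lam| * (R * ℓ / 2)) = 3 * Real.exp 3 * (ℓ * |lam|) * R := by ring
        _ ≤ 3 * (201 / 10) * 33 * (3 * T + 1) := by gcongr
        _ ≤ 1990 * (3 * T + 1) := by linarith
    have hRterm : 3 * ((R - 1 : ℕ) : ℝ) * Real.log ((P : ℝ) * Q) ≤ 96 * (3 * T + 1) := by
      have h1 : ((R - 1 : ℕ) : ℝ) ≤ R := by exact_mod_cast Nat.sub_le _ _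
      have h2 : ((R - 1 : ℕ) : ℝ) ≤ 3 * T + 1 := by linarith
      calc 3 * ((R - 1 : ℕ) : ℝ) * Real.log ((P : ℝ) * Q) ≤ 3 * (3 * T + 1) * 32 := by
            gcongr
            rw [Real.log_mul (by positivity) (by positivity)]
            positivity
        _ = _ := by ring
    have hlogAB : Real.log ((A : ℝ) * B) = 2 * T + lam := by
      rw [Real.log_mul (by positivity) (by positivity), hlam,
        Real.log_div (by positivity) (by positivity)]
      ring
    have hSterm : 3 * ((S - 1 : ℕ) : ℝ) * Real.log ((A : ℝ) * B) ≤ 2 / 3 * (ℓ * T) + 11 := by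
      have h1 : ((S - 1 : ℕ) : ℝ) ≤ S := by exact_mod_cast Nat.sub_le _ _
      have h2 : ((S - 1 : ℕ) : ℝ) ≤ ℓ / 9 := by linarith
      rw [hlogAB]
      calc 3 * ((S - 1 : ℕ) : ℝ) * (2 * T + lam) ≤ 3 * ((S - 1 : ℕ) : ℝ) * (2 * T + |lam|) := by
            gcongr
            exact le_abs_self _
        _ ≤ 3 * (ℓ / 9) * (2 * T + |lam|) := by gcongr
        _ = 2 / 3 * (ℓ * T) + ℓ * |lam| / 3 := by ring
        _ ≤ _ := by linarith
    have hKterm : 5 / 2 * ((K : ℝ) - 1) *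
        (Real.log ((Real.exp 3 + 1) * (R * ℓ / 2)) - Real.log K + 3 / 2) ≤
        5 / 2 * ((K : ℝ) - 1) * 8 := by
      apply mul_le_mul_of_nonneg_left
      · linarith
      · linarith
    linarith
  · have : (K : ℝ) ≤ R * ℓ := by nlinarith
    exact_mod_cast this
  · have : 5 * (K : ℝ) ≤ R * ((S - 4 : ℕ) : ℝ) := by
      rw [hS4]
      calc 5 * (K : ℝ) ≤ 3 * T * (ℓ / 9 - 1 - 4) := by nlinarith
        _ ≤ R * (S - 4) := by
          apply mul_le_mul hR1 (by linarith) (by linarith) (by positivity)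
    exact_mod_cast this
  · rw [← Real.exp_nat_mul]
    have h1 : ((5 * K : ℕ) : ℝ) * 3 ≤ 15 / 16 * (ℓ * T) := by
      push_cast
      linarith
    have h2 : 8 * (R : ℝ) * 10 ^ 13 ≤ Real.exp (ℓ * T / 16) := by
      have h3 : Real.exp (ℓ * T / 16) = Real.exp 32 * Real.exp (ℓ * T / 16 - 32) := by
        rw [← Real.exp_add]
        congr 1
        ring
      have h4 : (10 : ℝ) ^ 13 ≤ Real.exp 32 := by
        refine le_trans ?_ ((pow_le_exp_natCast 32).trans_eq (by norm_num))
        norm_num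
      have h5 := Real.add_one_le_exp (ℓ * T / 16 - 32)
      rw [h3, mul_comm]
      apply mul_le_mul h4 _ (by positivity) (by positivity)
      linarith
    calc Real.exp (((5 * K : ℕ) : ℝ) * 3) * (8 * R * δ)
        ≤ Real.exp (15 / 16 * (ℓ * T)) * (8 * R * (10 ^ 13 / Real.exp (ℓ * T))) := by gcongr
      _ = Real.exp (15 / 16 * (ℓ * T)) / Real.exp (ℓ * T) * (8 * R * 10 ^ 13) := by ring
      _ ≤ Real.exp (15 / 16 * (ℓ * T)) / Real.exp (ℓ * T) * Real.exp (ℓ * T / 16) := by gcongr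
      _ = 1 := by
        rw [← Real.exp_sub, ← Real.exp_add, ← Real.exp_zero]
        congr 1
        ring

/-- `force n f = f n`, but evaluation by the kernel reduces `n` to a numeral first. -/
def force {α : Type} (n : ℕ) (f : ℕ → α) : α :=
  match n with
  | 0 => f 0
  | m + 1 => f (m + 1)

theorem force_eq {α : Type} (n : ℕ) (f : ℕ → α) : force n f = f n := by
  cases n <;> rfl

/-- The residues of `z, z * ζ, …, z * ζ ^ (n - 1)` modulo `q`. -/
def powersMod (q ζ : ℕ) : ℕ → ℕ → List ℕ
  | 0, _ => []
  | n + 1, z => force z fun z => z :: powersMod q ζ n (z * ζ % q)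

/-- No `Q * z + C` with `z` in the list is zero or has `2 * k`-th power congruent to `p`. -/
def avoids (q k p Q C : ℕ) : List ℕ → Bool
  | [] => true
  | z :: zs => force ((Q * z + C) ^ (2 * k) % q) fun w =>
      bif w == 0 then false else bif w == p then false else avoids q k p Q C zs

/-- The triple `(P, Q, C)` is excluded modulo `q`, where `zs` lists the `k`-th roots of unity. -/
def killed (q k : ℕ) (zs : List ℕ) (t : ℕ × ℕ × ℕ) : Bool :=
  force (t.1 ^ (2 * k) % q) fun p => force t.2.1 fun Q => force t.2.2 fun C =>
    avoids q k p Q C (0 :: zs)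

/-- `ζ` has multiplicative order `k` modulo `q`. -/
def isOrder (q k ζ : ℕ) : Bool :=
  ζ ^ k % q == 1 && (powersMod q ζ (k - 1) ζ).all fun z => !(z == 1)

/-- The first `c ^ (2 * ℓ) % q` of order `k`, or `0` if there is none. -/
def findRoot (q k ℓ : ℕ) : List ℕ → ℕ
  | [] => 0
  | c :: cs => force (c ^ (2 * ℓ) % q) fun ζ => bif isOrder q k ζ then ζ else findRoot q k ℓ cs

/-- Pocklington's test for `q = 2 * k * ℓ + 1`, with trial division for small `ℓ`. -/
def primeTest (ℓ k q : ℕ) : Bool :=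
  bif Nat.ble (2 * k) ℓ then 2 ^ (q - 1) % q == 1 && Nat.gcd (2 ^ (2 * k) - 1) q == 1
  else Nat.ble q 3000 && (List.range 53).all fun d => Nat.ble q (d + 2) || !(q % (d + 2) == 0)

/-- Every triple of the list is excluded modulo some prime `2 * k * ℓ + 1`. -/
def sieve (ℓ : ℕ) : ℕ → ℕ → List (ℕ × ℕ × ℕ) → Bool
  | _, _, [] => true
  | 0, _, _ => false
  | n + 1, k, t :: ts => force (2 * k * ℓ + 1) fun q =>
    bif primeTest ℓ k q then
      force (findRoot q k ℓ [2, 3, 5, 6, 7, 10, 11, 13]) fun ζ =>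
        bif ζ == 0 then sieve ℓ n (k + 1) (t :: ts) else
        sieve ℓ n (k + 1) ((t :: ts).filter fun t => !killed q k (powersMod q ζ k 1) t)
    else sieve ℓ n (k + 1) (t :: ts)

/-- The coefficients `(P, Q, C)` of the equations `P * b ^ ℓ = Q * (a ^ 2) ^ ℓ + C` to be solved. -/
def descentTriples : List (ℕ × ℕ × ℕ) :=
  [1, 3, 17, 51, 49, 147, 833, 2499].flatMap fun g =>
    [(4 * g ^ 3, 25, 25 * 2499 * g ^ 2), (2500 * g ^ 3, 1, 2499 * 625 * g ^ 2)]

/-- The sieve succeeds for `n` consecutive exponents, apart from those failing a Fermat test. -/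
def sieveRange : ℕ → ℕ → Bool
  | 0, _ => true
  | n + 1, ℓ => force ℓ fun ℓ =>
    (!(2 ^ ℓ % ℓ == 2) || sieve ℓ 60 1 descentTriples) && sieveRange n (ℓ + 1)

theorem exists_mem_powersMod {q ζ : ℕ} (hq : 0 < q) {n i : ℕ} (hi : i < n) {z : ℕ} (hz : z < q) :
    ∃ w ∈ powersMod q ζ n z, w < q ∧ (w : ZMod q) = z * (ζ : ZMod q) ^ i := by
  induction n generalizing i z with
  | zero => omega
  | succ n ih =>
    rw [powersMod, force_eq]
    rcases i with _ | i
    · exact ⟨z, by simp, hz, by simp⟩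
    · obtain ⟨w, hw, hwq, h⟩ := ih (i := i) (by omega) (Nat.mod_lt (z * ζ) hq)
      refine ⟨w, List.mem_cons_of_mem _ hw, hwq, ?_⟩
      rw [h, ZMod.natCast_mod]
      push_cast
      ring

theorem isPrimitiveRoot_of_isOrder {q k ζ : ℕ} (hq : 1 < q) (hk : 0 < k) (hζ : ζ < q)
    (h : isOrder q k ζ = true) : IsPrimitiveRoot (ζ : ZMod q) k := by
  simp only [isOrder, Bool.and_eq_true, beq_iff_eq, List.all_eq_true, Bool.not_eq_true',
    beq_eq_false_iff_ne] at h
  obtain ⟨h1, h2⟩ := h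
  refine IsPrimitiveRoot.mk_of_lt _ hk ?_ ?_
  · have : ((ζ ^ k % q : ℕ) : ZMod q) = 1 := by rw [h1]; simp
    rw [ZMod.natCast_mod] at this
    exact_mod_cast this
  · intro l hl0 hlk hl
    obtain ⟨w, hw, hwq, hw2⟩ := exists_mem_powersMod (q := q) (ζ := ζ) (by omega) (n := k - 1)
      (i := l - 1) (by omega) hζ
    rw [← pow_succ', Nat.sub_add_cancel hl0, hl] at hw2
    apply h2 w hw
    have h3 : (w : ZMod q) = (1 : ℕ) := by rw [hw2]; simp
    rw [ZMod.natCast_eq_natCast_iff', Nat.mod_eq_of_lt hwq, Nat.mod_eq_of_lt hq] at h3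
    exact h3

theorem findRoot_spec {q k ℓ : ℕ} (hq : 1 < q) (hk : 0 < k) (cs : List ℕ)
    (h : findRoot q k ℓ cs ≠ 0) :
    findRoot q k ℓ cs < q ∧ IsPrimitiveRoot (findRoot q k ℓ cs : ZMod q) k := by
  induction cs with
  | nil => simp [findRoot] at h
  | cons c cs ih =>
    rw [findRoot, force_eq] at h ⊢
    rcases hb : isOrder q k (c ^ (2 * ℓ) % q) with _ | _
    · rw [hb] at h
      rw [cond_false] at h ⊢
      exact ih h
    · rw [cond_true]
      have : c ^ (2 * ℓ) % q < q := Nat.mod_lt _ (by omega)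
      exact ⟨this, isPrimitiveRoot_of_isOrder hq hk this hb⟩

theorem ne_of_avoids {q k p Q C : ℕ} {zs : List ℕ} (h : avoids q k p Q C zs = true) {z : ℕ}
    (hz : z ∈ zs) : (Q * z + C) ^ (2 * k) % q ≠ 0 ∧ (Q * z + C) ^ (2 * k) % q ≠ p := by
  induction zs with
  | nil => simp at hz
  | cons y zs ih =>
    rw [avoids, force_eq] at h
    simp only [Bool.cond_eq_ite, beq_iff_eq] at h
    split_ifs at h with h1 h2
    rcases List.mem_cons.mp hz with rfl | hz
    · exact ⟨h1, h2⟩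
    · exact ih h hz

theorem killed_spec {q k ℓ ζ : ℕ} (hq : q.Prime) (hk : 0 < k) (hℓ : 0 < ℓ) (hqk : q = 2 * k * ℓ + 1)
    (hζ : IsPrimitiveRoot (ζ : ZMod q) k) {t : ℕ × ℕ × ℕ}
    (h : killed q k (powersMod q ζ k 1) t = true) (a b : ℕ) :
    t.1 * b ^ ℓ ≠ t.2.1 * (a ^ 2) ^ ℓ + t.2.2 := by
  intro heq
  have := Fact.mk hq
  have : NeZero k := ⟨hk.ne'⟩
  obtain ⟨P, Q, C⟩ := t
  simp only [killed, force_eq] at h heq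
  have hz : ∃ z ∈ 0 :: powersMod q ζ k 1, (z : ZMod q) = (a ^ 2) ^ ℓ := by
    by_cases ha : (a : ZMod q) = 0
    · exact ⟨0, by simp, by simp [ha, hℓ.ne']⟩
    · have h1 : (((a : ZMod q) ^ 2) ^ ℓ) ^ k = 1 := by
        rw [← pow_mul, ← pow_mul, ← ZMod.pow_card_sub_one_eq_one ha]
        congr 1
        rw [hqk]
        simp only [Nat.add_sub_cancel]
        ring
      obtain ⟨i, hi, hi2⟩ := hζ.eq_pow_of_pow_eq_one h1
      obtain ⟨w, hw, -, hw2⟩ := exists_mem_powersMod (ζ := ζ) hq.pos hi hq.one_lt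
      refine ⟨w, List.mem_cons_of_mem _ hw, ?_⟩
      rw [hw2, hi2]
      simp
  obtain ⟨z, hz, hz2⟩ := hz
  obtain ⟨h1, h2⟩ := ne_of_avoids h hz
  have hcast : ((Q * z + C : ℕ) : ZMod q) = P * b ^ ℓ := by
    have : ((P * b ^ ℓ : ℕ) : ZMod q) = ((Q * (a ^ 2) ^ ℓ + C : ℕ) : ZMod q) := by rw [heq]
    push_cast at this ⊢
    rw [hz2, this]
  by_cases hb : (b : ZMod q) = 0
  · apply h1
    rw [← Nat.dvd_iff_mod_eq_zero, ← ZMod.natCast_eq_zero_iff]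
    rw [Nat.cast_pow, hcast, hb, zero_pow hℓ.ne', mul_zero, zero_pow (by omega)]
  · apply h2
    rw [← ZMod.natCast_eq_natCast_iff', Nat.cast_pow, hcast, mul_pow, ← pow_mul]
    have : (b : ZMod q) ^ (ℓ * (2 * k)) = 1 := by
      rw [← ZMod.pow_card_sub_one_eq_one hb]
      congr 1
      rw [hqk]
      simp only [Nat.add_sub_cancel]
      ring
    rw [this, mul_one, Nat.cast_pow]

/-- Pocklington's criterion. -/
theorem prime_of_pow_mod_eq_one {ℓ k q : ℕ} (hℓ : ℓ.Prime) (hk : 0 < k) (hkℓ : 2 * k ≤ ℓ)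
    (hqk : q = 2 * k * ℓ + 1) (h1 : 2 ^ (q - 1) % q = 1) (h2 : Nat.gcd (2 ^ (2 * k) - 1) q = 1) :
    q.Prime := by
  have hℓ2 := hℓ.two_le
  have hq1 : 1 < q := by
    have : 0 < 2 * k * ℓ := by positivity
    omega
  by_contra hnp
  set p := q.minFac with hpdef
  have hp : p.Prime := Nat.minFac_prime hq1.ne'
  have hpq : p ∣ q := Nat.minFac_dvd q
  have hpsq : p ^ 2 ≤ q := Nat.minFac_sq_le_self (by omega) hnp
  have := Fact.mk hp
  have h3 : ((2 : ZMod p) ^ (2 * k)) ^ ℓ = 1 := by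
    have h4 : 2 ^ (q - 1) ≡ 1 [MOD q] := by
      rw [Nat.ModEq, h1, Nat.mod_eq_of_lt hq1]
    have h5 := (ZMod.natCast_eq_natCast_iff _ _ p).mpr (h4.of_dvd hpq)
    push_cast at h5
    rw [← pow_mul, ← h5, hqk]
    rfl
  have h4 : (2 : ZMod p) ^ (2 * k) ≠ 1 := by
    intro h4
    have h5 : p ∣ 2 ^ (2 * k) - 1 := by
      rw [← ZMod.natCast_eq_zero_iff, Nat.cast_sub Nat.one_le_two_pow]
      push_cast
      rw [h4, sub_self]
    have := Nat.dvd_gcd h5 hpq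
    rw [h2] at this
    exact hp.one_lt.ne' (Nat.dvd_one.mp this)
  have := Fact.mk hℓ
  have h5 : orderOf ((2 : ZMod p) ^ (2 * k)) = ℓ := orderOf_eq_prime h3 h4
  have h6 : ℓ ∣ p - 1 := by
    rw [← h5]
    apply ZMod.orderOf_dvd_card_sub_one
    intro h0
    rw [h0, zero_pow hℓ.ne_zero] at h3
    exact zero_ne_one h3
  have h7 : ℓ ≤ p - 1 := Nat.le_of_dvd (by have := hp.two_le; omega) h6
  have h8 : ℓ + 1 ≤ p := by omega
  nlinarith

theorem prime_of_primeTest {ℓ k q : ℕ} (hℓ : ℓ.Prime) (hk : 0 < k) (hqk : q = 2 * k * ℓ + 1)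
    (h : primeTest ℓ k q = true) : q.Prime := by
  rw [primeTest, Bool.cond_eq_ite] at h
  split_ifs at h with hle
  · simp only [Bool.and_eq_true, beq_iff_eq] at h
    exact prime_of_pow_mod_eq_one hℓ hk (Nat.le_of_ble_eq_true hle) hqk h.1 h.2
  · simp only [Bool.and_eq_true, List.all_eq_true, Bool.or_eq_true, Bool.not_eq_true',
      beq_eq_false_iff_ne, List.mem_range] at h
    obtain ⟨h1, h2⟩ := h
    have h1 := Nat.le_of_ble_eq_true h1
    have hq1 : 1 < q := by
      have := hℓ.pos
      have : 0 < 2 * k * ℓ := by positivity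
      omega
    by_contra hnp
    have hpsq := Nat.minFac_sq_le_self (by omega) hnp
    have hp := (Nat.minFac_prime hq1.ne').two_le
    have hlt : q.minFac < 55 := by
      by_contra hge
      have := Nat.pow_le_pow_left (not_lt.mp hge) 2
      omega
    have h3 := h2 (q.minFac - 2) (by omega)
    rw [Nat.sub_add_cancel hp] at h3
    refine (h3.resolve_left fun h4 => ?_) ?_
    · have h5 := Nat.le_of_ble_eq_true h4
      have h6 := Nat.mul_le_mul_right q.minFac hp
      rw [sq] at hpsq
      omega
    exact Nat.mod_eq_zero_of_dvd (Nat.minFac_dvd q)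

theorem sieve_spec {ℓ : ℕ} (hℓ : ℓ.Prime) (n k : ℕ) (hk : 0 < k) (ts : List (ℕ × ℕ × ℕ))
    (h : sieve ℓ n k ts = true) (t : ℕ × ℕ × ℕ) (ht : t ∈ ts) (a b : ℕ) :
    t.1 * b ^ ℓ ≠ t.2.1 * (a ^ 2) ^ ℓ + t.2.2 := by
  induction n generalizing k ts with
  | zero =>
    cases ts with
    | nil => simp at ht
    | cons => simp [sieve] at h
  | succ n ih =>
    cases ts with
    | nil => simp at ht
    | cons s ts =>
      simp only [sieve, force_eq, Bool.cond_eq_ite] at h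
      split_ifs at h with h1 h2
      · exact ih (k + 1) (by omega) _ h ht
      · rw [beq_iff_eq] at h2
        have hq := prime_of_primeTest hℓ hk rfl h1
        have hspec := findRoot_spec hq.one_lt hk _ h2
        by_cases hkill : killed (2 * k * ℓ + 1) k (powersMod (2 * k * ℓ + 1)
            (findRoot (2 * k * ℓ + 1) k ℓ [2, 3, 5, 6, 7, 10, 11, 13]) k 1) t = true
        · exact killed_spec hq hk hℓ.pos rfl hspec.2 hkill a b
        · refine ih (k + 1) (by omega) _ h (List.mem_filter.mpr ⟨ht, ?_⟩)
          simpa using hkill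
      · exact ih (k + 1) (by omega) _ h ht

theorem sieveRange_spec (n ℓ₀ : ℕ) (h : sieveRange n ℓ₀ = true) {ℓ : ℕ} (hℓ : ℓ.Prime) (hℓ2 : 2 < ℓ)
    (h0 : ℓ₀ ≤ ℓ) (h1 : ℓ < ℓ₀ + n) (t : ℕ × ℕ × ℕ) (ht : t ∈ descentTriples) (a b : ℕ) :
    t.1 * b ^ ℓ ≠ t.2.1 * (a ^ 2) ^ ℓ + t.2.2 := by
  induction n generalizing ℓ₀ with
  | zero => omega
  | succ n ih =>
    simp only [sieveRange, force_eq, Bool.and_eq_true] at h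
    rcases h0.eq_or_lt with rfl | hlt
    · have hF : 2 ^ ℓ₀ % ℓ₀ = 2 := by
        have := Fact.mk hℓ
        have h3 : ((2 ^ ℓ₀ : ℕ) : ZMod ℓ₀) = (2 : ℕ) := by
          push_cast
          exact ZMod.pow_card _
        rw [ZMod.natCast_eq_natCast_iff', Nat.mod_eq_of_lt hℓ2] at h3
        exact h3
      have h2 := h.1
      simp only [hF, beq_self_eq_true, Bool.not_true, Bool.false_or] at h2
      exact sieve_spec hℓ 60 1 one_pos _ h2 t ht a b
    · exact ih (ℓ₀ + 1) h.2 hlt (by omega)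

theorem sieveRange_eq_true : sieveRange 19989 11 = true := by decide +kernel

theorem exists_factor_coprime {u w : ℕ} (h : 4 * w = u ^ 2 + 2499) :
    ∃ g ∈ [1, 3, 17, 51, 49, 147, 833, 2499], ∃ w', w = g * w' ∧ Nat.Coprime (u * g) w' := by
  have h3 : ∃ g w', (g = 1 ∨ g = 3) ∧ w = g * w' ∧ (3 ∣ u * g → ¬ 3 ∣ w') := by
    by_cases hu : 3 ∣ u
    · obtain ⟨v, rfl⟩ := hu
      have h' : 4 * w = 9 * v ^ 2 + 2499 := by rw [h]; ring
      refine ⟨3, w / 3, by simp, by omega, fun _ => by omega⟩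
    · exact ⟨1, w, by simp, by simp, fun h => by omega⟩
  have h17 : ∃ g w', (g = 1 ∨ g = 17) ∧ w = g * w' ∧ (17 ∣ u * g → ¬ 17 ∣ w') := by
    by_cases hu : 17 ∣ u
    · obtain ⟨v, rfl⟩ := hu
      have h' : 4 * w = 289 * v ^ 2 + 2499 := by rw [h]; ring
      refine ⟨17, w / 17, by simp, by omega, fun _ => by omega⟩
    · exact ⟨1, w, by simp, by simp, fun h => by omega⟩
  have h7 : ∃ g w', (g = 1 ∨ g = 49) ∧ w = g * w' ∧ (7 ∣ u * g → ¬ 7 ∣ w') := by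
    by_cases hu : 7 ∣ u
    · obtain ⟨v, rfl⟩ := hu
      have h' : 4 * w = 49 * v ^ 2 + 2499 := by rw [h]; ring
      have hv : v ^ 2 % 7 = 0 ∨ v ^ 2 % 7 = 1 ∨ v ^ 2 % 7 = 2 ∨ v ^ 2 % 7 = 4 := by
        have : v % 7 < 7 := Nat.mod_lt _ (by norm_num)
        rw [Nat.pow_mod]
        interval_cases v % 7 <;> simp
      refine ⟨49, w / 49, by simp, by omega, fun _ => by omega⟩
    · exact ⟨1, w, by simp, by simp, fun h => by omega⟩
  obtain ⟨a, wa, ha, hwa, ha'⟩ := h3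
  obtain ⟨b, wb, hb, hwb, hb'⟩ := h17
  obtain ⟨c, wc, hc, hwc, hc'⟩ := h7
  have hab : Nat.Coprime a b := by rcases ha with rfl | rfl <;> rcases hb with rfl | rfl <;> norm_num
  have habc : Nat.Coprime (a * b) c := by
    rcases ha with rfl | rfl <;> rcases hb with rfl | rfl <;> rcases hc with rfl | rfl <;> norm_num
  obtain ⟨w', hw'⟩ : a * b * c ∣ w := by
    refine habc.mul_dvd_of_dvd_of_dvd (hab.mul_dvd_of_dvd_of_dvd ?_ ?_) ?_
    exacts [⟨_, hwa⟩, ⟨_, hwb⟩, ⟨_, hwc⟩]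
  have hapos : 0 < a := by omega
  have hbpos : 0 < b := by omega
  have hcpos : 0 < c := by omega
  have hwa2 : wa = b * c * w' := by
    apply Nat.eq_of_mul_eq_mul_left hapos
    rw [← hwa, hw']; ring
  have hwb2 : wb = a * c * w' := by
    apply Nat.eq_of_mul_eq_mul_left hbpos
    rw [← hwb, hw']; ring
  have hwc2 : wc = a * b * w' := by
    apply Nat.eq_of_mul_eq_mul_left hcpos
    rw [← hwc, hw']; ring
  refine ⟨a * b * c, ?_, w', hw', ?_⟩
  · rcases ha with rfl | rfl <;> rcases hb with rfl | rfl <;> rcases hc with rfl | rfl <;> simp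
  · refine Nat.Coprime.symm (Nat.coprime_of_dvd fun p hp hpw hpu => ?_)
    have hp2499 : p ∣ 3 ∨ p ∣ 7 ∨ p ∣ 17 := by
      have hpd : p ∣ 3 * 7 ^ 2 * 17 := by
        rcases hp.dvd_mul.mp hpu with h1 | h1
        · have h2 : p ∣ 4 * w := by rw [hw']; exact (hpw.mul_left _).mul_left _
          rw [h] at h2
          exact (Nat.dvd_add_right (dvd_pow h1 two_ne_zero)).mp h2
        · refine h1.trans ?_
          rcases ha with rfl | rfl <;> rcases hb with rfl | rfl <;> rcases hc with rfl | rfl <;> norm_num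
      rcases hp.dvd_mul.mp hpd with h1 | h1
      · rcases hp.dvd_mul.mp h1 with h1 | h1
        · exact Or.inl h1
        · exact Or.inr (Or.inl (hp.dvd_of_dvd_pow h1))
      · exact Or.inr (Or.inr h1)
    rcases hp2499 with h1 | h1 | h1
    · obtain rfl := (Nat.prime_dvd_prime_iff_eq hp (by norm_num)).mp h1
      refine ha' ?_ (hwa2 ▸ hpw.mul_left _)
      rcases hp.dvd_mul.mp hpu with h2 | h2
      · exact h2.mul_right _
      · refine Dvd.dvd.mul_left ?_ u
        clear * - ha hb hc h2
        rcases ha with rfl | rfl <;> rcases hb with rfl | rfl <;> rcases hc with rfl | rfl <;> omega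
    · obtain rfl := (Nat.prime_dvd_prime_iff_eq hp (by norm_num)).mp h1
      refine hc' ?_ (hwc2 ▸ hpw.mul_left _)
      rcases hp.dvd_mul.mp hpu with h2 | h2
      · exact h2.mul_right _
      · refine Dvd.dvd.mul_left ?_ u
        clear * - ha hb hc h2
        rcases ha with rfl | rfl <;> rcases hb with rfl | rfl <;> rcases hc with rfl | rfl <;> omega
    · obtain rfl := (Nat.prime_dvd_prime_iff_eq hp (by norm_num)).mp h1
      refine hb' ?_ (hwb2 ▸ hpw.mul_left _)
      rcases hp.dvd_mul.mp hpu with h2 | h2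
      · exact h2.mul_right _
      · refine Dvd.dvd.mul_left ?_ u
        clear * - ha hb hc h2
        rcases ha with rfl | rfl <;> rcases hb with rfl | rfl <;> rcases hc with rfl | rfl <;> omega

theorem exists_pow_of_coprime_mul_eq_pow {a b c n : ℕ} (h : Nat.Coprime a b) (habc : a * b = c ^ n) :
    (∃ d, a = d ^ n) ∧ ∃ d, b = d ^ n := by
  refine ⟨exists_eq_pow_of_mul_eq_pow ?_ habc, exists_eq_pow_of_mul_eq_pow ?_ ((mul_comm b a).trans habc)⟩
  · exact Nat.isUnit_iff.mpr h
  · exact Nat.isUnit_iff.mpr h.symm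

theorem descent {u w Y ℓ : ℕ} (h : 4 * w = u ^ 2 + 2499) (hY : 25 * (u * w) = Y ^ ℓ) :
    ∃ g ∈ [1, 3, 17, 51, 49, 147, 833, 2499], ∃ a b, (u * g = a ^ ℓ ∧ 25 * w = g * b ^ ℓ) ∨
      (25 * (u * g) = a ^ ℓ ∧ w = g * b ^ ℓ) := by
  obtain ⟨g, hg, w', hw, hco⟩ := exists_factor_coprime h
  refine ⟨g, hg, ?_⟩
  have hg5 : ¬ 5 ∣ g := by
    simp only [List.mem_cons, List.not_mem_nil, or_false] at hg
    omega
  have h5 : Nat.Prime 5 := by norm_num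
  by_cases hu : 5 ∣ u
  · have hw5 : ¬ 5 ∣ w' := by
      intro h1
      have h2 : 5 ∣ w := hw ▸ h1.mul_left _
      obtain ⟨v, rfl⟩ := hu
      have h' : 4 * w = 25 * v ^ 2 + 2499 := by rw [h]; ring
      omega
    have hco' : Nat.Coprime (25 * (u * g)) w' := by
      refine Nat.Coprime.mul_left ?_ hco
      exact Nat.Coprime.pow_left 2 ((Nat.Prime.coprime_iff_not_dvd h5).mpr hw5)
    obtain ⟨⟨a, ha⟩, b, hb⟩ := exists_pow_of_coprime_mul_eq_pow hco'
      (c := Y) (n := ℓ) (by rw [← hY, hw]; ring)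
    exact ⟨a, b, Or.inr ⟨ha, by rw [hw, hb]⟩⟩
  · have hug : ¬ 5 ∣ u * g := by
      rw [h5.dvd_mul]
      tauto
    have hco' : Nat.Coprime (u * g) (25 * w') := by
      refine Nat.Coprime.mul_right ?_ hco
      exact Nat.Coprime.pow_right 2 ((Nat.Prime.coprime_iff_not_dvd h5).mpr hug).symm
    obtain ⟨⟨a, ha⟩, b, hb⟩ := exists_pow_of_coprime_mul_eq_pow hco'
      (c := Y) (n := ℓ) (by rw [← hY, hw]; ring)
    exact ⟨a, b, Or.inl ⟨ha, by rw [hw, ← hb]; ring⟩⟩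

theorem descent_equation_left {u w g a b ℓ : ℕ} (h : 4 * w = u ^ 2 + 2499) (h1 : u * g = a ^ ℓ)
    (h2 : 25 * w = g * b ^ ℓ) : 4 * g ^ 3 * b ^ ℓ = 25 * (a ^ 2) ^ ℓ + 25 * 2499 * g ^ 2 :=
  calc 4 * g ^ 3 * b ^ ℓ = g ^ 2 * (25 * (4 * w)) := by
        rw [show g ^ 2 * (25 * (4 * w)) = 4 * g ^ 2 * (25 * w) by ring, h2]; ring
    _ = 25 * (u * g) ^ 2 + 25 * 2499 * g ^ 2 := by rw [h]; ring
    _ = _ := by rw [h1]; ring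

theorem descent_equation_right {u w g a b ℓ : ℕ} (h : 4 * w = u ^ 2 + 2499)
    (h1 : 25 * (u * g) = a ^ ℓ) (h2 : w = g * b ^ ℓ) :
    2500 * g ^ 3 * b ^ ℓ = (a ^ 2) ^ ℓ + 2499 * 625 * g ^ 2 :=
  calc 2500 * g ^ 3 * b ^ ℓ = 625 * g ^ 2 * (4 * w) := by rw [h2]; ring
    _ = (25 * (u * g)) ^ 2 + 2499 * 625 * g ^ 2 := by rw [h]; ring
    _ = _ := by rw [h1]; ring

theorem no_solution_of_eleven_le {u w Y ℓ : ℕ} (hu : 1 < u) (h : 4 * w = u ^ 2 + 2499) (hℓ : ℓ.Prime)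
    (hℓ11 : 11 ≤ ℓ) : 25 * (u * w) ≠ Y ^ ℓ := by
  intro hY
  obtain ⟨g, hg, a, b, hab⟩ := descent h hY
  have hgpos : 0 < g := by
    simp only [List.mem_cons, List.not_mem_nil, or_false] at hg
    omega
  have hg2499 : g ≤ 2499 := by
    simp only [List.mem_cons, List.not_mem_nil, or_false] at hg
    omega
  have ha2 : 2 ≤ a := by
    by_contra hlt
    have h1 : a ^ ℓ ≤ 1 := by
      rcases (show a = 0 ∨ a = 1 by omega) with rfl | rfl
      · rw [zero_pow hℓ.ne_zero]; norm_num
      · simp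
    have h2 : 1 < u * g := by nlinarith
    omega
  obtain ⟨P, Q, C, hmem, hP, hQ, hPQ, hPQ', hC, hC', heq⟩ : ∃ P Q C : ℕ, (P, Q, C) ∈ descentTriples ∧
      0 < P ∧ 0 < Q ∧ P ≠ Q ∧ P * Q ≤ 4 * 10 ^ 13 ∧ 0 < C ∧ C ≤ 10 ^ 13 ∧
      P * b ^ ℓ = Q * (a ^ 2) ^ ℓ + C := by
    have hg3 : g ^ 3 ≤ 2499 ^ 3 := Nat.pow_le_pow_left hg2499 3
    have hg2 : g ^ 2 ≤ 2499 ^ 2 := Nat.pow_le_pow_left hg2499 2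
    have hg3' : 0 < g ^ 3 := by positivity
    have hg2' : 0 < g ^ 2 := by positivity
    have hmem : ∀ t ∈ [(4 * g ^ 3, 25, 25 * 2499 * g ^ 2), (2500 * g ^ 3, 1, 2499 * 625 * g ^ 2)],
        t ∈ descentTriples := fun t ht => List.mem_flatMap.mpr ⟨g, hg, ht⟩
    rcases hab with ⟨h1, h2⟩ | ⟨h1, h2⟩
    · refine ⟨_, _, _, hmem _ (List.mem_cons_self ..), by omega, by omega, by omega, by omega, by omega,
        by omega, ?_⟩
      exact descent_equation_left h h1 h2
    · refine ⟨_, _, _, hmem _ (List.mem_cons_of_mem _ (List.mem_cons_self ..)), by omega, by omega,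
        by omega, by omega, by omega, by omega, ?_⟩
      rw [one_mul]
      exact descent_equation_right h h1 h2
  rcases lt_or_ge ℓ 20000 with hlt | hge
  · exact sieveRange_spec 19989 11 sieveRange_eq_true hℓ (by omega) hℓ11 (by omega) (P, Q, C) hmem a b heq
  · exact mul_pow_ne_mul_pow_add hP hQ hPQ hPQ' hC hC' (by nlinarith) hge heq

theorem sieve_five : sieve 5 60 1 (descentTriples.filter fun t =>
    !(t == (4 * 147 ^ 3, 25, 25 * 2499 * 147 ^ 2))) = true := by decide +kernel

theorem sieve_seven : sieve 7 60 1 (descentTriples.filter fun t =>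
    !(t == (4 * 49 ^ 3, 25, 25 * 2499 * 49 ^ 2)) && !(t == (4 * 2499 ^ 3, 25, 25 * 2499 * 2499 ^ 2)) &&
    !(t == (2500 * 17 ^ 3, 1, 2499 * 625 * 17 ^ 2))) = true := by decide +kernel

theorem five_dvd_of_eq {w g b n : ℕ} (hg : Nat.Coprime 5 g) (h : 25 * w = g * b ^ n) : 5 ∣ b := by
  have : 5 ∣ g * b ^ n := by omega
  exact Nat.Prime.dvd_of_dvd_pow (by norm_num) ((Nat.Coprime.dvd_mul_left hg).mp this)

theorem no_solution_five {u w Y : ℕ} (h : 4 * w = u ^ 2 + 2499) : 25 * (u * w) ≠ Y ^ 5 := by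
  intro hY
  obtain ⟨g, hg, a, b, hab⟩ := descent h hY
  have hsieve := sieve_spec (by norm_num) 60 1 one_pos _ sieve_five
  rcases hab with ⟨h1, h2⟩ | ⟨h1, h2⟩
  · by_cases hg147 : g = 147
    · subst hg147
      obtain ⟨c, rfl⟩ := five_dvd_of_eq (by norm_num) h2
      rw [mul_pow] at h2
      have hu : u ^ 2 % 25 = 1 := by omega
      have hsq : a ^ 10 % 25 = 9 := by
        rw [show a ^ 10 = (a ^ 5) ^ 2 by ring, ← h1, mul_pow, Nat.mul_mod, hu]
        norm_num
      have hres : ∀ m < 25, m ^ 10 % 25 ≠ 9 := by decide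
      rw [Nat.pow_mod] at hsq
      exact hres _ (Nat.mod_lt _ (by norm_num)) hsq
    · refine hsieve (4 * g ^ 3, 25, 25 * 2499 * g ^ 2) ?_ a b (descent_equation_left h h1 h2)
      simp only [List.mem_cons, List.not_mem_nil, or_false] at hg
      rcases hg with rfl | rfl | rfl | rfl | rfl | rfl | rfl | rfl
      all_goals first | exact absurd rfl hg147 | decide
  · refine hsieve (2500 * g ^ 3, 1, 2499 * 625 * g ^ 2) ?_ a b
      ((descent_equation_right h h1 h2).trans (by rw [one_mul]))
    simp only [List.mem_cons, List.not_mem_nil, or_false] at hg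
    rcases hg with rfl | rfl | rfl | rfl | rfl | rfl | rfl | rfl <;> decide

theorem pow_seven_mod (n : ℕ) : n ^ 7 % 49 = 0 ∨ n ^ 7 % 49 = 1 ∨ n ^ 7 % 49 = 18 ∨ n ^ 7 % 49 = 19 ∨
    n ^ 7 % 49 = 30 ∨ n ^ 7 % 49 = 31 ∨ n ^ 7 % 49 = 48 := by
  have h : ∀ m < 49, m ^ 7 % 49 = 0 ∨ m ^ 7 % 49 = 1 ∨ m ^ 7 % 49 = 18 ∨ m ^ 7 % 49 = 19 ∨
    m ^ 7 % 49 = 30 ∨ m ^ 7 % 49 = 31 ∨ m ^ 7 % 49 = 48 := by decide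
  rw [Nat.pow_mod]
  exact h _ (Nat.mod_lt _ (by norm_num))

theorem sq_mod_seven (n : ℕ) : n ^ 2 % 7 = 0 ∨ n ^ 2 % 7 = 1 ∨ n ^ 2 % 7 = 2 ∨ n ^ 2 % 7 = 4 := by
  have h : ∀ m < 7, m ^ 2 % 7 = 0 ∨ m ^ 2 % 7 = 1 ∨ m ^ 2 % 7 = 2 ∨ m ^ 2 % 7 = 4 := by decide
  rw [Nat.pow_mod]
  exact h _ (Nat.mod_lt _ (by norm_num))

theorem no_solution_seven_aux {u w m a b : ℕ} (hm : m = 1 ∨ m = 51) (h : 4 * w = u ^ 2 + 2499)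
    (h1 : u * (49 * m) = a ^ 7) (h2 : 25 * w = 49 * m * b ^ 7) : False := by
  have h5 : 5 ∣ b := five_dvd_of_eq (by rcases hm with rfl | rfl <;> norm_num) h2
  have h7 : 7 ∣ a := by
    apply Nat.Prime.dvd_of_dvd_pow (n := 7) (by norm_num)
    exact ⟨7 * (u * m), by rw [← h1]; ring⟩
  obtain ⟨c, rfl⟩ := h5
  obtain ⟨d, rfl⟩ := h7
  rw [mul_pow] at h1 h2
  have hv : ∃ v, u = 7 ^ 5 * v := by
    rcases hm with rfl | rfl
    · exact ⟨d ^ 7, by omega⟩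
    · exact ⟨u / 7 ^ 5, by omega⟩
  obtain ⟨v, rfl⟩ := hv
  have h' : 4 * w = 282475249 * v ^ 2 + 2499 := by rw [h]; ring
  have hc := pow_seven_mod c
  generalize c ^ 7 = C at h2 hc
  generalize v ^ 2 = V at h'
  have hmod : 12500 * (m * C) % 49 = 2 := by
    have : 12500 * (m * C) = 5764801 * V + 51 := by linarith
    clear * - this
    omega
  clear * - hm hmod hc
  rcases hm with rfl | rfl <;> omega

theorem no_solution_seven {u w Y : ℕ} (h : 4 * w = u ^ 2 + 2499) : 25 * (u * w) ≠ Y ^ 7 := by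
  intro hY
  obtain ⟨g, hg, a, b, hab⟩ := descent h hY
  have hsieve := sieve_spec (by norm_num) 60 1 one_pos _ sieve_seven
  rcases hab with ⟨h1, h2⟩ | ⟨h1, h2⟩
  · by_cases hg49 : g = 49
    · subst hg49
      exact no_solution_seven_aux (Or.inl rfl) h h1 h2
    by_cases hg2499 : g = 2499
    · subst hg2499
      exact no_solution_seven_aux (Or.inr rfl) h h1 h2
    · refine hsieve (4 * g ^ 3, 25, 25 * 2499 * g ^ 2) ?_ a b (descent_equation_left h h1 h2)
      simp only [List.mem_cons, List.not_mem_nil, or_false] at hg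
      rcases hg with rfl | rfl | rfl | rfl | rfl | rfl | rfl | rfl
      all_goals first | exact absurd rfl hg49 | exact absurd rfl hg2499 | decide
  · by_cases hg17 : g = 17
    · subst hg17
      have h7 : ¬ 7 ∣ u := by
        rintro ⟨v, rfl⟩
        have hb : 7 ∣ b := by
          apply Nat.Prime.dvd_of_dvd_pow (n := 7) (by norm_num)
          have h' : 4 * w = 49 * v ^ 2 + 2499 := by rw [h]; ring
          omega
        obtain ⟨c, rfl⟩ := hb
        rw [mul_pow] at h2
        have h' : 4 * w = 49 * v ^ 2 + 2499 := by rw [h]; ring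
        have := sq_mod_seven v
        omega
      have hsq : (a ^ 7) ^ 2 = 180625 * u ^ 2 := by rw [← h1]; ring
      have ha7 : a ^ 7 % 49 ≠ 0 := by omega
      have hb := pow_seven_mod b
      have hmod : (a ^ 7 % 49) ^ 2 % 49 = 13 * (b ^ 7) % 49 := by
        rw [← Nat.pow_mod, hsq]
        omega
      clear * - hmod ha7 hb
      rcases pow_seven_mod a with h3 | h3 | h3 | h3 | h3 | h3 | h3 <;> rw [h3] at hmod <;> omega
    · refine hsieve (2500 * g ^ 3, 1, 2499 * 625 * g ^ 2) ?_ a b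
        ((descent_equation_right h h1 h2).trans (by rw [one_mul]))
      simp only [List.mem_cons, List.not_mem_nil, or_false] at hg
      rcases hg with rfl | rfl | rfl | rfl | rfl | rfl | rfl | rfl
      all_goals first | exact absurd rfl hg17 | decide

theorem one_add_pow_eq {R : Type*} [Ring R] (a : R) (n : ℕ) :
    ∃ S : R, (1 + a) ^ n = 1 + n * a + a ^ 2 * S := by
  induction n with
  | zero => exact ⟨0, by simp⟩
  | succ n ih =>
    obtain ⟨S, hS⟩ := ih
    refine ⟨S + S * a + n, ?_⟩
    rw [pow_succ, hS]
    have hcomm : (n : R) * a = a * n := (Nat.cast_commute n a)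
    push_cast
    linear_combination (norm := noncomm_ring) a * hcomm + hcomm * a

/-- First-order expansion of powers of an element which is `1` modulo `p ^ 2`. -/
theorem one_add_sq_mul_pow {R : Type*} [Ring R] (p : ℕ) (H : R) (k N : ℕ) :
    ∃ S : R, (1 + (p : R) ^ 2 * H) ^ (p ^ k * N) =
      1 + (p : R) ^ (k + 2) * (N * H) + (p : R) ^ (k + 3) * S := by
  have hc : ∀ (j : ℕ) (x : R), (p : R) ^ j * x = x * (p : R) ^ j := fun j x =>
    ((Nat.cast_commute p x).pow_left j)
  induction k with
  | zero =>
    obtain ⟨S, hS⟩ := one_add_pow_eq ((p : R) ^ 2 * H) N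
    refine ⟨p * (H * H * S), ?_⟩
    rw [pow_zero, one_mul, hS]
    have h1 : (N : R) * ((p : R) ^ 2 * H) = (p : R) ^ 2 * (N * H) := by
      rw [← mul_assoc, ← hc 2, mul_assoc]
    have h2 : ((p : R) ^ 2 * H) ^ 2 * S = (p : R) ^ 3 * (p * (H * H * S)) := by
      rw [sq ((p : R) ^ 2 * H), show (p : R) ^ 2 * H * ((p : R) ^ 2 * H) = (p : R) ^ 2 * (H * (p : R) ^ 2) * H by
        noncomm_ring, ← hc 2]
      noncomm_ring
    rw [h1, h2]
  | succ k ih =>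
    obtain ⟨S, hS⟩ := ih
    obtain ⟨S', hS'⟩ := one_add_pow_eq ((p : R) ^ (k + 2) * (N * H + p * S)) p
    set Z := (N : R) * H + p * S with hZ
    refine ⟨S + (p : R) ^ k * (Z * Z * S'), ?_⟩
    have h0 : (1 + (p : R) ^ 2 * H) ^ (p ^ k * N) = 1 + (p : R) ^ (k + 2) * Z := by
      rw [hS, hZ, mul_add, ← mul_assoc _ (p : R) S, ← pow_succ, ← add_assoc]
    have h2 : ((p : R) ^ (k + 2) * Z) ^ 2 = (p : R) ^ (k + 4) * ((p : R) ^ k * (Z * Z)) := by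
      rw [sq ((p : R) ^ (k + 2) * Z), mul_assoc, ← mul_assoc Z, ← hc (k + 2), ← mul_assoc, ← mul_assoc,
        ← mul_assoc, ← mul_assoc, ← pow_add, ← pow_add]
      congr 3
      omega
    have h1 : (p : R) * ((p : R) ^ (k + 2) * Z) = (p : R) ^ (k + 3) * (N * H) + (p : R) ^ (k + 4) * S := by
      rw [← mul_assoc, ← pow_succ', hZ, mul_add, ← mul_assoc _ (p : R) S, ← pow_succ]
    rw [show p ^ (k + 1) * N = p ^ k * N * p by ring, pow_mul, h0, hS', h1, h2]
    noncomm_ring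

section MatrixOrbit

variable {d m : ℕ}

/-- The least nonnegative residues of the entries of a vector. -/
def residues (m : ℕ) (v : Fin d → ℤ) : List ℕ := List.ofFn fun i => (v i % m).toNat

/-- Product of a matrix, given by its list of rows, with a vector modulo `m`. -/
def mulVecMod (m : ℕ) (rows : List (List ℕ)) (v : List ℕ) : List ℕ :=
  rows.map fun r => (List.zipWith (· * ·) r v).sum % m

/-- `forceList l f = f l`, but evaluation by the kernel reduces the entries of `l` to numerals first. -/
def forceList {α : Type} : List ℕ → (List ℕ → α) → α
  | [], f => f []
  | a :: l, f => force a fun a => forceList l fun l => f (a :: l)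

theorem forceList_eq {α : Type} (l : List ℕ) (f : List ℕ → α) : forceList l f = f l := by
  induction l generalizing f with
  | nil => rfl
  | cons a l ih => rw [forceList, force_eq, ih]

/-- The orbit of `v` under `rows` modulo `m` is at `v₀` after `n` steps, and all vectors before that
satisfy `good`. -/
def orbitCheck (m : ℕ) (rows : List (List ℕ)) (good : ℕ → List ℕ → Bool) (v₀ : List ℕ) :
    ℕ → ℕ → List ℕ → Bool
  | 0, _, v => v == v₀
  | n + 1, r, v => forceList v fun v => good r v && orbitCheck m rows good v₀ n (r + 1) (mulVecMod m rows v)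

theorem orbitCheck_spec {m : ℕ} {rows : List (List ℕ)} {good : ℕ → List ℕ → Bool} {v₀ : List ℕ} {n : ℕ} :
    ∀ {r : ℕ} {v : List ℕ}, orbitCheck m rows good v₀ n r v = true →
      (mulVecMod m rows)^[n] v = v₀ ∧ ∀ i < n, good (r + i) ((mulVecMod m rows)^[i] v) = true := by
  induction n with
  | zero =>
    intro r v h
    simpa [orbitCheck] using h
  | succ n ih =>
    intro r v h
    rw [orbitCheck, forceList_eq, Bool.and_eq_true] at h
    obtain ⟨h1, h2⟩ := ih h.2
    refine ⟨by rw [Function.iterate_succ_apply, h1], fun i hi => ?_⟩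
    cases i with
    | zero => exact h.1
    | succ i =>
      rw [Function.iterate_succ_apply, show r + (i + 1) = r + 1 + i by ring]
      exact h2 i (by omega)

theorem residues_mulVec [NeZero m] (M : Matrix (Fin d) (Fin d) ℤ) (v : Fin d → ℤ) :
    residues m (M *ᵥ v) = mulVecMod m (List.ofFn fun i => residues m (M i)) (residues m v) := by
  have hcast : ∀ x : ℤ, ((x % m).toNat : ℤ) = x % m := fun x =>
    Int.toNat_of_nonneg (Int.emod_nonneg _ (by exact_mod_cast NeZero.ne m))
  have hzip : ∀ a b : Fin d → ℕ, List.zipWith (· * ·) (List.ofFn a) (List.ofFn b) =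
      List.ofFn fun i => a i * b i := by
    intro a b
    apply List.ext_getElem <;> simp
  simp only [residues, mulVecMod, List.map_ofFn]
  congr 1
  ext i
  simp only [Function.comp_apply, hzip, List.sum_ofFn]
  zify
  rw [hcast]
  simp only [hcast, mulVec, dotProduct]
  rw [Finset.sum_int_mod, Finset.sum_int_mod (f := fun i_1 => M i i_1 % m * (v i_1 % m))]
  simp only [Int.mul_emod, Int.emod_emod]

theorem residues_pow_mulVec [NeZero m] (M : Matrix (Fin d) (Fin d) ℤ) (v : Fin d → ℤ) (n : ℕ) :
    residues m (M ^ n *ᵥ v) =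
      (mulVecMod m (List.ofFn fun i => residues m (M i)))^[n] (residues m v) := by
  induction n with
  | zero => simp
  | succ n ih => rw [pow_succ', ← mulVec_mulVec, residues_mulVec, ih, Function.iterate_succ_apply']

/-- The vectors `M ^ n v` are periodic modulo `m` with period `T`, and satisfy `good`. -/
def orbitGood (m T : ℕ) (good : ℕ → List ℕ → Bool) (M : Matrix (Fin d) (Fin d) ℤ) (v : Fin d → ℤ) :
    Bool :=
  orbitCheck m (List.ofFn fun i => residues m (M i)) good (residues m v) T 0 (residues m v)

theorem orbitGood_spec {T : ℕ} [NeZero m] {good : ℕ → List ℕ → Bool} {M : Matrix (Fin d) (Fin d) ℤ}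
    {v : Fin d → ℤ} (hT : 0 < T) (h : orbitGood m T good M v = true) (n : ℕ) :
    good (n % T) (residues m (M ^ n *ᵥ v)) = true := by
  obtain ⟨h1, h2⟩ := orbitCheck_spec h
  have h3 := h2 (n % T) (Nat.mod_lt _ hT)
  rw [zero_add, Function.IsPeriodicPt.iterate_mod_apply h1] at h3
  rw [residues_pow_mulVec]
  exact h3

/-- If `M ≡ 1` modulo `p ^ 2`, then `M ^ n v` is known to first order. -/
theorem pow_mulVec_expansion {M H : Matrix (Fin d) (Fin d) ℤ} {p : ℕ} (hp : p.Prime)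
    (hM : M = 1 + (p : ℤ) ^ 2 • H) {n : ℕ} (hn : n ≠ 0) (v : Fin d → ℤ) :
    ∃ (k : ℕ) (N : ℤ) (w : Fin d → ℤ), ¬ (p : ℤ) ∣ N ∧
      ∀ i, (M ^ n *ᵥ v) i = v i + p ^ (k + 2) * (N * (H *ᵥ v) i + p * w i) := by
  obtain ⟨k, N, hN, rfl⟩ := Nat.exists_eq_pow_mul_and_not_dvd hn p hp.ne_one
  obtain ⟨S, hS⟩ := one_add_sq_mul_pow p H k N
  refine ⟨k, N, S *ᵥ v, by exact_mod_cast hN, fun i => ?_⟩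
  have hcast : ∀ (a : ℕ) (A : Matrix (Fin d) (Fin d) ℤ), (a : Matrix (Fin d) (Fin d) ℤ) * A = (a : ℤ) • A := by
    intro a A
    rw [← nsmul_eq_mul, natCast_zsmul]
  have hM' : M = 1 + (p : Matrix (Fin d) (Fin d) ℤ) ^ 2 * H := by
    rw [hM, ← Nat.cast_pow, ← Nat.cast_pow, hcast]
  rw [hM', hS, ← Nat.cast_pow, ← Nat.cast_pow, hcast, hcast, hcast]
  simp only [add_mulVec, one_mulVec, smul_mulVec, Pi.add_apply, Pi.smul_apply, smul_eq_mul]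
  push_cast
  ring

end MatrixOrbit

/-- Norm form of the order `ℤ[∛20, ∛50]`. -/
def cubicNorm (v : Fin 3 → ℤ) : ℤ := v 0 ^ 3 + 20 * v 1 ^ 3 + 50 * v 2 ^ 3 - 30 * v 0 * v 1 * v 2

/-- Multiplication by the unit `1 + ∛20 - ∛50`. -/
def cubicUnit : Matrix (Fin 3) (Fin 3) ℤ := !![1, -10, 10; 1, 1, -5; -1, 2, 1]

/-- Multiplication by the unit `11 + 4 ∛20 + 3 ∛50`, the inverse of `1 + ∛20 - ∛50`. -/
def cubicUnitInv : Matrix (Fin 3) (Fin 3) ℤ := !![11, 30, 40; 4, 11, 15; 3, 8, 11]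

theorem cubicUnit_mul_inv : cubicUnit * cubicUnitInv = 1 := by decide +kernel

theorem cubicUnitInv_mul : cubicUnitInv * cubicUnit = 1 := by decide +kernel

theorem cubicUnit_mulVec (v : Fin 3 → ℤ) : cubicUnit *ᵥ v =
    ![v 0 - 10 * v 1 + 10 * v 2, v 0 + v 1 - 5 * v 2, -v 0 + 2 * v 1 + v 2] := by
  ext i
  fin_cases i <;> simp [cubicUnit, mulVec, dotProduct, Fin.sum_univ_three] <;> ring

theorem cubicUnitInv_mulVec (v : Fin 3 → ℤ) : cubicUnitInv *ᵥ v =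
    ![11 * v 0 + 30 * v 1 + 40 * v 2, 4 * v 0 + 11 * v 1 + 15 * v 2,
      3 * v 0 + 8 * v 1 + 11 * v 2] := by
  ext i
  fin_cases i <;> simp [cubicUnitInv, mulVec, dotProduct, Fin.sum_univ_three]

theorem cubicNorm_pow_unit (n : ℕ) (v : Fin 3 → ℤ) : cubicNorm (cubicUnit ^ n *ᵥ v) = cubicNorm v := by
  induction n with
  | zero => simp
  | succ n ih =>
    rw [pow_succ', ← mulVec_mulVec, cubicUnit_mulVec, ← ih]
    simp only [cubicNorm, Matrix.cons_val]
    ring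

theorem cubicNorm_pow_unitInv (n : ℕ) (v : Fin 3 → ℤ) :
    cubicNorm (cubicUnitInv ^ n *ᵥ v) = cubicNorm v := by
  induction n with
  | zero => simp
  | succ n ih =>
    rw [pow_succ', ← mulVec_mulVec, cubicUnitInv_mulVec, ← ih]
    simp only [cubicNorm, Matrix.cons_val]
    ring

/-- The real embedding of `ℤ[∛20, ∛50]`, with `θ` the cube root of `20`. -/
noncomputable def cubicEmb (θ : ℝ) (v : Fin 3 → ℤ) : ℝ := v 0 + v 1 * θ + v 2 * (θ ^ 2 / 2)

theorem cubicEmb_unit {θ : ℝ} (hθ : θ ^ 3 = 20) (n : ℕ) (v : Fin 3 → ℤ) :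
    cubicEmb θ (cubicUnit ^ n *ᵥ v) * (11 + 4 * θ + 3 * (θ ^ 2 / 2)) ^ n = cubicEmb θ v := by
  induction n with
  | zero => simp
  | succ n ih =>
    rw [pow_succ', ← mulVec_mulVec, cubicUnit_mulVec, ← ih, pow_succ', ← mul_assoc]
    congr 1
    simp only [cubicEmb, Matrix.cons_val]
    push_cast
    generalize ((cubicUnit ^ n *ᵥ v) 0 : ℝ) = a
    generalize ((cubicUnit ^ n *ᵥ v) 1 : ℝ) = b
    generalize ((cubicUnit ^ n *ᵥ v) 2 : ℝ) = c
    linear_combination (-a / 2 + 11 / 2 * b - 11 / 2 * c + θ * (3 / 4) * (-a + 2 * b + c)) * hθ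

theorem cubicEmb_unitInv {θ : ℝ} (hθ : θ ^ 3 = 20) (n : ℕ) (v : Fin 3 → ℤ) :
    cubicEmb θ (cubicUnitInv ^ n *ᵥ v) = cubicEmb θ v * (11 + 4 * θ + 3 * (θ ^ 2 / 2)) ^ n := by
  induction n with
  | zero => simp
  | succ n ih =>
    rw [pow_succ', ← mulVec_mulVec, cubicUnitInv_mulVec, pow_succ, ← mul_assoc, ← ih]
    simp only [cubicEmb, Matrix.cons_val]
    push_cast
    generalize ((cubicUnitInv ^ n *ᵥ v) 0 : ℝ) = a
    generalize ((cubicUnitInv ^ n *ᵥ v) 1 : ℝ) = b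
    generalize ((cubicUnitInv ^ n *ᵥ v) 2 : ℝ) = c
    linear_combination (-3 / 2 * b - 2 * c - θ * (3 / 4) * c) * hθ

theorem cubicNorm_eq_emb_mul {θ : ℝ} (hθ : θ ^ 3 = 20) (v : Fin 3 → ℤ) :
    2 * (cubicNorm v : ℝ) = cubicEmb θ v * ((v 0 - v 1 * θ) ^ 2 + (v 1 * θ - v 2 * (θ ^ 2 / 2)) ^ 2 +
      (v 2 * (θ ^ 2 / 2) - v 0) ^ 2) := by
  simp only [cubicNorm, cubicEmb]
  push_cast
  generalize (v 0 : ℝ) = a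
  generalize (v 1 : ℝ) = b
  generalize (v 2 : ℝ) = c
  linear_combination (-2 * b ^ 3 - c ^ 3 / 4 * (θ ^ 3 + 20) + 3 * a * b * c) * hθ

theorem abs_le_of_mul_sq_le {x r ρ s N : ℝ} (hρ : 0 < ρ) (hr : ρ ≤ r) (hs : 0 ≤ s) (hN : N ≤ ρ * s ^ 2)
    (h : r * (3 * x - r) ^ 2 ≤ 4 * N) : |3 * x| ≤ r + 2 * s := by
  have h1 : ρ * (3 * x - r) ^ 2 ≤ ρ * (2 * s) ^ 2 := by
    nlinarith [sq_nonneg (3 * x - r), mul_le_mul_of_nonneg_right hr (sq_nonneg (3 * x - r))]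
  have h5 := abs_le_of_sq_le_sq (le_of_mul_le_mul_left h1 hρ) (by positivity)
  have h3 := abs_sub_abs_le_abs_sub (3 * x) r
  have h4 : |r| = r := abs_of_pos (hρ.trans_le hr)
  linarith

theorem cubic_bounds_of_emb {N D : ℤ} {ρ s θ : ℝ} (hθ : θ ^ 3 = 20) (hθl : 2.714 ≤ θ) (hρ : 0 < ρ) (hs : 0 ≤ s)
    (hN : N ≤ ρ * s ^ 2) (hD : 33 * ρ + 2 * s ≤ D) {v : Fin 3 → ℤ} (hv : cubicNorm v = N)
    (hrl : ρ ≤ cubicEmb θ v) (hru : cubicEmb θ v ≤ 33 * ρ) :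
    3 * |v 0| ≤ D ∧ 8 * |v 1| ≤ D ∧ 11 * |v 2| ≤ D := by
  have hθ0 : 0 ≤ θ := by linarith
  set φ := θ ^ 2 / 2 with hφ
  have hφl : 3.682 ≤ φ := by rw [hφ]; nlinarith
  have hnorm := cubicNorm_eq_emb_mul hθ v
  rw [hv] at hnorm
  set r := cubicEmb θ v with hrdef
  have hrpos : 0 < r := hρ.trans_le hrl
  have hsum : r = v 0 + v 1 * θ + v 2 * φ := rfl
  rw [← hφ] at hnorm
  have hx : |3 * (v 0 : ℝ)| ≤ r + 2 * s := by
    refine abs_le_of_mul_sq_le hρ hrl hs hN ?_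
    rw [show 3 * (v 0 : ℝ) - r = (v 0 - v 1 * θ) - (v 2 * φ - v 0) by rw [hsum]; ring]
    nlinarith [mul_nonneg hrpos.le (sq_nonneg ((v 0 - v 1 * θ) + (v 2 * φ - v 0)))]
  have hy : |3 * (v 1 * θ : ℝ)| ≤ r + 2 * s := by
    refine abs_le_of_mul_sq_le hρ hrl hs hN ?_
    rw [show 3 * (v 1 * θ : ℝ) - r = (v 1 * θ - v 2 * φ) - (v 0 - v 1 * θ) by rw [hsum]; ring]
    nlinarith [mul_nonneg hrpos.le (sq_nonneg ((v 1 * θ - v 2 * φ) + (v 0 - v 1 * θ)))]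
  have hz : |3 * (v 2 * φ : ℝ)| ≤ r + 2 * s := by
    refine abs_le_of_mul_sq_le hρ hrl hs hN ?_
    rw [show 3 * (v 2 * φ : ℝ) - r = (v 2 * φ - v 0) - (v 1 * θ - v 2 * φ) by rw [hsum]; ring]
    nlinarith [mul_nonneg hrpos.le (sq_nonneg ((v 2 * φ - v 0) + (v 1 * θ - v 2 * φ)))]
  rw [abs_mul, abs_of_pos (by norm_num : (0 : ℝ) < 3)] at hx hy hz
  rw [abs_mul, abs_of_nonneg hθ0] at hy
  rw [abs_mul, abs_of_nonneg (by linarith : 0 ≤ φ)] at hz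
  have hx' : 3 * |(v 0 : ℝ)| ≤ D := by linarith
  have hy' : 8 * |(v 1 : ℝ)| ≤ D := by
    have := mul_le_mul_of_nonneg_left hθl (abs_nonneg (v 1 : ℝ))
    linarith [abs_nonneg (v 1 : ℝ)]
  have hz' : 11 * |(v 2 : ℝ)| ≤ D := by
    have := mul_le_mul_of_nonneg_left hφl (abs_nonneg (v 2 : ℝ))
    linarith [abs_nonneg (v 2 : ℝ)]
  rw [← Int.cast_abs] at hx' hy' hz'
  exact ⟨by exact_mod_cast hx', by exact_mod_cast hy', by exact_mod_cast hz'⟩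

/-- Every element of positive norm `N` is a unit multiple of one in an explicit box. -/
theorem exists_cubic_reduced {N D : ℤ} {ρ s : ℝ} (hN0 : 0 < N) (hρ : 0 < ρ) (hs : 0 ≤ s)
    (hN : N ≤ ρ * s ^ 2) (hD : 33 * ρ + 2 * s ≤ D) {v : Fin 3 → ℤ} (hv : cubicNorm v = N) :
    ∃ (n : ℕ) (v' : Fin 3 → ℤ), (v = cubicUnit ^ n *ᵥ v' ∨ v = cubicUnitInv ^ n *ᵥ v') ∧
      cubicNorm v' = N ∧ 3 * |v' 0| ≤ D ∧ 8 * |v' 1| ≤ D ∧ 11 * |v' 2| ≤ D := by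
  obtain ⟨θ, hθ0, hθ⟩ : ∃ θ : ℝ, 0 ≤ θ ∧ θ ^ 3 = 20 :=
    ⟨(20 : ℝ) ^ ((3 : ℕ) : ℝ)⁻¹, by positivity, Real.rpow_inv_natCast_pow (by norm_num) (by norm_num)⟩
  have hθl : 2.714 ≤ θ := by
    by_contra! hlt
    nlinarith [pow_lt_pow_left₀ hlt hθ0 (n := 3) (by norm_num)]
  have hθu : θ ≤ 2.7145 := by
    by_contra! hlt
    nlinarith [pow_lt_pow_left₀ hlt (by norm_num) (n := 3) (by norm_num)]
  set φ := θ ^ 2 / 2 with hφ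
  have hφl : 3.682 ≤ φ := by rw [hφ]; nlinarith
  have hφu : φ ≤ 3.6844 := by rw [hφ]; nlinarith
  set κ := 11 + 4 * θ + 3 * φ with hκ
  have hpos : ∀ w : Fin 3 → ℤ, cubicNorm w = N → 0 < cubicEmb θ w := by
    intro w hw
    have h1 := cubicNorm_eq_emb_mul hθ w
    rw [hw] at h1
    by_contra! hle
    have h2 : (0 : ℝ) < N := by exact_mod_cast hN0
    nlinarith [mul_nonneg (neg_nonneg.mpr hle) (add_nonneg (add_nonneg (sq_nonneg ((w 0 : ℝ) - w 1 * θ))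
      (sq_nonneg ((w 1 : ℝ) * θ - w 2 * (θ ^ 2 / 2)))) (sq_nonneg ((w 2 : ℝ) * (θ ^ 2 / 2) - w 0)))]
  obtain ⟨z, hz1, hz2⟩ := exists_mem_Ico_zpow (div_pos (hpos v hv) hρ)
    (show 1 < κ by rw [hκ]; linarith)
  have hκpos : 0 < κ := by rw [hκ]; linarith
  have hmain : ∃ (n : ℕ) (v' : Fin 3 → ℤ), (v = cubicUnit ^ n *ᵥ v' ∨ v = cubicUnitInv ^ n *ᵥ v') ∧
      cubicNorm v' = N ∧ cubicEmb θ v' / ρ = cubicEmb θ v / ρ / κ ^ z := by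
    obtain ⟨n, rfl | rfl⟩ := z.eq_nat_or_neg
    · refine ⟨n, cubicUnit ^ n *ᵥ v, Or.inr ?_, by rw [cubicNorm_pow_unit, hv], ?_⟩
      · rw [mulVec_mulVec, ← (show Commute cubicUnitInv cubicUnit from
          cubicUnitInv_mul.trans cubicUnit_mul_inv.symm).mul_pow, cubicUnitInv_mul, one_pow, one_mulVec]
      · rw [← cubicEmb_unit hθ n v, zpow_natCast, ← hφ, ← hκ]
        field_simp
    · refine ⟨n, cubicUnitInv ^ n *ᵥ v, Or.inl ?_, by rw [cubicNorm_pow_unitInv, hv], ?_⟩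
      · rw [mulVec_mulVec, ← (show Commute cubicUnit cubicUnitInv from
          cubicUnit_mul_inv.trans cubicUnitInv_mul.symm).mul_pow, cubicUnit_mul_inv, one_pow, one_mulVec]
      · rw [cubicEmb_unitInv hθ n v, _root_.zpow_neg, zpow_natCast, ← hφ, ← hκ]
        field_simp
  obtain ⟨n, v', hvv', hv', hr⟩ := hmain
  have hκz : 0 < κ ^ z := zpow_pos hκpos z
  rw [zpow_add_one₀ hκpos.ne'] at hz2
  have hrl : ρ ≤ cubicEmb θ v' := by
    rw [← one_le_div hρ, hr, one_le_div hκz]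
    exact hz1
  have hru : cubicEmb θ v' ≤ 33 * ρ := by
    rw [← div_le_iff₀ hρ, hr, div_le_iff₀ hκz]
    refine hz2.le.trans ?_
    rw [mul_comm]
    refine mul_le_mul_of_nonneg_right ?_ hκz.le
    rw [hκ]
    linarith
  exact ⟨n, v', hvv', hv', cubic_bounds_of_emb hθ hθl hρ hs hN hD hv' hrl hru⟩

/-- Search for the vectors of norm `N` in the box `3 |x| ≤ D`, `8 |y| ≤ D`, `11 |z| ≤ D`, outside a list. -/
def cubicSearch (N D : ℕ) (l : List (ℤ × ℤ × ℤ)) : Bool :=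
  (List.range (2 * (D / 3) + 1)).all fun i =>
    let x : ℤ := i - (D / 3 : ℕ)
    (x * x * x - N) % 10 != 0 || (List.range (2 * (D / 8) + 1)).all fun j =>
      let y : ℤ := j - (D / 8 : ℕ)
      (List.range (2 * (D / 11) + 1)).all fun k =>
        let z : ℤ := k - (D / 11 : ℕ)
        x * x * x + 20 * (y * y * y) + 50 * (z * z * z) - 30 * (x * y * z) != N || l.contains (x, y, z)

theorem mem_range_of_mul_abs_le {D c : ℕ} {x : ℤ} (h : (c : ℤ) * |x| ≤ D) (hc : 0 < c) :
    ∃ i ∈ List.range (2 * (D / c) + 1), (i : ℤ) - (D / c : ℕ) = x := by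
  have h1 : |x| ≤ (D / c : ℕ) := by
    push_cast
    rw [Int.le_ediv_iff_mul_le (by exact_mod_cast hc)]
    linarith
  rw [abs_le] at h1
  refine ⟨(x + (D / c : ℕ)).toNat, ?_, ?_⟩
  · rw [List.mem_range]
    omega
  · omega

theorem cubicSearch_spec {N D : ℕ} {l : List (ℤ × ℤ × ℤ)} (h : cubicSearch N D l = true)
    {v : Fin 3 → ℤ} (hv : cubicNorm v = N) (h0 : 3 * |v 0| ≤ D) (h1 : 8 * |v 1| ≤ D)
    (h2 : 11 * |v 2| ≤ D) : (v 0, v 1, v 2) ∈ l := by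
  obtain ⟨i, hi, hx⟩ := mem_range_of_mul_abs_le (c := 3) (by exact_mod_cast h0) (by norm_num)
  obtain ⟨j, hj, hy⟩ := mem_range_of_mul_abs_le (c := 8) (by exact_mod_cast h1) (by norm_num)
  obtain ⟨k, hk, hz⟩ := mem_range_of_mul_abs_le (c := 11) (by exact_mod_cast h2) (by norm_num)
  rw [cubicSearch, List.all_eq_true] at h
  have hi := h i hi
  simp only [hx, Bool.or_eq_true, bne_iff_ne, ne_eq] at hi
  have hn : v 0 * v 0 * v 0 + 20 * (v 1 * v 1 * v 1) + 50 * (v 2 * v 2 * v 2) -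
      30 * (v 0 * v 1 * v 2) = N := by
    rw [← hv, cubicNorm]
    ring
  rcases hi with hi | hi
  · exact absurd (by omega) hi
  · have hj := List.all_eq_true.mp hi j hj
    simp only [hy] at hj
    have hk := List.all_eq_true.mp hj k hk
    simp only [hz, hn, bne_self_eq_false, Bool.false_or] at hk
    simpa using hk

theorem cubicSearch_2499 : cubicSearch 2499 131 [(-1, 5, 0), (19, -3, -2), (39, 13, 11)] = true := by
  decide +kernel

theorem cubicSearch_4998 : cubicSearch 4998 165 [(-18, 14, -5), (-8, 4, 3), (22, 7, 3)] = true := by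
  decide +kernel

theorem cubicSearch_294 :
    cubicSearch 294 64 [(-16, 2, 3), (-6, 4, -1), (4, 3, 1), (14, 5, 3)] = true := by
  decide +kernel

theorem cubicSearch_6 : cubicSearch 6 18 [] = true := by decide +kernel

theorem cubicSearch_1666 : cubicSearch 1666 115 [(-4, 1, 3), (16, 3, 3), (16, 4, -7)] = true := by
  decide +kernel

/-- The entry `i` is nonzero or the entry `j` is not `-k` times a square modulo `m`. -/
def avoidsNegSquare (m i j k : ℕ) (v : List ℕ) : Bool :=
  v.getD i 0 != 0 || (List.range m).all fun a => (v.getD j 0 + k * (a * a)) % m != 0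

theorem avoidsNegSquare_residues {m k d : ℕ} [NeZero m] {v : Fin d → ℤ} {i j : Fin d} (a : ℤ)
    (hi : v i = 0) (hj : v j = -(k * a ^ 2)) : avoidsNegSquare m i j k (residues m v) = false := by
  have hm : (m : ℤ) ≠ 0 := by exact_mod_cast NeZero.ne m
  have hget : ∀ i : Fin d, (residues m v).getD i 0 = (v i % m).toNat := by
    intro i
    simp [residues, List.getD_eq_getElem?_getD]
  rw [avoidsNegSquare, hget, hget, hi, Bool.or_eq_false_iff]
  refine ⟨by simp, ?_⟩
  rw [Bool.eq_false_iff, ne_eq, List.all_eq_true]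
  intro h
  have h1 := h (a % m).toNat (by
    rw [List.mem_range]
    have := Int.emod_lt_of_pos a (by positivity : (0 : ℤ) < m)
    have := Int.emod_nonneg a hm
    omega)
  rw [bne_iff_ne] at h1
  apply h1
  rw [← Nat.dvd_iff_mod_eq_zero, ← Int.natCast_dvd_natCast]
  push_cast
  rw [Int.toNat_of_nonneg (Int.emod_nonneg _ hm), Int.toNat_of_nonneg (Int.emod_nonneg _ hm), hj,
    ← Int.modEq_zero_iff_dvd]
  calc -(k * a ^ 2) % m + k * (a % m * (a % m)) ≡ -(k * a ^ 2) + k * (a * a) [ZMOD m] := by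
        gcongr <;> exact Int.mod_modEq _ _
    _ = 0 := by ring

/-- No multiple of a vector by a power of the unit has the form `(x, 0, -k a ^ 2)`. -/
def cubicOrbitAvoids (k : ℕ) (t : ℤ × ℤ × ℤ) : Bool :=
  [cubicUnit, cubicUnitInv].all fun M =>
    orbitGood 25 25 (fun _ => avoidsNegSquare 25 1 2 k) M ![t.1, t.2.1, t.2.2] ||
    orbitGood 7 6 (fun _ => avoidsNegSquare 7 1 2 k) M ![t.1, t.2.1, t.2.2]

theorem cubicNorm_ne {N D k : ℕ} {ρ s : ℝ} {l : List (ℤ × ℤ × ℤ)} (hN0 : 0 < N) (hρ : 0 < ρ)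
    (hs : 0 ≤ s) (hN : N ≤ ρ * s ^ 2) (hD : 33 * ρ + 2 * s ≤ D) (hsearch : cubicSearch N D l = true)
    (havoid : l.all (cubicOrbitAvoids k) = true) (x a : ℤ) : cubicNorm ![x, 0, -(k * a ^ 2)] ≠ N := by
  intro h
  obtain ⟨n, v, hv, hvN, h0, h1, h2⟩ := exists_cubic_reduced (N := N) (D := D) (by exact_mod_cast hN0) hρ hs
    (by exact_mod_cast hN) (by exact_mod_cast hD) h
  have hgood := List.all_eq_true.mp havoid _ (cubicSearch_spec hsearch hvN h0 h1 h2)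
  rw [cubicOrbitAvoids, List.all_eq_true] at hgood
  obtain ⟨M, hM, hMv⟩ : ∃ M ∈ [cubicUnit, cubicUnitInv], ![x, 0, -(k * a ^ 2)] = M ^ n *ᵥ v := by
    rcases hv with hv | hv
    exacts [⟨_, by simp, hv⟩, ⟨_, by simp, hv⟩]
  have hgM := hgood M hM
  have hvv : ![v 0, v 1, v 2] = v := by
    ext i
    fin_cases i <;> rfl
  simp only [hvv, Bool.or_eq_true] at hgM
  rcases hgM with hgM | hgM
  · have := orbitGood_spec (by norm_num) hgM n
    rw [← hMv] at this
    have h3 := avoidsNegSquare_residues (m := 25) (k := k) (v := ![x, 0, -(k * a ^ 2)]) (i := 1) (j := 2) a rfl rfl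
    rw [Fin.val_one, Fin.val_two] at h3
    rw [h3] at this
    exact absurd this (by simp)
  · have := orbitGood_spec (by norm_num) hgM n
    rw [← hMv] at this
    have h3 := avoidsNegSquare_residues (m := 7) (k := k) (v := ![x, 0, -(k * a ^ 2)]) (i := 1) (j := 2) a rfl rfl
    rw [Fin.val_one, Fin.val_two] at h3
    rw [h3] at this
    exact absurd this (by simp)

theorem cubicNorm_ne_4998 (x a : ℤ) : cubicNorm ![x, 0, -a ^ 2] ≠ 4998 := by
  have := cubicNorm_ne (N := 4998) (D := 165) (k := 1) (ρ := 5 / 3) (s := 55) (by norm_num) (by norm_num)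
    (by norm_num) (by norm_num) (by norm_num) cubicSearch_4998 (by decide +kernel) x a
  simpa using this

theorem cubicNorm_ne_294 (x a : ℤ) : cubicNorm ![x, 0, -(17 * a ^ 2)] ≠ 294 :=
  cubicNorm_ne (N := 294) (D := 64) (k := 17) (ρ := 2 / 3) (s := 21) (by norm_num) (by norm_num)
    (by norm_num) (by norm_num) (by norm_num) cubicSearch_294 (by decide +kernel) x a

theorem cubicNorm_ne_6 (x a : ℤ) : cubicNorm ![x, 0, -(17 * a ^ 2)] ≠ 6 :=
  cubicNorm_ne (N := 6) (D := 18) (k := 17) (ρ := 1 / 6) (s := 6) (by norm_num) (by norm_num)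
    (by norm_num) (by norm_num) (by norm_num) cubicSearch_6 (by decide +kernel) x a

theorem cubicNorm_ne_1666 (x a : ℤ) : cubicNorm ![x, 0, -(3 * a ^ 2)] ≠ 1666 :=
  cubicNorm_ne (N := 1666) (D := 115) (k := 3) (ρ := 7 / 6) (s := 38) (by norm_num) (by norm_num)
    (by norm_num) (by norm_num) (by norm_num) cubicSearch_1666 (by decide +kernel) x a

/-- The matrix `(M - 1) / m`. -/
def subOneDiv {d : ℕ} (m : ℤ) (M : Matrix (Fin d) (Fin d) ℤ) : Matrix (Fin d) (Fin d) ℤ :=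
  (M - 1).map (· / m)

theorem cubicUnit_pow_25 : ∀ M ∈ [cubicUnit, cubicUnitInv], M ^ 25 = 1 + (5 : ℤ) ^ 2 • subOneDiv 25 (M ^ 25) ∧
    ¬ (5 : ℤ) ∣ (subOneDiv 25 (M ^ 25) *ᵥ ![-1, 5, 0]) 2 := by
  decide +kernel

theorem cubicSearch_orbits_2499 : ∀ M ∈ [cubicUnit, cubicUnitInv],
    orbitGood 25 25 (fun r v => r == 0 || avoidsNegSquare 25 2 0 1 v) M ![-1, 5, 0] ∧
    orbitGood 25 25 (fun _ => avoidsNegSquare 25 2 0 1) M ![19, -3, -2] ∧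
    orbitGood 25 25 (fun _ => avoidsNegSquare 25 2 0 1) M ![39, 13, 11] := by
  decide +kernel

theorem sq_eq_one_of_cubicNorm {a b : ℤ} (h : cubicNorm ![-a ^ 2, b, 0] = 2499) : a ^ 2 = 1 := by
  obtain ⟨n, v, hv, hvN, h0, h1, h2⟩ := exists_cubic_reduced (N := 2499) (D := 131) (ρ := 4 / 3)
    (s := 43.4) (by norm_num) (by norm_num) (by norm_num) (by norm_num) (by norm_num) h
  obtain ⟨M, hM, hMv⟩ : ∃ M ∈ [cubicUnit, cubicUnitInv], ![-a ^ 2, b, 0] = M ^ n *ᵥ v := by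
    rcases hv with hv | hv
    exacts [⟨_, by simp, hv⟩, ⟨_, by simp, hv⟩]
  have hmem := cubicSearch_spec cubicSearch_2499 hvN h0 h1 h2
  obtain ⟨hgood1, hgood2, hgood3⟩ := cubicSearch_orbits_2499 M hM
  have hbad := avoidsNegSquare_residues (m := 25) (k := 1) (v := ![-a ^ 2, b, 0]) (i := 2) (j := 0) a rfl
    (by simp)
  rw [Fin.val_zero, Fin.val_two, hMv] at hbad
  have hvv : ![v 0, v 1, v 2] = v := by
    ext i
    fin_cases i <;> rfl
  simp only [List.mem_cons, List.not_mem_nil, or_false, Prod.mk.injEq] at hmem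
  rcases hmem with ⟨e0, e1, e2⟩ | ⟨e0, e1, e2⟩ | ⟨e0, e1, e2⟩ <;> rw [e0, e1, e2] at hvv <;> subst hvv
  · have hn := orbitGood_spec (by norm_num) hgood1 n
    rw [hbad, Bool.or_false, beq_iff_eq] at hn
    obtain ⟨q, rfl⟩ := Nat.dvd_of_mod_eq_zero hn
    obtain ⟨hpow, hne⟩ := cubicUnit_pow_25 M hM
    rcases eq_or_ne q 0 with rfl | hq
    · have := congrFun hMv 0
      simpa using this
    · obtain ⟨k, N, w, hN, hw⟩ := pow_mulVec_expansion (p := 5) (by norm_num) hpow hq ![-1, 5, 0]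
      have hw2 := hw 2
      rw [← pow_mul, ← hMv] at hw2
      have hz : (0 : ℤ) = 0 + ((5 : ℕ) : ℤ) ^ (k + 2) *
        (N * (subOneDiv 25 (M ^ 25) *ᵥ ![-1, 5, 0]) 2 + (5 : ℕ) * w 2) := hw2
      rw [zero_add, zero_eq_mul, or_iff_right (by positivity)] at hz
      have hdvd : (5 : ℤ) ∣ N * (subOneDiv 25 (M ^ 25) *ᵥ ![-1, 5, 0]) 2 :=
        ⟨-w 2, by push_cast at hz; linarith⟩
      rcases (Int.prime_iff_natAbs_prime.mpr (by norm_num : Nat.Prime (5 : ℤ).natAbs)).dvd_or_dvd hdvd with h5 | h5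
      · exact absurd (by exact_mod_cast h5) hN
      · exact absurd h5 hne
  · have hn := orbitGood_spec (by norm_num) hgood2 n
    rw [hbad] at hn
    exact absurd hn (by simp)
  · have hn := orbitGood_spec (by norm_num) hgood3 n
    rw [hbad] at hn
    exact absurd hn (by simp)

theorem sieve_three : sieve 3 60 1 [(4 * 3 ^ 3, 25, 25 * 2499 * 3 ^ 2), (4 * 17 ^ 3, 25, 25 * 2499 * 17 ^ 2),
    (2500 * 51 ^ 3, 1, 2499 * 625 * 51 ^ 2), (4 * 147 ^ 3, 25, 25 * 2499 * 147 ^ 2),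
    (4 * 833 ^ 3, 25, 25 * 2499 * 833 ^ 2), (2500 * 2499 ^ 3, 1, 2499 * 625 * 2499 ^ 2)] = true := by
  decide +kernel

theorem cube_mod_seven (n : ℕ) : n ^ 3 % 7 = 0 ∨ n ^ 3 % 7 = 1 ∨ n ^ 3 % 7 = 6 := by
  have h : ∀ m < 7, m ^ 3 % 7 = 0 ∨ m ^ 3 % 7 = 1 ∨ m ^ 3 % 7 = 6 := by decide
  rw [Nat.pow_mod]
  exact h _ (Nat.mod_lt _ (by norm_num))

theorem cube_mod_twentySeven (n : ℕ) : n ^ 3 % 27 = 0 ∨ n ^ 3 % 27 = 1 ∨ n ^ 3 % 27 = 8 ∨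
    n ^ 3 % 27 = 10 ∨ n ^ 3 % 27 = 17 ∨ n ^ 3 % 27 = 19 ∨ n ^ 3 % 27 = 26 := by
  have h : ∀ m < 27, m ^ 3 % 27 = 0 ∨ m ^ 3 % 27 = 1 ∨ m ^ 3 % 27 = 8 ∨
    m ^ 3 % 27 = 10 ∨ m ^ 3 % 27 = 17 ∨ m ^ 3 % 27 = 19 ∨ m ^ 3 % 27 = 26 := by decide
  rw [Nat.pow_mod]
  exact h _ (Nat.mod_lt _ (by norm_num))

theorem nine_dvd_of_cube {u a c : ℕ} (hc : ¬ 3 ∣ c) (h : u * (3 * c) = a ^ 3) : 9 ∣ u := by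
  have h3 : 3 ∣ a := Nat.Prime.dvd_of_dvd_pow (n := 3) (by norm_num) ⟨u * c, by rw [← h]; ring⟩
  obtain ⟨d, rfl⟩ := h3
  have h9 : u * c = 9 * d ^ 3 := by linarith
  have hco : Nat.Coprime 9 c := Nat.Coprime.pow_left 2 ((Nat.Prime.coprime_iff_not_dvd (by norm_num)).mpr hc)
  exact hco.dvd_of_dvd_mul_right ⟨_, h9⟩

theorem no_solution_three_left {u w a b g : ℕ} (hu : 1 < u) (h : 4 * w = u ^ 2 + 2499)
    (hg : g ∈ [1, 3, 17, 51, 49, 147, 833, 2499]) (h1 : u * g = a ^ 3) (h2 : 25 * w = g * b ^ 3) :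
    False := by
  have hsieve := sieve_spec (by norm_num) 60 1 one_pos _ sieve_three (4 * g ^ 3, 25, 25 * 2499 * g ^ 2)
  have heq := descent_equation_left h h1 h2
  simp only [List.mem_cons, List.not_mem_nil, or_false] at hg
  rcases hg with rfl | rfl | rfl | rfl | rfl | rfl | rfl | rfl
  · obtain ⟨c, rfl⟩ := five_dvd_of_eq (by norm_num) h2
    have hnorm : cubicNorm ![-(a : ℤ) ^ 2, c, 0] = 2499 := by
      simp only [cubicNorm, Matrix.cons_val]
      zify at heq
      linarith
    have := sq_eq_one_of_cubicNorm hnorm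
    have ha : a = 1 := by
      have h3 : a ^ 2 = 1 ^ 2 := by exact_mod_cast this
      exact Nat.pow_left_injective two_ne_zero h3
    subst ha
    omega
  · exact hsieve (by simp) a b heq
  · exact hsieve (by simp) a b heq
  · obtain ⟨v, rfl⟩ := nine_dvd_of_cube (c := 17) (by norm_num) h1
    have h' : 4 * w = 81 * v ^ 2 + 2499 := by rw [h]; ring
    have := cube_mod_twentySeven b
    clear * - h' h2 this
    omega
  · have h7 : 7 ∣ a := Nat.Prime.dvd_of_dvd_pow (n := 3) (by norm_num) ⟨7 * u, by rw [← h1]; ring⟩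
    obtain ⟨d, rfl⟩ := h7
    obtain rfl : u = 7 * d ^ 3 := by linarith
    have h' : 4 * w = 49 * (d ^ 2) ^ 3 + 2499 := by rw [h]; ring
    have hb := cube_mod_seven b
    have hd : (d ^ 2) ^ 3 % 7 = 0 ∨ (d ^ 2) ^ 3 % 7 = 1 := by
      rw [show (d ^ 2) ^ 3 = (d ^ 3) ^ 2 by ring, Nat.pow_mod]
      rcases cube_mod_seven d with h3 | h3 | h3 <;> rw [h3] <;> simp
    clear * - h' h2 hb hd
    omega
  · exact hsieve (by simp) a b heq
  · exact hsieve (by simp) a b heq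
  · obtain ⟨v, rfl⟩ := nine_dvd_of_cube (c := 833) (by norm_num) h1
    have h' : 4 * w = 81 * v ^ 2 + 2499 := by rw [h]; ring
    have := cube_mod_twentySeven b
    clear * - h' h2 this
    omega

theorem no_solution_three_right {u w a b g : ℕ} (h : 4 * w = u ^ 2 + 2499)
    (hg : g ∈ [1, 3, 17, 51, 49, 147, 833, 2499]) (h1 : 25 * (u * g) = a ^ 3) (h2 : w = g * b ^ 3) :
    False := by
  have hsieve := sieve_spec (by norm_num) 60 1 one_pos _ sieve_three (2500 * g ^ 3, 1, 2499 * 625 * g ^ 2)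
  have heq := descent_equation_right h h1 h2
  have heq' : 2500 * g ^ 3 * b ^ 3 = 1 * (a ^ 2) ^ 3 + 2499 * 625 * g ^ 2 := by rw [heq, one_mul]
  have hdvd : ∀ p : ℕ, p.Prime → p ∣ 5 * g → p ∣ a := fun p hp hpg =>
    hp.dvd_of_dvd_pow (n := 3) (h1 ▸ hpg.trans ⟨5 * u, by ring⟩)
  obtain ⟨c, rfl⟩ := hdvd 5 (by norm_num) ⟨g, rfl⟩
  have hdvd' : ∀ p : ℕ, p.Prime → p ≠ 5 → p ∣ g → p ∣ c := fun p hp hp5 hpg =>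
    (Nat.Coprime.dvd_mul_left ((Nat.coprime_primes hp (by norm_num)).mpr hp5)).mp
      (hdvd p hp (hpg.mul_left 5))
  simp only [List.mem_cons, List.not_mem_nil, or_false] at hg
  rcases hg with rfl | rfl | rfl | rfl | rfl | rfl | rfl | rfl
  · apply cubicNorm_ne_4998 (2 * b) c
    simp only [cubicNorm, Matrix.cons_val]
    zify at heq
    linarith
  · obtain ⟨d, rfl⟩ := hdvd' 3 (by norm_num) (by norm_num) (by norm_num)
    apply cubicNorm_ne_1666 (2 * b) d
    simp only [cubicNorm, Matrix.cons_val]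
    zify at heq
    linarith
  · obtain ⟨d, rfl⟩ := hdvd' 17 (by norm_num) (by norm_num) (by norm_num)
    apply cubicNorm_ne_294 (2 * b) d
    simp only [cubicNorm, Matrix.cons_val]
    zify at heq
    linarith
  · exact hsieve (by simp) (5 * c) b heq'
  · obtain ⟨d, rfl⟩ := hdvd' 7 (by norm_num) (by norm_num) (by norm_num)
    obtain ⟨v, rfl⟩ : 7 ∣ u := by
      clear * - h1
      rw [mul_pow, mul_pow] at h1
      omega
    have h' : 4 * w = 49 * v ^ 2 + 2499 := by rw [h]; ring
    have hv : v = 5 * d ^ 3 := by linarith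
    have hb := cube_mod_seven b
    have hd : v ^ 2 % 7 = 0 ∨ v ^ 2 % 7 = 4 := by
      rw [hv, mul_pow, Nat.mul_mod, Nat.pow_mod (d ^ 3)]
      rcases cube_mod_seven d with h3 | h3 | h3 <;> rw [h3] <;> simp
    clear * - h' h2 hb hd
    omega
  · obtain ⟨v, rfl⟩ := nine_dvd_of_cube (u := u) (a := 5 * c) (c := 25 * 49) (by norm_num) (by rw [← h1]; ring)
    have h' : 4 * w = 81 * v ^ 2 + 2499 := by rw [h]; ring
    have := cube_mod_twentySeven b
    clear * - h' h2 this
    omega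
  · obtain ⟨d, rfl⟩ := hdvd' 17 (by norm_num) (by norm_num) (by norm_num)
    obtain ⟨e, rfl⟩ : 7 ∣ d := (Nat.Coprime.dvd_mul_left (by norm_num : Nat.Coprime 7 17)).mp
      (hdvd' 7 (by norm_num) (by norm_num) (by norm_num))
    apply cubicNorm_ne_6 (2 * b) e
    simp only [cubicNorm, Matrix.cons_val]
    zify at heq
    linarith
  · exact hsieve (by simp) (5 * c) b heq'

theorem no_solution_three {u w Y : ℕ} (hu : 1 < u) (h : 4 * w = u ^ 2 + 2499) : 25 * (u * w) ≠ Y ^ 3 := by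
  intro hY
  obtain ⟨g, hg, a, b, ⟨h1, h2⟩ | ⟨h1, h2⟩⟩ := descent h hY
  · exact no_solution_three_left hu h hg h1 h2
  · exact no_solution_three_right h hg h1 h2

/-- A vector can be moved into the fundamental domain `[ρ, ρ κ)` for the action of a matrix which
multiplies the linear functional `φ` by `κ`. -/
theorem exists_mem_fundamental_domain {d : ℕ} {M M' : Matrix (Fin d) (Fin d) ℤ} (hMM' : M * M' = 1)
    {φ : (Fin d → ℤ) → ℝ} {κ ρ : ℝ} (hκ : 1 < κ) (hρ : 0 < ρ) (hφ : ∀ v, φ (M *ᵥ v) = κ * φ v)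
    {P : (Fin d → ℤ) → Prop} (hP : ∀ v, P v → P (M *ᵥ v)) (hP' : ∀ v, P v → P (M' *ᵥ v))
    {v : Fin d → ℤ} (hv : P v) (hpos : 0 < φ v) :
    ∃ (n : ℕ) (v' : Fin d → ℤ), (v = M ^ n *ᵥ v' ∨ v = M' ^ n *ᵥ v') ∧ P v' ∧ ρ ≤ φ v' ∧ φ v' < ρ * κ := by
  have hκ0 : 0 < κ := one_pos.trans hκ
  have hM'M : M' * M = 1 := mul_eq_one_comm.mp hMM'
  have hcomm : Commute M M' := hMM'.trans hM'M.symm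
  have hφpow : ∀ (n : ℕ) v, φ (M ^ n *ᵥ v) = κ ^ n * φ v := by
    intro n v
    induction n with
    | zero => simp
    | succ n ih => rw [pow_succ', ← mulVec_mulVec, hφ, ih]; ring
  have hpow : ∀ N : Matrix (Fin d) (Fin d) ℤ, (∀ v, P v → P (N *ᵥ v)) → ∀ n : ℕ, P (N ^ n *ᵥ v) := by
    intro N hN n
    induction n with
    | zero => simpa using hv
    | succ n ih => rw [pow_succ', ← mulVec_mulVec]; exact hN _ ih
  have hinv : ∀ n : ℕ, M ^ n *ᵥ (M' ^ n *ᵥ v) = v := fun n => by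
    rw [mulVec_mulVec, ← hcomm.mul_pow, hMM', one_pow, one_mulVec]
  have hinv' : ∀ n : ℕ, M' ^ n *ᵥ (M ^ n *ᵥ v) = v := fun n => by
    rw [mulVec_mulVec, ← hcomm.symm.mul_pow, hM'M, one_pow, one_mulVec]
  obtain ⟨z, hz1, hz2⟩ := exists_mem_Ico_zpow (div_pos hpos hρ) hκ
  have hmain : ∃ (n : ℕ) (v' : Fin d → ℤ), (v = M ^ n *ᵥ v' ∨ v = M' ^ n *ᵥ v') ∧ P v' ∧
      φ v' / ρ = φ v / ρ / κ ^ z := by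
    obtain ⟨n, rfl | rfl⟩ := z.eq_nat_or_neg
    · refine ⟨n, M' ^ n *ᵥ v, Or.inl (hinv n).symm, hpow _ hP' n, ?_⟩
      have h1 := hφpow n (M' ^ n *ᵥ v)
      rw [hinv] at h1
      rw [h1, zpow_natCast]
      field_simp
    · refine ⟨n, M ^ n *ᵥ v, Or.inr (hinv' n).symm, hpow _ hP n, ?_⟩
      rw [hφpow, _root_.zpow_neg, zpow_natCast]
      field_simp
  obtain ⟨n, v', hvv', hv', hr⟩ := hmain
  have hκz : 0 < κ ^ z := zpow_pos hκ0 z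
  rw [zpow_add_one₀ hκ0.ne'] at hz2
  refine ⟨n, v', hvv', hv', ?_, ?_⟩
  · rw [← one_le_div hρ, hr, one_le_div hκz]
    exact hz1
  · rw [← div_lt_iff₀' hρ, hr, div_lt_iff₀ hκz, mul_comm]
    exact hz2

/-- Multiplication by the unit `50 + 7 √51` on the numbers `A √51 + B`. -/
def pellUnit : Matrix (Fin 2) (Fin 2) ℤ := !![50, 7; 357, 50]

/-- Multiplication by the unit `50 - 7 √51` on the numbers `A √51 + B`. -/
def pellUnitInv : Matrix (Fin 2) (Fin 2) ℤ := !![50, -7; -357, 50]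

theorem pellUnit_orbits : ∀ M ∈ [pellUnit, pellUnitInv],
    (∀ c ∈ ([3, 7] : List ℕ), orbitGood 8 4 (fun r v => r == 0 || v != [1, 8 - c]) M ![1, -(c : ℤ)] = true) ∧
    orbitGood 8 4 (fun _ v => v != [1, 5]) M ![1, 3] = true := by
  decide +kernel

theorem exists_pell_reduced {c : ℕ} (hc : c ∈ [3, 7]) {v : Fin 2 → ℤ}
    (hv : 51 * v 0 ^ 2 - v 1 ^ 2 = 51 - c ^ 2) (h0 : 0 < v 0) :
    ∃ (n : ℕ) (v' : Fin 2 → ℤ), (v' = ![1, -(c : ℤ)] ∨ c = 3 ∧ v' = ![1, 3]) ∧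
      (v = pellUnit ^ n *ᵥ v' ∨ v = pellUnitInv ^ n *ᵥ v') := by
  obtain ⟨h, hh0, hh⟩ : ∃ h : ℝ, 0 ≤ h ∧ h ^ 2 = 51 := ⟨√51, by positivity, Real.sq_sqrt (by norm_num)⟩
  have hhl : 7.141 < h := by
    by_contra! hlt
    nlinarith
  have hhu : h < 7.142 := by
    by_contra! hlt
    nlinarith
  have hprod : ∀ w : Fin 2 → ℤ, 51 * w 0 ^ 2 - w 1 ^ 2 = 51 - (c : ℤ) ^ 2 →
      (w 0 * h + w 1) * (w 0 * h - w 1) = 51 - (c : ℝ) ^ 2 := by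
    intro w hw
    have hw' : 51 * (w 0 : ℝ) ^ 2 - w 1 ^ 2 = 51 - (c : ℝ) ^ 2 := by exact_mod_cast hw
    rw [← hw', ← hh]
    ring
  have hcpos : (0 : ℝ) < 51 - (c : ℝ) ^ 2 := by
    simp only [List.mem_cons, List.not_mem_nil, or_false] at hc
    rcases hc with rfl | rfl <;> norm_num
  have hpos : 0 < (v 0 : ℝ) * h + v 1 := by
    have h1 := hprod v hv
    have h0' : (0 : ℝ) < v 0 := by exact_mod_cast h0
    have h2 : 0 < (v 0 : ℝ) * h := by positivity
    by_contra! hle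
    nlinarith [mul_nonneg (neg_nonneg.mpr hle) (by linarith : 0 ≤ (v 0 : ℝ) * h - v 1)]
  obtain ⟨n, v', hvv', hv', hl, hu⟩ := exists_mem_fundamental_domain (M := pellUnit) (M' := pellUnitInv)
    (φ := fun w => w 0 * h + w 1) (κ := 50 + 7 * h) (ρ := if c = 3 then 0.65 else 0.14)
    (P := fun w => 51 * w 0 ^ 2 - w 1 ^ 2 = 51 - (c : ℤ) ^ 2) (by decide +kernel) (by linarith)
    (by split_ifs <;> norm_num)
    (by
      intro w
      simp only [pellUnit, mulVec, dotProduct, Fin.sum_univ_two, Matrix.of_apply, Matrix.cons_val]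
      push_cast
      linear_combination (-7 * (w 0 : ℝ)) * hh)
    (by
      intro w hw
      simp only [pellUnit, mulVec, dotProduct, Fin.sum_univ_two, Matrix.of_apply, Matrix.cons_val]
      rw [← hw]
      ring)
    (by
      intro w hw
      simp only [pellUnitInv, mulVec, dotProduct, Fin.sum_univ_two, Matrix.of_apply, Matrix.cons_val]
      rw [← hw]
      ring) hv hpos
  refine ⟨n, v', ?_, hvv'⟩
  have hvv : v' = ![v' 0, v' 1] := by
    ext i
    fin_cases i <;> rfl
  have h1 := hprod v' hv'
  generalize hα : (v' 0 : ℝ) * h + v' 1 = α at *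
  generalize hβ : (v' 0 : ℝ) * h - v' 1 = β at *
  have hv0 : 2 * h * (v' 0 : ℝ) = α + β := by rw [← hα, ← hβ]; ring
  have hlow : 0 < v' 0 ∧ (v' 0 : ℝ) < 5 ∧ (c = 7 → (v' 0 : ℝ) < 2) := by
    have hα0 : 0 < α := lt_of_lt_of_le (by split_ifs <;> norm_num) hl
    have hβ0 : 0 < β := by
      by_contra! hle
      nlinarith
    have hV0 : 0 < (v' 0 : ℝ) := by
      by_contra! hle
      nlinarith
    refine ⟨by exact_mod_cast hV0, ?_⟩
    simp only [List.mem_cons, List.not_mem_nil, or_false] at hc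
    rcases hc with rfl | rfl
    · norm_num at hl hu h1 ⊢
      have hβu : β < 65 := by
        by_contra! hle
        nlinarith
      have : α + β < 66 := by
        by_contra! hle
        nlinarith
      by_contra! hle
      nlinarith
    · norm_num at hl hu h1 ⊢
      have hβu : β < 14.3 := by
        by_contra! hle
        nlinarith
      constructor <;>
      · by_contra! hle
        nlinarith
  obtain ⟨hlo, hu5, hu2⟩ := hlow
  have hu5' : v' 0 < 5 := by exact_mod_cast hu5
  have hu2' : c = 7 → v' 0 < 2 := fun h => by exact_mod_cast hu2 h
  have hb7 : c = 7 → v' 0 = 1 → v' 1 ≠ 7 := by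
    rintro rfl hb0 hb1
    rw [hb0, hb1] at hα
    norm_num at hα hu
    linarith
  have hb : v' 0 = 1 ∧ (v' 1 = -(c : ℤ) ∨ c = 3 ∧ v' 1 = 3) := by
    have habs : |v' 1| < 36 := by
      rw [← sq_lt_sq₀ (abs_nonneg _) (by norm_num), sq_abs]
      have hc7 : (c : ℤ) ^ 2 ≤ 49 := by
        simp only [List.mem_cons, List.not_mem_nil, or_false] at hc
        rcases hc with rfl | rfl <;> norm_num
      nlinarith
    rw [abs_lt] at habs
    obtain ⟨hb1, hb2⟩ := habs
    simp only [List.mem_cons, List.not_mem_nil, or_false] at hc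
    clear * - hv' hc hlo hu5' hu2' hb1 hb2 hb7
    generalize v' 0 = x at *
    generalize v' 1 = y at *
    rcases hc with rfl | rfl
    · have key : ∀ x ∈ Finset.Ioo (0 : ℤ) 5, ∀ y ∈ Finset.Ioo (-36 : ℤ) 36, 51 * x ^ 2 - y ^ 2 = 51 - (3 : ℕ) ^ 2 →
          x = 1 ∧ (y = -(3 : ℕ) ∨ 3 = 3 ∧ y = 3) := by decide +kernel
      exact key x (by simp [*]) y (by simp [*]) hv'
    · have hx : x = 1 := by
        have := hu2' rfl
        omega
      refine ⟨hx, ?_⟩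
      subst hx
      have h7 : y ^ 2 = ((7 : ℕ) : ℤ) ^ 2 := by linarith
      exact Or.inl ((sq_eq_sq_iff_eq_or_eq_neg.mp h7).resolve_left (hb7 rfl rfl))
  rw [hvv, hb.1]
  rcases hb.2 with h | ⟨rfl, h⟩ <;> simp [h]

theorem pellUnit_pow : ∀ M ∈ [pellUnit, pellUnitInv], ∀ n : ℕ, ∃ p q : ℤ,
    p ^ 2 - 51 * q ^ 2 = 1 ∧ M ^ n = !![p, q; 51 * q, p] ∧ (Even n ∧ 5 ∣ q ∨ Odd n ∧ 5 ∣ p) := by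
  intro M hM n
  have hM' : ∃ r s : ℤ, r ^ 2 - 51 * s ^ 2 = 1 ∧ M = !![r, s; 51 * s, r] ∧ 5 ∣ r := by
    simp only [List.mem_cons, List.not_mem_nil, or_false] at hM
    rcases hM with rfl | rfl
    exacts [⟨50, 7, by norm_num, by simp [pellUnit], by norm_num⟩,
      ⟨50, -7, by norm_num, by simp [pellUnitInv], by norm_num⟩]
  obtain ⟨r, s, hrs, hM', hr⟩ := hM'
  induction n with
  | zero => exact ⟨1, 0, by norm_num, by simp [Matrix.one_fin_two], by simp⟩
  | succ n ih =>
    obtain ⟨p, q, hpq, hn, hd⟩ := ih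
    refine ⟨p * r + 51 * (q * s), p * s + q * r, ?_, ?_, ?_⟩
    · linear_combination hpq * (r ^ 2 - 51 * s ^ 2) + hrs
    · rw [pow_succ, hn, hM']
      ext i j
      fin_cases i <;> fin_cases j <;> simp [Matrix.mul_apply] <;> ring
    · rcases hd with ⟨hn, hq⟩ | ⟨hn, hp⟩
      · exact Or.inr ⟨hn.add_one, dvd_add (hr.mul_left _) ((hq.mul_right _).mul_left _)⟩
      · exact Or.inl ⟨hn.add_one, dvd_add (hp.mul_right _) (hr.mul_left _)⟩

/-- The curve obtained from `51 n ^ 4 - c ^ 2 m ^ 4 = 51 - c ^ 2` by adjoining `√51`. -/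
def OnRelCurve (c : ℤ) (v : Fin 4 → ℤ) : Prop :=
  v 0 ^ 2 + 51 * v 1 ^ 2 - 2 * c * v 2 * v 3 = 1 ∧
    102 * v 0 * v 1 - c * (v 2 ^ 2 + 51 * v 3 ^ 2) = -c

theorem exists_onRelCurve {c : ℕ} (hc : c ∈ [3, 7]) {n m : ℤ} (hn : Odd n) (hm : Odd m)
    (h : 51 * n ^ 4 - c ^ 2 * m ^ 4 = 51 - c ^ 2) :
    ∃ p q : ℤ, p ^ 2 - 51 * q ^ 2 = 1 ∧ 5 ∣ q ∧ OnRelCurve c ![n * p, n * q, m * p, m * q] := by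
  have hn8 := Int.eight_dvd_sq_sub_one_of_odd hn
  have hm8 := Int.eight_dvd_sq_sub_one_of_odd hm
  have hres : residues 8 ![n ^ 2, -(c : ℤ) * m ^ 2] = [1, 8 - c] := by
    simp only [List.mem_cons, List.not_mem_nil, or_false] at hc
    rcases hc with rfl | rfl <;> simp [residues] <;> omega
  have hn0 : 0 < n ^ 2 := by
    have : n ≠ 0 := by rintro rfl; simp at hn
    positivity
  obtain ⟨k, v', hv', hvv'⟩ := exists_pell_reduced hc (v := ![n ^ 2, -(c : ℤ) * m ^ 2])
    (by simp only [Matrix.cons_val]; linear_combination h) hn0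
  obtain ⟨M, hM, hMv⟩ : ∃ M ∈ [pellUnit, pellUnitInv], ![n ^ 2, -(c : ℤ) * m ^ 2] = M ^ k *ᵥ v' := by
    rcases hvv' with hv | hv
    exacts [⟨_, by simp, hv⟩, ⟨_, by simp, hv⟩]
  obtain ⟨hgood1, hgood2⟩ := pellUnit_orbits M hM
  rcases hv' with rfl | ⟨rfl, rfl⟩
  · have hk := orbitGood_spec (by norm_num) (hgood1 c hc) k
    rw [← hMv, hres, bne_self_eq_false, Bool.or_false, beq_iff_eq] at hk
    obtain ⟨j, rfl⟩ : ∃ j, k = j + j := ⟨k / 2, by omega⟩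
    obtain ⟨p, q, hpq, hj, hd⟩ := pellUnit_pow M hM j
    have hq : 5 ∣ q := by
      rcases hd with hd | hd
      · exact hd.2
      · rw [Nat.odd_iff] at hd
        omega
    have e0 := congrFun hMv 0
    have e1 := congrFun hMv 1
    rw [pow_add, hj] at e0 e1
    simp [Matrix.mulVec, dotProduct, Fin.sum_univ_two, Matrix.mul_apply] at e0 e1
    refine ⟨p, -q, by rw [← hpq]; ring, hq.neg_right, ?_, ?_⟩ <;> simp only [Matrix.cons_val]
    · linear_combination (p ^ 2 + 51 * q ^ 2) * e0 - 2 * p * q * e1 + (p ^ 2 - 51 * q ^ 2 + 1) * hpq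
    · linear_combination -(102 * p * q) * e0 + (p ^ 2 + 51 * q ^ 2) * e1 - c * (p ^ 2 - 51 * q ^ 2 + 1) * hpq
  · have hk := orbitGood_spec (by norm_num) hgood2 k
    rw [← hMv, hres] at hk
    simp at hk

/-- Multiplication by the relative unit `(r₀ + r₁ √51) + (t₀ + t₁ √51) √(c √51)`. -/
def relUnit (c r₀ r₁ t₀ t₁ : ℤ) : Matrix (Fin 4) (Fin 4) ℤ :=
  !![r₀, 51 * r₁, c * t₀, 51 * c * t₁; r₁, r₀, c * t₁, c * t₀;
    51 * t₁, 51 * t₀, r₀, 51 * r₁; t₀, 51 * t₁, r₁, r₀]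

theorem OnRelCurve.relUnit_mulVec {c r₀ r₁ t₀ t₁ : ℤ} (h1 : r₀ ^ 2 + 51 * r₁ ^ 2 - 102 * c * t₀ * t₁ = 1)
    (h2 : 2 * r₀ * r₁ - c * (t₀ ^ 2 + 51 * t₁ ^ 2) = 0) {v : Fin 4 → ℤ} (hv : OnRelCurve c v) :
    OnRelCurve c (relUnit c r₀ r₁ t₀ t₁ *ᵥ v) := by
  obtain ⟨hv1, hv2⟩ := hv
  constructor <;>
    simp only [relUnit, mulVec, dotProduct, Fin.sum_univ_four, Matrix.of_apply, Matrix.cons_val]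
  · linear_combination (v 0 ^ 2 + 51 * v 1 ^ 2 - 2 * c * v 2 * v 3) * h1 +
      (102 * v 0 * v 1 - c * (v 2 ^ 2 + 51 * v 3 ^ 2)) * h2 + hv1
  · linear_combination (102 * v 0 * v 1 - c * (v 2 ^ 2 + 51 * v 3 ^ 2)) * h1 +
      51 * (v 0 ^ 2 + 51 * v 1 ^ 2 - 2 * c * v 2 * v 3) * h2 + hv2

/-- The linear form `h (x₀ + x₁ h²) + k (y₀ + y₁ h²)` on the relative curve. -/
def relEmb (h k : ℝ) (v : Fin 4 → ℤ) : ℝ := h * (v 0 + v 1 * h ^ 2) + k * (v 2 + v 3 * h ^ 2)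

theorem relEmb_relUnit {c r₀ r₁ t₀ t₁ : ℤ} {h k : ℝ} (hh : h ^ 4 = 51) (hk : k ^ 2 = c)
    (v : Fin 4 → ℤ) : relEmb h k (relUnit c r₀ r₁ t₀ t₁ *ᵥ v) =
      ((r₀ + r₁ * h ^ 2) + (t₀ + t₁ * h ^ 2) * (h * k)) * relEmb h k v := by
  simp only [relEmb, relUnit, mulVec, dotProduct, Fin.sum_univ_four, Matrix.of_apply, Matrix.cons_val]
  push_cast
  linear_combination -(h * r₁ * v 1 + h * c * t₁ * v 3 + k * r₁ * v 3 + k * (t₁ * v 0 + t₀ * v 1 +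
    t₁ * v 1 * h ^ 2)) * hh - (t₀ + t₁ * h ^ 2) * h * (v 2 + v 3 * h ^ 2) * hk

/-- The points of the relative curve in a box. -/
theorem relCurve_search : ∀ c ∈ ([3, 7] : List ℤ),
    ∀ x ∈ Finset.Icc (-8 : ℤ) 8, ∀ e ∈ Finset.Icc (-2 : ℤ) 2, ∀ y ∈ Finset.Icc (-6 : ℤ) 6,
    ∀ f ∈ Finset.Icc (-2 : ℤ) 2, (7 * x + e) ^ 2 + 51 * x ^ 2 - 2 * c * (7 * y + f) * y = 1 →
    102 * (7 * x + e) * x - c * ((7 * y + f) ^ 2 + 51 * y ^ 2) = -c →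
    x = 0 ∧ y = 0 ∧ |e| = 1 ∧ |f| = 1 := by
  decide +kernel

/-- The trivial points of the relative curve. -/
def relReps : List (Fin 4 → ℤ) := [![1, 0, 1, 0], ![1, 0, -1, 0], ![-1, 0, 1, 0], ![-1, 0, -1, 0]]

theorem mem_Icc_of_abs_lt {s A B : ℝ} (hsl : 7.141 < s) (hsu : s < 7.1415) {a b N : ℤ}
    (hA : |a + b * s| < A) (hB : |a - b * s| < B) (hN : A + B ≤ 14.282 * (N + 1))
    (hN' : B + 0.1415 * N ≤ 3) : b ∈ Finset.Icc (-N) N ∧ a - 7 * b ∈ Finset.Icc (-2) 2 := by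
  rw [abs_lt] at hA hB
  have hb : -(N + 1) < b ∧ b < N + 1 := by
    constructor
    · have : -((N : ℝ) + 1) < b := by
        by_contra! hle
        nlinarith
      exact_mod_cast this
    · have : (b : ℝ) < N + 1 := by
        by_contra! hle
        nlinarith
      exact_mod_cast this
  have hbl : -(N : ℝ) ≤ b := by exact_mod_cast (by omega : -N ≤ b)
  have hbu : (b : ℝ) ≤ N := by exact_mod_cast (by omega : b ≤ N)
  have he : -3 < a - 7 * b ∧ a - 7 * b < 3 := by
    constructor
    · have : (-3 : ℝ) < a - 7 * b := by nlinarith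
      exact_mod_cast this
    · have : (a : ℝ) - 7 * b < 3 := by nlinarith
      exact_mod_cast this
  rw [Finset.mem_Icc, Finset.mem_Icc]
  omega

set_option maxHeartbeats 800000 in
theorem mem_relReps_of_relEmb_le {c : ℕ} (hc : c ∈ [3, 7]) {h k : ℝ} (hh0 : 0 ≤ h) (hh : h ^ 4 = 51)
    (hk0 : 0 ≤ k) (hk : k ^ 2 = c) {v : Fin 4 → ℤ} (hv : OnRelCurve c v) (hpos : 0 < relEmb h k v)
    (hle : relEmb h k v ≤ 331) (hpos' : 0 < relEmb h (-k) v) (hle' : relEmb h (-k) v ≤ 331) :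
    v ∈ relReps := by
  have hc3 : (3 : ℝ) ≤ c ∧ (c : ℝ) ≤ 7 := by
    simp only [List.mem_cons, List.not_mem_nil, or_false] at hc
    rcases hc with rfl | rfl <;> norm_num
  obtain ⟨hc3, hc7⟩ := hc3
  obtain ⟨hv1, hv2⟩ := hv
  have hv1' : (v 0 : ℝ) ^ 2 + 51 * v 1 ^ 2 - 2 * c * v 2 * v 3 = 1 := by exact_mod_cast hv1
  have hv2' : 102 * (v 0 : ℝ) * v 1 - c * (v 2 ^ 2 + 51 * v 3 ^ 2) = -c := by exact_mod_cast hv2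
  rw [relEmb] at hpos hle hpos' hle'
  generalize hs : h ^ 2 = s at *
  have hs0 : 0 ≤ s := by rw [← hs]; positivity
  have hss : s ^ 2 = 51 := by rw [← hs, ← hh]; ring
  have hsl : 7.141 < s := by
    by_contra! hlt
    nlinarith
  have hsu : s < 7.1415 := by
    by_contra! hlt
    nlinarith
  have hhl : 2.672 < h := by
    by_contra! hlt
    nlinarith
  have hkl : 1.732 < k := by
    by_contra! hlt
    nlinarith
  have hconj : s * (v 0 - v 1 * s) ^ 2 + c * (v 2 - v 3 * s) ^ 2 = s + c := by
    linear_combination s * hv1' - hv2' + (s * (v 1 : ℝ) ^ 2 - 2 * v 0 * v 1 + c * v 3 ^ 2) * hss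
  generalize hX : (v 0 : ℝ) + v 1 * s = X at *
  generalize hY : (v 2 : ℝ) + v 3 * s = Y at *
  generalize hX' : (v 0 : ℝ) - v 1 * s = X' at *
  generalize hY' : (v 2 : ℝ) - v 3 * s = Y' at *
  have hX0 : 0 < X := by
    by_contra! hlt
    nlinarith
  have hX1 : X < 124 := by
    by_contra! hlt
    nlinarith
  have hY0 : -95.6 < Y := by
    by_contra! hlt
    nlinarith
  have hY1 : Y < 95.6 := by
    by_contra! hlt
    nlinarith
  have hX2 : |X'| < 1.41 := by
    have h1 : s * X' ^ 2 ≤ s + 7 := by linarith [mul_nonneg (by linarith : (0 : ℝ) ≤ c) (sq_nonneg Y')]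
    rw [← sq_lt_sq₀ (abs_nonneg _) (by norm_num), sq_abs]
    by_contra! hle
    linarith [mul_le_mul_of_nonneg_left hle hs0]
  have hY2 : |Y'| < 1.84 := by
    have h1 : c * Y' ^ 2 ≤ s + c := by linarith [mul_nonneg hs0 (sq_nonneg X')]
    rw [← sq_lt_sq₀ (abs_nonneg _) (by norm_num), sq_abs]
    by_contra! hle
    linarith [mul_le_mul_of_nonneg_left hle (by linarith : (0 : ℝ) ≤ c)]
  obtain ⟨hx1, he⟩ := mem_Icc_of_abs_lt (N := 8) hsl hsu
    (hX.symm ▸ abs_lt.mpr ⟨by linarith, hX1⟩ : |(v 0 : ℝ) + v 1 * s| < 124) (hX'.symm ▸ hX2)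
    (by norm_num) (by norm_num)
  obtain ⟨hy1, hf⟩ := mem_Icc_of_abs_lt (N := 6) hsl hsu
    (hY.symm ▸ abs_lt.mpr ⟨hY0, hY1⟩ : |(v 2 : ℝ) + v 3 * s| < 95.6) (hY'.symm ▸ hY2)
    (by norm_num) (by norm_num)
  obtain ⟨z1, z3, z0, z2⟩ := relCurve_search c
    (by simp only [List.mem_cons, List.not_mem_nil, or_false] at hc ⊢; exact_mod_cast hc)
    _ hx1 _ he _ hy1 _ hf
    (by rw [← hv1]; ring) (by rw [← hv2]; ring)
  have hvv : v = ![v 0, v 1, v 2, v 3] := by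
    ext i
    fin_cases i <;> rfl
  rw [z1, mul_zero, sub_zero] at z0
  rw [z3, mul_zero, sub_zero] at z2
  rw [hvv, z1, z3]
  rcases eq_or_eq_neg_of_abs_eq z0 with h0 | h0 <;> rcases eq_or_eq_neg_of_abs_eq z2 with h2 | h2 <;>
    simp [relReps, h0, h2]

/-- A relative unit on the curve with parameter `c`. -/
def curveUnit (c : ℕ) : Matrix (Fin 4) (Fin 4) ℤ :=
  if c = 3 then relUnit 3 6578 921 1421 199 else relUnit 7 50 7 7 1

/-- The inverse of the unit `curveUnit c`. -/
def curveUnitInv (c : ℕ) : Matrix (Fin 4) (Fin 4) ℤ :=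
  if c = 3 then relUnit 3 6578 921 (-1421) (-199) else relUnit 7 50 7 (-7) (-1)

theorem exists_relCurve_reduced {c : ℕ} (hc : c ∈ [3, 7]) {v : Fin 4 → ℤ} (hv : OnRelCurve c v)
    (hpos : 0 < (v 0 : ℝ) + v 1 * √51) :
    ∃ n : ℕ, ∃ v' ∈ relReps, v = curveUnit c ^ n *ᵥ v' ∨ v = curveUnitInv c ^ n *ᵥ v' := by
  obtain ⟨h, hh0, hh2⟩ : ∃ h : ℝ, 0 ≤ h ∧ h ^ 2 = √51 := ⟨√√51, by positivity, Real.sq_sqrt (by positivity)⟩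
  have hh : h ^ 4 = 51 := by
    rw [show h ^ 4 = (h ^ 2) ^ 2 by ring, hh2, Real.sq_sqrt (by norm_num)]
  obtain ⟨k, hk0, hk⟩ : ∃ k : ℝ, 0 ≤ k ∧ k ^ 2 = c := ⟨√c, by positivity, Real.sq_sqrt (by positivity)⟩
  rw [← hh2] at hpos
  have hsl : 7.141 < h ^ 2 := by
    by_contra! hlt
    nlinarith [sq_nonneg h]
  have hsu : h ^ 2 < 7.1415 := by
    by_contra! hlt
    nlinarith
  have hhl : 2.672 < h := by
    by_contra! hlt
    nlinarith
  have hhu : h < 2.6724 := by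
    by_contra! hlt
    nlinarith
  have hprod : ∀ w : Fin 4 → ℤ, OnRelCurve c w → relEmb h k w * relEmb h (-k) w = h ^ 2 - c := by
    intro w ⟨hw1, hw2⟩
    have hw1' : (w 0 : ℝ) ^ 2 + 51 * w 1 ^ 2 - 2 * c * w 2 * w 3 = 1 := by exact_mod_cast hw1
    have hw2' : 102 * (w 0 : ℝ) * w 1 - c * (w 2 ^ 2 + 51 * w 3 ^ 2) = -c := by exact_mod_cast hw2
    rw [relEmb, relEmb]
    linear_combination h ^ 2 * hw1' + hw2' - (w 2 + w 3 * h ^ 2) ^ 2 * hk +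
      (h ^ 2 * (w 1 : ℝ) ^ 2 + 2 * w 0 * w 1 - c * w 3 ^ 2) * hh
  have hemb : 0 < relEmb h k v := by
    have h1 := hprod v hv
    have h2 : relEmb h k v + relEmb h (-k) v = 2 * (h * (v 0 + v 1 * h ^ 2)) := by
      rw [relEmb, relEmb]
      ring
    have h3 : 0 < h * (v 0 + v 1 * h ^ 2) := mul_pos (by linarith) hpos
    have hc7 : (c : ℝ) ≤ 7 := by
      simp only [List.mem_cons, List.not_mem_nil, or_false] at hc
      rcases hc with rfl | rfl <;> norm_num
    by_contra! hle
    nlinarith [mul_nonneg (neg_nonneg.mpr hle) (by linarith : 0 ≤ relEmb h (-k) v)]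
  have hfin : ∀ v' : Fin 4 → ℤ, OnRelCurve c v' → 0 < relEmb h k v' → relEmb h k v' ≤ 331 →
      h ^ 2 - c ≤ 331 * relEmb h k v' → v' ∈ relReps := by
    intro v' hv' hp hle hge
    have h1 := hprod v' hv'
    have hc7 : 0 < h ^ 2 - c := by
      simp only [List.mem_cons, List.not_mem_nil, or_false] at hc
      rcases hc with rfl | rfl <;> norm_num <;> linarith
    refine mem_relReps_of_relEmb_le hc hh0 hh hk0 hk hv' hp hle ?_ ?_
    · rw [← h1] at hc7
      exact (pos_iff_pos_of_mul_pos hc7).mp hp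
    · rw [← h1, mul_comm 331] at hge
      exact le_of_mul_le_mul_left hge hp
  simp only [List.mem_cons, List.not_mem_nil, or_false] at hc
  rcases hc with rfl | rfl
  · have hku : k < 1.7321 := by
      by_contra! hlt
      norm_num at hk
      nlinarith
    have hhk : h * k < 4.63 := by nlinarith
    have hhk0 : 0 ≤ h * k := by positivity
    obtain ⟨n, v', hvv', hv', hl, hu⟩ := exists_mem_fundamental_domain (M := curveUnit 3)
      (M' := curveUnitInv 3) (φ := relEmb h k) (κ := ((6578 : ℤ) + (921 : ℤ) * h ^ 2) +
        ((1421 : ℤ) + (199 : ℤ) * h ^ 2) * (h * k)) (ρ := 0.01255) (P := OnRelCurve 3)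
      (by decide +kernel) (by push_cast; nlinarith) (by norm_num)
      (relEmb_relUnit hh (by exact_mod_cast hk))
      (fun v hv => hv.relUnit_mulVec (by norm_num) (by norm_num))
      (fun v hv => hv.relUnit_mulVec (by norm_num) (by norm_num)) hv hemb
    refine ⟨n, v', hfin v' hv' (by linarith) (hu.le.trans ?_) ?_, hvv'⟩
    · push_cast
      nlinarith
    · push_cast
      linarith
  · have hku : k < 2.646 := by
      by_contra! hlt
      norm_num at hk
      nlinarith
    have hhk : h * k < 7.08 := by nlinarith
    have hhk0 : 0 ≤ h * k := by positivity
    obtain ⟨n, v', hvv', hv', hl, hu⟩ := exists_mem_fundamental_domain (M := curveUnit 7)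
      (M' := curveUnitInv 7) (φ := relEmb h k) (κ := ((50 : ℤ) + (7 : ℤ) * h ^ 2) +
        ((7 : ℤ) + (1 : ℤ) * h ^ 2) * (h * k)) (ρ := 0.0266) (P := OnRelCurve 7)
      (by decide +kernel) (by push_cast; nlinarith) (by norm_num)
      (relEmb_relUnit hh (by exact_mod_cast hk))
      (fun v hv => hv.relUnit_mulVec (by norm_num) (by norm_num))
      (fun v hv => hv.relUnit_mulVec (by norm_num) (by norm_num)) hv hemb
    refine ⟨n, v', hfin v' hv' (by linarith) (hu.le.trans ?_) ?_, hvv'⟩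
    · push_cast
      nlinarith
    · push_cast
      linarith

/-- The condition `x₀ y₁ = x₁ y₀` fails modulo `25`, or `x₁` is nonzero modulo `5`. -/
def avoidsProportional (v : List ℕ) : Bool :=
  v.getD 0 0 * v.getD 3 0 % 25 != v.getD 1 0 * v.getD 2 0 % 25 || v.getD 1 0 % 5 != 0

theorem curveUnit_orbits : ∀ c ∈ ([3, 7] : List ℕ),
    ∀ M ∈ [(curveUnit c, curveUnitInv c), (curveUnitInv c, curveUnit c)], ∀ v ∈ relReps,
    M.1 * M.2 = 1 ∧
    orbitGood 25 30 (fun r w => avoidsProportional w || r == 0 ||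
      (r == 1 && relReps.contains (M.1 *ᵥ v)) || (r == 29 && relReps.contains (M.2 *ᵥ v)))
      M.1 v = true ∧
    M.1 ^ 30 = 1 + (5 : ℤ) ^ 2 • subOneDiv 25 (M.1 ^ 30) ∧
    v 1 = 0 ∧ v 3 = 0 ∧
    ¬ (5 : ℤ) ∣ v 0 * (subOneDiv 25 (M.1 ^ 30) *ᵥ v) 3 - (subOneDiv 25 (M.1 ^ 30) *ᵥ v) 1 * v 2 := by
  decide +kernel

theorem avoidsProportional_residues {v : Fin 4 → ℤ} (h : v 0 * v 3 = v 1 * v 2) (h5 : 5 ∣ v 1) :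
    avoidsProportional (residues 25 v) = false := by
  have hres : residues 25 v = [(v 0 % 25).toNat, (v 1 % 25).toNat, (v 2 % 25).toNat, (v 3 % 25).toNat] := by
    simp [residues]
  rw [avoidsProportional, hres, Bool.or_eq_false_iff, bne_eq_false_iff_eq, bne_eq_false_iff_eq]
  simp only [List.getD_cons_zero, List.getD_cons_succ]
  have hcast : ∀ x : ℤ, ((x % 25).toNat : ℤ) = x % 25 := fun x =>
    Int.toNat_of_nonneg (Int.emod_nonneg _ (by norm_num))
  constructor
  · zify
    rw [hcast, hcast, hcast, hcast, ← Int.mul_emod, ← Int.mul_emod, h]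
  · omega

/-- The only points with `x₀ y₁ = x₁ y₀` and `5 ∣ x₁` on the relative curve are the trivial ones. -/
theorem mem_relReps_of_proportional {c : ℕ} (hc : c ∈ [3, 7]) {v : Fin 4 → ℤ} (hv : OnRelCurve c v)
    (hpos : 0 < (v 0 : ℝ) + v 1 * √51) (hprop : v 0 * v 3 = v 1 * v 2) (h5 : 5 ∣ v 1) : v ∈ relReps := by
  obtain ⟨n, v', hv', hvv'⟩ := exists_relCurve_reduced hc hv hpos
  obtain ⟨M, hM, hMv⟩ : ∃ M ∈ [(curveUnit c, curveUnitInv c), (curveUnitInv c, curveUnit c)],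
      v = M.1 ^ n *ᵥ v' := by
    rcases hvv' with hv | hv
    exacts [⟨(_, _), List.mem_cons_self, hv⟩, ⟨(_, _), List.mem_cons_of_mem _ List.mem_cons_self, hv⟩]
  obtain ⟨hinv, hgood, -⟩ := curveUnit_orbits c hc M hM v' hv'
  have hn := orbitGood_spec (by norm_num) hgood n
  rw [← hMv, avoidsProportional_residues hprop h5] at hn
  simp only [Bool.false_or, Bool.or_eq_true, Bool.and_eq_true, beq_iff_eq, List.contains_iff_mem] at hn
  obtain ⟨q, v₀, hv₀, hq⟩ : ∃ q : ℕ, ∃ v₀ ∈ relReps, v = (M.1 ^ 30) ^ q *ᵥ v₀ := by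
    rcases hn with (hn | ⟨hn, hmem⟩) | ⟨hn, hmem⟩
    · refine ⟨n / 30, v', hv', ?_⟩
      rw [hMv, ← pow_mul]
      congr 2
      omega
    · refine ⟨n / 30, _, hmem, ?_⟩
      rw [hMv, ← pow_mul, mulVec_mulVec, ← pow_succ]
      congr 2
      omega
    · refine ⟨n / 30 + 1, _, hmem, ?_⟩
      rw [hMv, ← pow_mul, show 30 * (n / 30 + 1) = n + 1 by omega, mulVec_mulVec, pow_succ, mul_assoc,
        hinv, mul_one]
  obtain ⟨-, -, hpow, hv1, hv3, hne⟩ := curveUnit_orbits c hc M hM v₀ hv₀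
  rcases eq_or_ne q 0 with rfl | hq0
  · rw [pow_zero, one_mulVec] at hq
    rwa [hq]
  · obtain ⟨k, N, w, hN, hw⟩ := pow_mulVec_expansion (p := 5) (by norm_num) hpow hq0 v₀
    rw [← hq] at hw
    rw [hw 0, hw 1, hw 2, hw 3, hv1, hv3] at hprop
    generalize (subOneDiv 25 (M.1 ^ 30) *ᵥ v₀) = z at *
    have hz : ((5 : ℕ) : ℤ) ^ (k + 2) * (N * (v₀ 0 * z 3 - z 1 * v₀ 2) + 5 * (v₀ 0 * w 3 - v₀ 2 * w 1 +
        5 * (5 : ℤ) ^ k * ((N * z 0 + 5 * w 0) * (N * z 3 + 5 * w 3) -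
        (N * z 1 + 5 * w 1) * (N * z 2 + 5 * w 2)))) = 0 := by
      push_cast at hprop ⊢
      linear_combination hprop
    rw [mul_eq_zero, or_iff_right (by positivity)] at hz
    have hdvd : (5 : ℤ) ∣ N * (v₀ 0 * z 3 - z 1 * v₀ 2) := by
      rw [eq_neg_of_add_eq_zero_left hz]
      exact (dvd_mul_right _ _).neg_right
    rcases (Int.prime_iff_natAbs_prime.mpr (by norm_num : Nat.Prime (5 : ℤ).natAbs)).dvd_or_dvd hdvd with h5 | h5
    · exact absurd (by exact_mod_cast h5) hN
    · exact absurd h5 hne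

theorem eq_one_of_quartic {c : ℕ} (hc : c ∈ [3, 7]) {n m : ℕ} (hn : Odd n) (hm : Odd m)
    (h : 51 * n ^ 4 + c ^ 2 = c ^ 2 * m ^ 4 + 51) : n = 1 ∧ m = 1 := by
  obtain ⟨p, q, hpq, hq, hcurve⟩ := exists_onRelCurve hc (n := n) (m := m) (by exact_mod_cast hn)
    (by exact_mod_cast hm) (by zify at h; linarith)
  have hneg : ∀ p q : ℤ, 5 ∣ q → OnRelCurve c ![n * p, n * q, m * p, m * q] → 0 < (p : ℝ) + q * √51 →
      n = 1 ∧ m = 1 := by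
    intro p q hq hcurve hpos
    have hmem := mem_relReps_of_proportional hc hcurve (by
      simp only [Matrix.cons_val]
      push_cast
      rw [mul_assoc, ← mul_add]
      have : 0 < n := hn.pos
      positivity) (by simp only [Matrix.cons_val]; ring) (by simpa using hq.mul_left _)
    have hunit : IsUnit ((n : ℤ) * p) ∧ IsUnit ((m : ℤ) * p) := by
      simp only [relReps, List.mem_cons, List.not_mem_nil, or_false] at hmem
      rcases hmem with h | h | h | h <;>
      · have h0 := congrFun h 0
        have h2 := congrFun h 2
        simp only [Matrix.cons_val] at h0 h2
        rw [h0, h2]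
        simp
    exact ⟨by simpa [Int.ofNat_isUnit] using isUnit_of_mul_isUnit_left hunit.1,
      by simpa [Int.ofNat_isUnit] using isUnit_of_mul_isUnit_left hunit.2⟩
  have hne : (p : ℝ) + q * √51 ≠ 0 := by
    intro h0
    have h1 : ((p : ℝ) + q * √51) * (p - q * √51) = 1 := by
      have : (p : ℝ) ^ 2 - 51 * q ^ 2 = 1 := by exact_mod_cast hpq
      rw [← this]
      linear_combination -(q : ℝ) ^ 2 * Real.sq_sqrt (by norm_num : (0 : ℝ) ≤ 51)
    rw [h0, zero_mul] at h1
    exact zero_ne_one h1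
  rcases hne.lt_or_gt with hlt | hgt
  · refine hneg (-p) (-q) hq.neg_right ?_ (by push_cast; linarith)
    obtain ⟨h1, h2⟩ := hcurve
    constructor <;> simp only [Matrix.cons_val] at h1 h2 ⊢ <;> linarith
  · exact hneg p q hq hcurve hgt

theorem exists_mul_pow_of_coprime {A B D s k : ℕ} (hD : D ≠ 0) (hco : Nat.Coprime A B)
    (h : A * B = D * s ^ k) : ∃ d e n m, d * e = D ∧ A = d * n ^ k ∧ B = e * m ^ k := by
  have hde : Nat.gcd D A * Nat.gcd D B = D := by
    rw [← hco.gcd_mul, h, Nat.gcd_mul_right_right]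
  obtain ⟨a, ha⟩ := Nat.gcd_dvd_right D A
  obtain ⟨b, hb⟩ := Nat.gcd_dvd_right D B
  generalize Nat.gcd D A = d at *
  generalize Nat.gcd D B = e at *
  have hab : a * b = s ^ k := by
    rw [ha, hb] at h
    apply Nat.eq_of_mul_eq_mul_left (Nat.pos_of_ne_zero hD)
    rw [← h]
    nth_rewrite 1 [← hde]
    ring
  have hco' : Nat.Coprime a b := Nat.Coprime.coprime_dvd_left ⟨d, by rw [ha]; ring⟩
    (Nat.Coprime.coprime_dvd_right ⟨e, by rw [hb]; ring⟩ hco)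
  obtain ⟨⟨n, rfl⟩, m, rfl⟩ := exists_pow_of_coprime_mul_eq_pow hco' hab
  exact ⟨d, e, n, m, hde, ha, hb⟩

theorem fourth_pow_mod_three (n : ℕ) : n ^ 4 % 3 = 0 ∨ n ^ 4 % 3 = 1 := by
  have h : ∀ m < 3, m ^ 4 % 3 = 0 ∨ m ^ 4 % 3 = 1 := by decide
  rw [Nat.pow_mod]
  exact h _ (Nat.mod_lt _ (by norm_num))

theorem fourth_pow_mod_seventeen (n : ℕ) : n ^ 4 % 17 = 0 ∨ n ^ 4 % 17 = 1 ∨ n ^ 4 % 17 = 4 ∨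
    n ^ 4 % 17 = 13 ∨ n ^ 4 % 17 = 16 := by
  have h : ∀ m < 17, m ^ 4 % 17 = 0 ∨ m ^ 4 % 17 = 1 ∨ m ^ 4 % 17 = 4 ∨ m ^ 4 % 17 = 13 ∨
    m ^ 4 % 17 = 16 := by decide
  rw [Nat.pow_mod]
  exact h _ (Nat.mod_lt _ (by norm_num))

theorem odd_of_odd_mul_pow {d n k A : ℕ} (hk : k ≠ 0) (hA : Odd A) (h : A = d * n ^ k) : Odd n := by
  rw [h, Nat.odd_mul] at hA
  exact (Nat.odd_pow_iff hk).mp hA.2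

theorem eq_five_of_quartic {s t : ℕ} (h7 : ¬ 7 ∣ s) (h : 4 * t ^ 2 = 51 * s ^ 4 + 49) : t = 5 := by
  obtain ⟨A, hA⟩ : ∃ A, 2 * t = A + 7 := ⟨2 * t - 7, by
    have : 7 ≤ 2 * t := by nlinarith [Nat.zero_le (s ^ 4)]
    omega⟩
  have hodd : Odd A := ⟨t - 4, by omega⟩
  have hAB : A * (A + 14) = 51 * s ^ 4 := by nlinarith
  have hco : Nat.Coprime A (A + 14) := by
    rw [Nat.coprime_self_add_right, show 14 = 2 * 7 by norm_num]
    refine Nat.Coprime.mul_right (Nat.coprime_two_right.mpr hodd) ?_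
    rw [Nat.coprime_comm, Nat.Prime.coprime_iff_not_dvd (by norm_num)]
    intro hd
    have h1 : 7 ∣ 51 * s ^ 4 := hAB ▸ hd.mul_right _
    exact h7 (Nat.Prime.dvd_of_dvd_pow (by norm_num)
      ((Nat.Coprime.dvd_mul_left (by norm_num : Nat.Coprime 7 51)).mp h1))
  obtain ⟨d, e, n, m, hde, hn, hm⟩ := exists_mul_pow_of_coprime (by norm_num) hco hAB
  have hnodd := odd_of_odd_mul_pow (by norm_num) hodd hn
  have hmodd := odd_of_odd_mul_pow (by norm_num) (hodd.add_even (by decide)) hm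
  have hdmem : d ∈ Nat.divisors 51 := Nat.mem_divisors.mpr ⟨⟨e, hde.symm⟩, by norm_num⟩
  rw [show Nat.divisors 51 = {1, 3, 17, 51} by decide +kernel] at hdmem
  simp only [Finset.mem_insert, Finset.mem_singleton] at hdmem
  have hn3 := fourth_pow_mod_three n
  have hm3 := fourth_pow_mod_three m
  have hn17 := fourth_pow_mod_seventeen n
  rcases hdmem with rfl | rfl | rfl | rfl
  · obtain rfl : e = 51 := by clear * - hde; omega
    clear * - hn hm hn17
    omega
  · obtain rfl : e = 17 := by clear * - hde; omega
    obtain ⟨rfl, rfl⟩ := eq_one_of_quartic (c := 3) (by simp) hmodd hnodd (by clear * - hn hm; omega)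
    clear * - hn hA
    omega
  · obtain rfl : e = 3 := by clear * - hde; omega
    clear * - hn hm hn3
    omega
  · obtain rfl : e = 1 := by clear * - hde; omega
    clear * - hn hm hm3
    omega

theorem eq_twentyFive_of_quartic {s t : ℕ} (h : 4 * t ^ 2 = 2499 * s ^ 4 + 1) : t = 25 := by
  obtain ⟨A, hA⟩ : ∃ A, 2 * t = A + 1 := ⟨2 * t - 1, by
    have : 1 ≤ 2 * t := by nlinarith [Nat.zero_le (s ^ 4)]
    omega⟩
  have hodd : Odd A := ⟨t - 1, by omega⟩
  have hAB : A * (A + 2) = 2499 * s ^ 4 := by nlinarith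
  have hco : Nat.Coprime A (A + 2) := by
    rw [Nat.coprime_self_add_right]
    exact Nat.coprime_two_right.mpr hodd
  obtain ⟨d, e, n, m, hde, hn, hm⟩ := exists_mul_pow_of_coprime (by norm_num) hco hAB
  have hnodd := odd_of_odd_mul_pow (by norm_num) hodd hn
  have hmodd := odd_of_odd_mul_pow (by norm_num) (hodd.add_even (by decide)) hm
  have hdmem : d ∈ Nat.divisors 2499 := Nat.mem_divisors.mpr ⟨⟨e, hde.symm⟩, by norm_num⟩
  rw [show Nat.divisors 2499 = {1, 3, 17, 51, 49, 147, 833, 2499, 7, 21, 119, 357} by decide +kernel] at hdmem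
  simp only [Finset.mem_insert, Finset.mem_singleton] at hdmem
  have hn3 := fourth_pow_mod_three n
  have hm3 := fourth_pow_mod_three m
  have hn17 := fourth_pow_mod_seventeen n
  have hde' : d = 49 ∧ e = 51 := by
    clear * - hde hdmem hn hm hn3 hm3 hn17
    rcases hdmem with rfl | rfl | rfl | rfl | rfl | rfl | rfl | rfl | rfl | rfl | rfl | rfl
    · obtain rfl : e = 2499 := by clear * - hde; omega
      clear hn3 hm3
      omega
    · obtain rfl : e = 833 := by clear * - hde; omega
      clear hn3 hm3
      omega
    · obtain rfl : e = 147 := by clear * - hde; omega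
      clear hn17
      omega
    · obtain rfl : e = 49 := by clear * - hde; omega
      clear hn17
      omega
    · exact ⟨rfl, by clear * - hde; omega⟩
    · obtain rfl : e = 17 := by clear * - hde; omega
      clear hn3 hm3
      omega
    · obtain rfl : e = 3 := by clear * - hde; omega
      clear * - hn hm hn3
      have h3 : (833 * n ^ 4 + 2) % 3 = 0 := by rw [← hn, hm]; exact Nat.mul_mod_right 3 _
      clear hn hm
      omega
    · obtain rfl : e = 1 := by clear * - hde; omega
      clear * - hn hm hm3
      omega
    · obtain rfl : e = 357 := by clear * - hde; omega
      clear hn3 hm3 hn17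
      omega
    · obtain rfl : e = 119 := by clear * - hde; omega
      clear hn3 hm3 hn17
      omega
    · obtain rfl : e = 21 := by clear * - hde; omega
      clear hn3 hm3 hn17
      omega
    · obtain rfl : e = 7 := by clear * - hde; omega
      clear hn3 hm3 hn17
      omega
  obtain ⟨rfl, rfl⟩ := hde'
  obtain ⟨rfl, rfl⟩ := eq_one_of_quartic (c := 7) (by simp) hmodd hnodd (by clear * - hn hm; omega)
  clear * - hn hA
  omega

theorem eq_zero_of_mod_seventeen : ∀ s < 17, ∀ t < 17, 4 * t ^ 2 % 17 = 3 * s ^ 4 % 17 → s = 0 ∧ t = 0 := by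
  decide

theorem eq_zero_of_mod_three : ∀ s < 3, ∀ t < 3, 4 * t ^ 2 % 3 = 17 * s ^ 4 % 3 → s = 0 ∧ t = 0 := by
  decide

theorem descent_two {u w Y : ℕ} (h : 4 * w = u ^ 2 + 2499) (hY : 25 * (u * w) = Y ^ 2) :
    ∃ g ∈ [1, 3, 17, 51], ∃ s t, u = g * s ^ 2 ∧ w = g * t ^ 2 := by
  obtain ⟨g, hg, s, t, hs, ht⟩ : ∃ g ∈ [1, 3, 17, 51, 49, 147, 833, 2499], ∃ s t, u * g = s ^ 2 ∧
      w = g * t ^ 2 := by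
    obtain ⟨g, hg, a, b, ⟨h1, h2⟩ | ⟨h1, h2⟩⟩ := descent h hY
    · have h5 : Nat.Coprime 5 g := by
        simp only [List.mem_cons, List.not_mem_nil, or_false] at hg
        rcases hg with rfl | rfl | rfl | rfl | rfl | rfl | rfl | rfl <;> norm_num
      obtain ⟨c, rfl⟩ := five_dvd_of_eq h5 h2
      exact ⟨g, hg, a, c, h1, by linarith⟩
    · obtain ⟨c, rfl⟩ : 5 ∣ a := Nat.Prime.dvd_of_dvd_pow (n := 2) (by norm_num) ⟨5 * (u * g), by rw [← h1]; ring⟩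
      exact ⟨g, hg, c, b, by linarith, h2⟩
  obtain ⟨g, hg, s, t, hs, ht⟩ : ∃ g ∈ [1, 3, 17, 51], ∃ s t, u * g = s ^ 2 ∧ w = g * t ^ 2 := by
    have h49 : ∀ g ∈ [1, 3, 17, 51], u * (49 * g) = s ^ 2 → w = 49 * g * t ^ 2 →
        ∃ g ∈ [1, 3, 17, 51], ∃ s t, u * g = s ^ 2 ∧ w = g * t ^ 2 := by
      intro g hg hs ht
      obtain ⟨c, rfl⟩ : 7 ∣ s := Nat.Prime.dvd_of_dvd_pow (n := 2) (by norm_num) ⟨7 * (u * g), by rw [← hs]; ring⟩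
      exact ⟨g, hg, c, 7 * t, by linarith, by rw [ht]; ring⟩
    simp only [List.mem_cons, List.not_mem_nil, or_false] at hg
    rcases hg with rfl | rfl | rfl | rfl | rfl | rfl | rfl | rfl
    exacts [⟨1, by simp, s, t, hs, ht⟩, ⟨3, by simp, s, t, hs, ht⟩, ⟨17, by simp, s, t, hs, ht⟩,
      ⟨51, by simp, s, t, hs, ht⟩, h49 1 (by simp) hs ht, h49 3 (by simp) hs ht, h49 17 (by simp) hs ht,
      h49 51 (by simp) hs ht]
  have hsq : Squarefree g := by
    simp only [List.mem_cons, List.not_mem_nil, or_false] at hg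
    rcases hg with rfl | rfl | rfl | rfl
    exacts [squarefree_one, Nat.prime_three.squarefree, (by norm_num : Nat.Prime 17).squarefree,
      (Nat.squarefree_mul (by norm_num : Nat.Coprime 3 17)).mpr
        ⟨Nat.prime_three.squarefree, (by norm_num : Nat.Prime 17).squarefree⟩]
  obtain ⟨c, rfl⟩ := (hsq.dvd_pow_iff_dvd two_ne_zero).mp ⟨u, by rw [← hs]; ring⟩
  refine ⟨g, hg, c, t, ?_, ht⟩
  apply Nat.eq_of_mul_eq_mul_right (Nat.pos_of_ne_zero hsq.ne_zero)
  rw [hs]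
  ring

theorem eq_of_square {u w Y : ℕ} (hu : 53 ≤ u) (h : 4 * w = u ^ 2 + 2499) (hY : 25 * (u * w) = Y ^ 2) :
    u = 2499 := by
  obtain ⟨g, hg, s, t, rfl, rfl⟩ := descent_two h hY
  simp only [List.mem_cons, List.not_mem_nil, or_false] at hg
  rcases hg with rfl | rfl | rfl | rfl
  · exfalso
    have h' : 4 * t ^ 2 = s ^ 4 + 2499 := by linarith
    have hs : 8 ≤ s := by
      by_contra! hlt
      interval_cases s <;> omega
    have ht : s ^ 2 + 1 ≤ 2 * t := by
      by_contra! hlt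
      nlinarith
    have hs' : s ≤ 35 := by
      by_contra! hlt
      nlinarith
    obtain ⟨D, hD⟩ : ∃ D, 2 * t = s ^ 2 + D := ⟨2 * t - s ^ 2, by omega⟩
    have hprod : D * (D + 2 * s ^ 2) = 2499 := by nlinarith
    have hD' : D < 50 := by
      by_contra! hlt
      nlinarith
    clear * - hprod hD' hs hs'
    interval_cases s <;> interval_cases D <;> omega
  · exfalso
    have h' : 4 * t ^ 2 = 3 * s ^ 4 + 833 := by linarith
    have hmod := eq_zero_of_mod_seventeen (s % 17) (Nat.mod_lt _ (by norm_num)) (t % 17)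
      (Nat.mod_lt _ (by norm_num)) (by
        rw [Nat.mul_mod, ← Nat.pow_mod, Nat.mul_mod 3, ← Nat.pow_mod s, ← Nat.mul_mod, ← Nat.mul_mod, h']
        omega)
    obtain ⟨a, rfl⟩ := Nat.dvd_of_mod_eq_zero hmod.1
    obtain ⟨b, rfl⟩ := Nat.dvd_of_mod_eq_zero hmod.2
    rw [mul_pow, mul_pow] at h'
    omega
  · exfalso
    have h' : 4 * t ^ 2 = 17 * s ^ 4 + 147 := by linarith
    have hmod := eq_zero_of_mod_three (s % 3) (Nat.mod_lt _ (by norm_num)) (t % 3)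
      (Nat.mod_lt _ (by norm_num)) (by
        rw [Nat.mul_mod, ← Nat.pow_mod, Nat.mul_mod 17, ← Nat.pow_mod s, ← Nat.mul_mod, ← Nat.mul_mod, h']
        omega)
    obtain ⟨a, rfl⟩ := Nat.dvd_of_mod_eq_zero hmod.1
    obtain ⟨b, rfl⟩ := Nat.dvd_of_mod_eq_zero hmod.2
    rw [mul_pow, mul_pow] at h'
    omega
  · have h' : 4 * t ^ 2 = 51 * s ^ 4 + 49 := by linarith
    have hone : ∀ n : ℕ, n ^ 4 = 1 → n = 1 := fun n hn => by simpa using hn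
    by_cases h7 : 7 ∣ s
    · obtain ⟨a, rfl⟩ := h7
      obtain ⟨b, rfl⟩ : 7 ∣ t := by
        have : 7 ∣ 4 * t ^ 2 := ⟨7 * (2499 * a ^ 4 + 1), by rw [h']; ring⟩
        exact Nat.Prime.dvd_of_dvd_pow (by norm_num)
          ((Nat.Coprime.dvd_mul_left (by norm_num : Nat.Coprime 7 4)).mp this)
      have hb := eq_twentyFive_of_quartic (s := a) (t := b) (by linarith)
      subst hb
      have ha := hone a (by linarith)
      subst ha
      norm_num
    · have ht := eq_five_of_quartic h7 h'
      subst ht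
      have hs := hone s (by linarith)
      subst hs
      omega

theorem sum_fifty_consecutive_cubes (x : ℤ) :
    4 * ∑ i ∈ Finset.range 50, (x + (i : ℤ) + 1) ^ 3 = 25 * ((2 * x + 51) * ((2 * x + 51) ^ 2 + 2499)) := by
  simp only [Finset.sum_range_succ, Finset.sum_range_zero]
  push_cast
  ring

/-- The only solutions in integers `x ≥ 1`, `y` to
`(x+1)³ + (x+2)³ + ⋯ + (x+50)³ = yˡ` with `ℓ` prime are
`(x, y, ℓ) = (1224, ±312375, 2)`. -/
theorem sum_fifty_consecutive_cubes_perfect_power (ℓ : ℕ) (hℓ : ℓ.Prime)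
    (x y : ℤ) (hx : 1 ≤ x) :
    (∑ i ∈ Finset.range 50, (x + (i : ℤ) + 1) ^ 3) = y ^ ℓ ↔
      (x = 1224 ∧ y = 312375 ∧ ℓ = 2) ∨ (x = 1224 ∧ y = -312375 ∧ ℓ = 2) := by
  have hsum := sum_fifty_consecutive_cubes x
  constructor
  · intro h
    rw [h] at hsum
    obtain ⟨u, hu⟩ : ∃ u : ℕ, (u : ℤ) = 2 * x + 51 := ⟨(2 * x + 51).toNat, by omega⟩
    obtain ⟨w, hw⟩ : ∃ w : ℕ, 4 * w = u ^ 2 + 2499 := by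
      have hodd : Odd u := by
        rw [Nat.odd_iff]
        omega
      obtain ⟨k, hk⟩ := hodd
      exact ⟨k ^ 2 + k + 625, by rw [hk]; ring⟩
    have hyw : y ^ ℓ = 25 * (u * w) := by
      have hw' : 4 * (w : ℤ) = (u : ℤ) ^ 2 + 2499 := by exact_mod_cast hw
      rw [← hu, ← hw'] at hsum
      linarith
    have hY : 25 * (u * w) = y.natAbs ^ ℓ := by
      rw [← Int.natAbs_pow, hyw]
      norm_cast
    have hu1 : 1 < u := by omega
    rcases lt_or_ge ℓ 11 with hlt | hge
    · interval_cases ℓ <;> norm_num at hℓ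
      · have hu' := eq_of_square (by omega) hw hY
        obtain rfl : x = 1224 := by omega
        have hy : y ^ 2 = 312375 ^ 2 := by linarith
        rcases sq_eq_sq_iff_eq_or_eq_neg.mp hy with rfl | rfl <;> simp
      · exact absurd hY (no_solution_three hu1 hw)
      · exact absurd hY (no_solution_five hw)
      · exact absurd hY (no_solution_seven hw)
    · exact absurd hY (no_solution_of_eleven_le hu1 hw hℓ hge)
  · rintro (⟨rfl, rfl, rfl⟩ | ⟨rfl, rfl, rfl⟩) <;> linarith
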